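/- Let T be a bounded operator on a complex separable Hilbert space K. Assume: (i) T is irreducible; (ii) T is homogeneous; (iii) T is a bilateral 2-shift, i.e. there is a family (K_n)_{n ∈ ℤ} of mutually orthogonal closed subspaces of K whose closed linear span is all of K, such that T maps K_n into K_{n+1} for every n ∈ ℤ, and K_n has dimension 2 for all but finitely many n ∈ ℤ. Then T is unitarily equivalent to one of the following operators on ℓ²(ℤ,ℂ) ⊕ ℓ²(ℤ,ℂ): T(a, b, α) for some 0 < a < b < 1 and α > 0; or B(λ, ia, α) for some λ ∈ (−1, 1], real a > 0 and α > 0; or B(λ, α) for some λ ∈ (−1, 1) and α > 0. -/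

import Mathlib

noncomputable section

open ContinuousLinearMap

/-- The Hilbert space `ℓ²(ℤ, ℂ)`. -/
abbrev H : Type := lp (fun _ : ℤ => ℂ) 2

/-- The standard orthonormal basis vectors of `ℓ²(ℤ, ℂ)`. -/
def e (n : ℤ) : H := lp.single 2 n 1

/-- The `2 × 2` upper-triangular block operator `[[T₁, S], [0, T₂]]` on the Hilbert space
direct sum `E ⊕ E = WithLp 2 (E × E)`. -/
def blockOp {E : Type*} [NormedAddCommGroup E] [NormedSpace ℂ E]
    (T₁ S T₂ : E →L[ℂ] E) : WithLp 2 (E × E) →L[ℂ] WithLp 2 (E × E) :=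
  ((WithLp.prodContinuousLinearEquiv 2 ℂ E E).symm :
      E × E →L[ℂ] WithLp 2 (E × E)) ∘L
    ((((T₁ ∘L fst ℂ E E) + (S ∘L snd ℂ E E)).prod (T₂ ∘L snd ℂ E E)) ∘L
      ((WithLp.prodContinuousLinearEquiv 2 ℂ E E) :
        WithLp 2 (E × E) →L[ℂ] E × E))

/-- Unitary equivalence of bounded operators on (possibly different) complex Hilbert spaces:
there is a unitary (= surjective linear isometry) `U` with `U A U⁻¹ = B`. -/
def UnitarilyEquiv {E F : Type*} [NormedAddCommGroup E] [NormedSpace ℂ E]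
    [NormedAddCommGroup F] [NormedSpace ℂ F] (A : E →L[ℂ] E) (B : F →L[ℂ] F) : Prop :=
  ∃ U : E ≃ₗᵢ[ℂ] F, ∀ x, U (A x) = B (U x)

/-- The Möbius transform `e^{iθ} (T - c·1)(1 - c̄·T)⁻¹` of an operator. -/
def mobius {E : Type*} [NormedAddCommGroup E] [NormedSpace ℂ E] [CompleteSpace E]
    (θ : ℝ) (c : ℂ) (T : E →L[ℂ] E) : E →L[ℂ] E :=
  Complex.exp (θ * Complex.I) •
    ((T - c • (1 : E →L[ℂ] E)) * Ring.inverse (1 - (starRingEnd ℂ c) • T))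

/-- A bounded operator on a complex Hilbert space is homogeneous if its spectrum lies in the
closed unit disc and all its Möbius transforms are unitarily equivalent to it. -/
def Homogeneous {E : Type*} [NormedAddCommGroup E] [NormedSpace ℂ E] [CompleteSpace E]
    (T : E →L[ℂ] E) : Prop :=
  spectrum ℂ T ⊆ Metric.closedBall 0 1 ∧
    ∀ (θ : ℝ) (c : ℂ), ‖c‖ < 1 →
      IsUnit (1 - (starRingEnd ℂ c) • T) ∧ UnitarilyEquiv (mobius θ c T) T

/-- A bounded operator is irreducible if the only closed subspaces invariant under both the
operator and its adjoint are `{0}` and the whole space. -/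
def IrreducibleOp {E : Type*} [NormedAddCommGroup E] [InnerProductSpace ℂ E] [CompleteSpace E]
    (T : E →L[ℂ] E) : Prop :=
  ∀ M : Submodule ℂ E, IsClosed (M : Set E) → (∀ x ∈ M, T x ∈ M) →
    (∀ x ∈ M, ContinuousLinearMap.adjoint T x ∈ M) → M = ⊥ ∨ M = ⊤

/-- Weight sequence of the shift `B_{λ, ia}`. -/
def wB (l a : ℝ) (n : ℤ) : ℂ :=
  ((n : ℂ) + (1 + (l : ℂ)) / 2 + Complex.I * (a : ℂ)) /
    ((n : ℂ) + (1 + (l : ℂ)) / 2 - Complex.I * (a : ℂ))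

/-- Weight sequence of the shift `T(a, b)`. -/
def wT (a b : ℝ) (n : ℤ) : ℂ := (Real.sqrt (((n : ℝ) + a) / ((n : ℝ) + b)) : ℂ)

/-- Weight sequence of the shift `S[λ]`. -/
def wS (l : ℝ) (n : ℤ) : ℂ := ((l : ℂ) + 2 * (n : ℂ) + 1)⁻¹

namespace TwoShift

open scoped InnerProductSpace ComplexConjugate

variable {K : Type*} [NormedAddCommGroup K] [InnerProductSpace ℂ K] [CompleteSpace K]

/-- The kernel of an operator commuting with `T` and its adjoint is trivial when `T` is
irreducible. -/
lemma ker_eq_bot_or_eq_zero {T : K →L[ℂ] K} (hirr : IrreducibleOp T) {g : K →L[ℂ] K}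
    (h1 : g * T = T * g) (h2 : g * star T = star T * g) :
    (∀ x, g x = 0 → x = 0) ∨ g = 0 := by
  have hk : ∀ x, x ∈ LinearMap.ker (g : K →ₗ[ℂ] K) ↔ g x = 0 := fun x => by simp
  have hT : ∀ S : K →L[ℂ] K, g * S = S * g → ∀ x ∈ LinearMap.ker (g : K →ₗ[ℂ] K),
      S x ∈ LinearMap.ker (g : K →ₗ[ℂ] K) := by
    intro S hS x hx
    rw [hk] at hx ⊢
    have : g (S x) = S (g x) := DFunLike.congr_fun hS x
    rw [this, hx, map_zero]
  rcases hirr (LinearMap.ker (g : K →ₗ[ℂ] K)) g.isClosed_ker (hT T h1) (hT (star T) h2)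
    with h | h
  · left
    intro x hx
    have : x ∈ LinearMap.ker (g : K →ₗ[ℂ] K) := (hk x).2 hx
    rw [h] at this
    simpa using this
  · right
    ext x
    have : x ∈ LinearMap.ker (g : K →ₗ[ℂ] K) := by rw [h]; trivial
    simpa using (hk x).1 this

/-- Schur's lemma for self-adjoint operators in the commutant. -/
lemma schur_selfAdjoint [Nontrivial K] {T : K →L[ℂ] K} (hirr : IrreducibleOp T) {a : K →L[ℂ] K}
    (ha : IsSelfAdjoint a) (h1 : a * T = T * a) : ∃ c : ℝ, a = (c : ℂ) • 1 := by
  have h2 : a * star T = star T * a := by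
    have := congrArg star h1
    rw [star_mul, star_mul, ha.star_eq] at this
    exact this.symm
  have hcomm : ∀ f : ℝ → ℝ, Continuous f →
      (∀ x, cfc f a x = 0 → x = 0) ∨ cfc f a = 0 := by
    intro f _
    apply ker_eq_bot_or_eq_zero hirr
    · exact Commute.cfc_real (a := a) (b := T) h1 f
    · exact Commute.cfc_real (a := a) (b := star T) h2 f
  obtain ⟨c, hc⟩ : (spectrum ℝ a).Nonempty := ContinuousFunctionalCalculus.spectrum_nonempty a ha
  have hsub : spectrum ℝ a ⊆ {c} := by
    intro d hd
    by_contra hne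
    have hne : d ≠ c := hne
    obtain ⟨x, y, hx, hy, hxy⟩ : ∃ x y, x ∈ spectrum ℝ a ∧ y ∈ spectrum ℝ a ∧ x < y := by
      rcases lt_or_gt_of_ne hne with h | h
      · exact ⟨d, c, hd, hc, h⟩
      · exact ⟨c, d, hc, hd, h⟩
    set m := (x + y) / 2
    set f : ℝ → ℝ := fun t => max 0 (m - t)
    set g : ℝ → ℝ := fun t => max 0 (t - m)
    have hf : Continuous f := by fun_prop
    have hg : Continuous g := by fun_prop
    have hf0 : cfc f a ≠ 0 := by
      intro h
      have hm := cfc_map_spectrum f a ha hf.continuousOn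
      rw [h, spectrum.zero_eq] at hm
      have : f x ∈ ({0} : Set ℝ) := by rw [hm]; exact ⟨x, hx, rfl⟩
      have h3 : max 0 (m - x) = 0 := this
      have : m - x ≤ 0 := by rw [← h3]; exact le_max_right _ _
      simp only [m] at this
      linarith
    have hg0 : cfc g a ≠ 0 := by
      intro h
      have hm := cfc_map_spectrum g a ha hg.continuousOn
      rw [h, spectrum.zero_eq] at hm
      have : g y ∈ ({0} : Set ℝ) := by rw [hm]; exact ⟨y, hy, rfl⟩
      have h3 : max 0 (y - m) = 0 := this
      have : y - m ≤ 0 := by rw [← h3]; exact le_max_right _ _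
      simp only [m] at this
      linarith
    have hmul : cfc g a * cfc f a = 0 := by
      rw [← cfc_mul g f a hg.continuousOn hf.continuousOn]
      have : (fun t => g t * f t) = fun _ => (0 : ℝ) := by
        funext t
        simp only [f, g]
        rcases le_total t m with h | h
        · rw [max_eq_left (by linarith : t - m ≤ 0)]; simp
        · rw [max_eq_left (by linarith : m - t ≤ 0)]; simp
      rw [this]
      simp
    rcases hcomm g hg with h | h
    · apply hf0
      ext z
      exact h _ (by simpa using DFunLike.congr_fun hmul z)
    · exact hg0 h
  refine ⟨c, ?_⟩
  have := CFC.eq_algebraMap_of_spectrum_subset_singleton (R := ℝ) a c hsub ha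
  rw [this, Algebra.algebraMap_eq_smul_one]
  ext x
  simp

/-- Schur's lemma. -/
lemma schur [Nontrivial K] {T : K →L[ℂ] K} (hirr : IrreducibleOp T) {a : K →L[ℂ] K}
    (h1 : a * T = T * a) (h2 : a * star T = star T * a) : ∃ c : ℂ, a = c • 1 := by
  have h3 : star a * T = T * star a := by
    have := congrArg star h2
    rw [star_mul, star_mul, star_star] at this
    exact this.symm
  obtain ⟨c, hc⟩ := schur_selfAdjoint hirr (a := (realPart a : K →L[ℂ] K)) (realPart a).2 (by
    rw [realPart_apply_coe]
    simp only [smul_add, add_mul, mul_add, smul_mul_assoc, mul_smul_comm, h1, h3])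
  obtain ⟨d, hd⟩ := schur_selfAdjoint hirr (a := (imaginaryPart a : K →L[ℂ] K))
    (imaginaryPart a).2 (by
    rw [imaginaryPart_apply_coe]
    simp only [smul_sub, sub_mul, mul_sub, smul_mul_assoc, mul_smul_comm, h1, h3])
  refine ⟨c + Complex.I * d, ?_⟩
  conv_lhs => rw [← realPart_add_I_smul_imaginaryPart a, hc, hd]
  rw [add_smul, smul_smul]

/-- Weak compactness of balls along an ultrafilter. -/
lemma exists_weak_limit {ι : Type*} (l : Ultrafilter ι) (f : ι → K) {C : ℝ}
    (hf : ∀ᶠ i in (l : Filter ι), ‖f i‖ ≤ C) :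
    ∃ ξ : K, ‖ξ‖ ≤ C ∧ ∀ y, Filter.Tendsto (fun i => ⟪y, f i⟫_ℂ) l (nhds ⟪y, ξ⟫_ℂ) := by
  have hC : 0 ≤ C := by
    obtain ⟨i, hi⟩ := hf.exists
    exact (norm_nonneg _).trans hi
  have hlim : ∀ y : K, ∃ c : ℂ, ‖c‖ ≤ C * ‖y‖ ∧
      Filter.Tendsto (fun i => ⟪f i, y⟫_ℂ) l (nhds c) := by
    intro y
    have hcpt := isCompact_closedBall (0 : ℂ) (C * ‖y‖)
    have : ∀ᶠ i in (l : Filter ι), ⟪f i, y⟫_ℂ ∈ Metric.closedBall (0 : ℂ) (C * ‖y‖) := by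
      filter_upwards [hf] with i hi
      rw [mem_closedBall_zero_iff]
      exact (norm_inner_le_norm _ _).trans (by gcongr)
    obtain ⟨c, hc, hl⟩ := hcpt.ultrafilter_le_nhds (l.map fun i => ⟪f i, y⟫_ℂ)
      (by rw [Filter.le_principal_iff]; exact this)
    exact ⟨c, by simpa using hc, hl⟩
  choose L hL1 hL2 using hlim
  let φ : K →ₗ[ℂ] ℂ :=
    { toFun := L
      map_add' := fun x y => by
        refine tendsto_nhds_unique (hL2 (x + y)) ?_
        simp only [inner_add_right]
        exact (hL2 x).add (hL2 y)
      map_smul' := fun c x => by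
        refine tendsto_nhds_unique (hL2 (c • x)) ?_
        simp only [inner_smul_right, RingHom.id_apply, smul_eq_mul]
        exact (hL2 x).const_mul c }
  let φc : StrongDual ℂ K := φ.mkContinuous C hL1
  have hξ : ∀ y, ⟪(InnerProductSpace.toDual ℂ K).symm φc, y⟫_ℂ = L y := by
    intro y
    rw [InnerProductSpace.toDual_symm_apply]
    rfl
  refine ⟨(InnerProductSpace.toDual ℂ K).symm φc, ?_, ?_⟩
  · rw [LinearIsometryEquiv.norm_map]
    exact φ.mkContinuous_norm_le hC hL1
  · intro y
    have h := (hL2 y)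
    rw [← hξ y] at h
    have := (Complex.continuous_conj.tendsto _).comp h
    simp only [Function.comp_def] at this
    simpa only [inner_conj_symm] using this

end TwoShift

namespace TwoShift

open scoped InnerProductSpace ComplexConjugate

variable {K : Type*} [NormedAddCommGroup K] [InnerProductSpace ℂ K] [CompleteSpace K]

/-- An orthogonal decomposition of `K` into closed subspaces indexed by `ℤ`. -/
structure IsGrading (G : ℤ → Submodule ℂ K) : Prop where
  closed : ∀ n, IsClosed (G n : Set K)
  orth : ∀ m n, m ≠ n → ∀ x ∈ G m, ∀ y ∈ G n, ⟪x, y⟫_ℂ = 0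
  span : (⨆ n, G n).topologicalClosure = ⊤

variable {G : ℤ → Submodule ℂ K}

open Classical in
/-- The orthogonal projection onto a submodule (zero if there is none). -/
def proj (M : Submodule ℂ K) : K →L[ℂ] K :=
  if _ : M.HasOrthogonalProjection then M.starProjection else 0

lemma IsGrading.hasProj (hG : IsGrading G) (n : ℤ) : (G n).HasOrthogonalProjection := by
  have := (hG.closed n).completeSpace_coe
  infer_instance

lemma IsGrading.proj_eq (hG : IsGrading G) (n : ℤ) :
    have := hG.hasProj n
    proj (G n) = (G n).starProjection := by
  have := hG.hasProj n
  simp [proj, this]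

lemma IsGrading.proj_mem (hG : IsGrading G) (n : ℤ) (x : K) : proj (G n) x ∈ G n := by
  have := hG.hasProj n
  rw [hG.proj_eq]
  exact Submodule.starProjection_apply_mem _ _

lemma IsGrading.proj_of_mem (hG : IsGrading G) {n : ℤ} {x : K} (hx : x ∈ G n) :
    proj (G n) x = x := by
  have := hG.hasProj n
  rw [hG.proj_eq]
  exact Submodule.starProjection_eq_self_iff.2 hx

lemma IsGrading.proj_of_mem_ne (hG : IsGrading G) {m n : ℤ} (hmn : m ≠ n) {x : K}
    (hx : x ∈ G n) : proj (G m) x = 0 := by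
  have := hG.hasProj m
  rw [hG.proj_eq, Submodule.starProjection_apply_eq_zero_iff]
  intro y hy
  exact hG.orth m n hmn y hy x hx

lemma IsGrading.star_proj (hG : IsGrading G) (n : ℤ) : star (proj (G n)) = proj (G n) := by
  have := hG.hasProj n
  rw [hG.proj_eq]
  exact (isSelfAdjoint_starProjection _).star_eq

lemma IsGrading.proj_mul_self (hG : IsGrading G) (n : ℤ) :
    proj (G n) * proj (G n) = proj (G n) := by
  ext x
  exact hG.proj_of_mem (hG.proj_mem n x)

lemma IsGrading.inner_proj (hG : IsGrading G) (n : ℤ) (x y : K) :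
    ⟪proj (G n) x, y⟫_ℂ = ⟪x, proj (G n) y⟫_ℂ := by
  conv_lhs => rw [← hG.star_proj n]
  rw [star_eq_adjoint, adjoint_inner_left]

lemma IsGrading.norm_proj_le (hG : IsGrading G) (n : ℤ) : ‖proj (G n)‖ ≤ 1 := by
  have := hG.hasProj n
  rw [hG.proj_eq]
  exact Submodule.starProjection_norm_le _

/-- Bounded operators agreeing on each graded piece are equal. -/
lemma IsGrading.op_ext (hG : IsGrading G) {F : Type*} [NormedAddCommGroup F] [NormedSpace ℂ F]
    {a b : K →L[ℂ] F} (h : ∀ n, ∀ x ∈ G n, a x = b x) : a = b := by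
  have hle : (⨆ n, G n) ≤ LinearMap.ker ((a - b : K →L[ℂ] F) : K →ₗ[ℂ] F) := by
    refine iSup_le fun n x hx => ?_
    simp [h n x hx]
  have := Submodule.topologicalClosure_minimal _ hle (a - b).isClosed_ker
  rw [hG.span] at this
  ext x
  have hx := this (Submodule.mem_top (x := x))
  simpa [sub_eq_zero] using hx

lemma IsGrading.eq_zero_of_inner (hG : IsGrading G) {x : K}
    (h : ∀ n, ∀ y ∈ G n, ⟪x, y⟫_ℂ = 0) : x = 0 := by
  have : innerSL ℂ x = 0 := hG.op_ext fun n y hy => by simpa using h n y hy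
  have h2 : innerSL ℂ x x = 0 := by rw [this]; rfl
  simpa using h2

lemma IsGrading.eq_zero_of_proj (hG : IsGrading G) {x : K}
    (h : ∀ n, proj (G n) x = 0) : x = 0 := by
  refine hG.eq_zero_of_inner fun n y hy => ?_
  rw [← hG.proj_of_mem hy, ← hG.inner_proj, h n, inner_zero_left]

lemma IsGrading.mem_of_proj (hG : IsGrading G) {n : ℤ} {x : K}
    (h : ∀ m, m ≠ n → proj (G m) x = 0) : x ∈ G n := by
  have : x - proj (G n) x = 0 := by
    refine hG.eq_zero_of_proj fun m => ?_
    rcases eq_or_ne m n with rfl | hm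
    · rw [map_sub, hG.proj_of_mem (hG.proj_mem m x), sub_self]
    · rw [map_sub, h m hm, hG.proj_of_mem_ne hm (hG.proj_mem n x), sub_self]
  rw [sub_eq_zero.1 this]
  exact hG.proj_mem n x

lemma IsGrading.mem_of_inner (hG : IsGrading G) {n : ℤ} {x : K}
    (h : ∀ m, m ≠ n → ∀ y ∈ G m, ⟪x, y⟫_ℂ = 0) : x ∈ G n := by
  refine hG.mem_of_proj fun m hm => ?_
  refine hG.eq_zero_of_inner fun k y _ => ?_
  rw [hG.inner_proj]
  exact h m hm _ (hG.proj_mem m y)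

/-- If `a` raises degree by `d`, its adjoint lowers degree by `d`. -/
lemma IsGrading.adjoint_mem (hG : IsGrading G) {a : K →L[ℂ] K} {d : ℤ}
    (ha : ∀ n, ∀ x ∈ G n, a x ∈ G (n + d)) (n : ℤ) (x : K) (hx : x ∈ G n) :
    star a x ∈ G (n - d) := by
  refine hG.mem_of_inner fun m hm y hy => ?_
  rw [star_eq_adjoint, adjoint_inner_left]
  refine hG.orth n (m + d) (fun h => hm (by omega)) x hx _ (ha m y hy)

lemma exists_isometry_scalar (hG : IsGrading G) (u : ℤ → ℂ) (hu : ∀ n, ‖u n‖ = 1) :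
    ∃ D : K →ₗᵢ[ℂ] K, ∀ n, ∀ x ∈ G n, D x = u n • x := by
  have := fun n => (hG.closed n).completeSpace_coe
  have hO : OrthogonalFamily ℂ (fun n => G n) fun n => (G n).subtypeₗᵢ := by
    intro m n hmn x y
    exact hG.orth m n hmn x x.2 y y.2
  have hS : IsHilbertSum ℂ (fun n => G n) fun n => (G n).subtypeₗᵢ := by
    refine IsHilbertSum.mkInternal _ hO ?_
    rw [hG.span]
  let W : ∀ n, G n →ₗᵢ[ℂ] K := fun n =>
    { toLinearMap := u n • (G n).subtype
      norm_map' := fun x => by simp [norm_smul, hu] }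
  have hW : OrthogonalFamily ℂ (fun n => G n) W := by
    intro m n hmn x y
    change ⟪u m • (x : K), u n • (y : K)⟫_ℂ = 0
    rw [inner_smul_left, inner_smul_right, hG.orth m n hmn x x.2 y y.2]
    simp
  refine ⟨hW.linearIsometry.comp hS.linearIsometryEquiv.toLinearIsometry, fun n x hx => ?_⟩
  have h1 : hS.linearIsometryEquiv x = lp.single 2 n ⟨x, hx⟩ := by
    rw [← hS.linearIsometryEquiv.symm.injective.eq_iff, LinearIsometryEquiv.symm_apply_apply,
      IsHilbertSum.linearIsometryEquiv_symm_apply_single]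
    rfl
  change hW.linearIsometry (hS.linearIsometryEquiv x) = _
  rw [h1, OrthogonalFamily.linearIsometry_apply_single]
  rfl

/-- The gauge unitaries. -/
lemma IsGrading.exists_gauge (hG : IsGrading G) (u : ℂ) (hu : ‖u‖ = 1) :
    ∃ D ∈ unitary (K →L[ℂ] K), ∀ n, ∀ x ∈ G n, D x = u ^ n • x := by
  have hu0 : u ≠ 0 := by rintro rfl; simp at hu
  obtain ⟨D, hD⟩ := exists_isometry_scalar hG (fun n => u ^ n) (by simp [hu])
  obtain ⟨D', hD'⟩ := exists_isometry_scalar hG (fun n => (u ^ n)⁻¹) (by simp [hu])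
  set A := D.toContinuousLinearMap
  set B := D'.toContinuousLinearMap
  have hA : ∀ n, ∀ x ∈ G n, A x = u ^ n • x := hD
  have hB : ∀ n, ∀ x ∈ G n, B x = (u ^ n)⁻¹ • x := hD'
  have h1 : A * B = 1 := hG.op_ext fun n x hx => by
    change A (B x) = x
    rw [hB n x hx, map_smul, hA n x hx, smul_smul, inv_mul_cancel₀ (zpow_ne_zero _ hu0), one_smul]
  have h2 : star A * A = 1 := by
    ext x
    refine ext_inner_right ℂ fun y => ?_
    change ⟪star A (A x), y⟫_ℂ = ⟪x, y⟫_ℂ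
    rw [star_eq_adjoint, adjoint_inner_left]
    exact D.inner_map_map x y
  have h3 : star A = B := by
    calc star A = star A * (A * B) := by rw [h1, mul_one]
      _ = B := by rw [← mul_assoc, h2, one_mul]
  exact ⟨A, Unitary.mem_iff.2 ⟨h2, by rw [h3, h1]⟩, hA⟩

end TwoShift

namespace TwoShift

open scoped InnerProductSpace ComplexConjugate

variable {K : Type*} [NormedAddCommGroup K] [InnerProductSpace ℂ K] [CompleteSpace K]

/-- The Möbius transform without rotation. -/
def phi (z : ℂ) (T : K →L[ℂ] K) : K →L[ℂ] K :=
  (T - z • 1) * Ring.inverse (1 - conj z • T)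

/-- `V` is a unitary implementing the disc automorphism with parameters `u`, `z`. -/
structure Impl (T V : K →L[ℂ] K) (u z : ℂ) : Prop where
  mem : V ∈ unitary (K →L[ℂ] K)
  norm_u : ‖u‖ = 1
  norm_z : ‖z‖ < 1
  rel : V * T = (u • phi z T) * V

/-- The group law of the disc. -/
def discAdd (z w : ℂ) : ℂ := (z + w) / (1 + conj w * z)

variable {T V W : K →L[ℂ] K} {u z u' w : ℂ}

lemma one_add_ne_zero (hz : ‖z‖ < 1) (hw : ‖w‖ < 1) : 1 + conj w * z ≠ 0 := by
  intro h
  have h1 : conj w * z = -1 := by linear_combination h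
  have h2 := congrArg norm h1
  rw [norm_mul, Complex.norm_conj, norm_neg, norm_one] at h2
  nlinarith [norm_nonneg z, norm_nonneg w]

lemma one_sub_normSq_discAdd (hz : ‖z‖ < 1) (hw : ‖w‖ < 1) :
    1 - ‖discAdd z w‖ ^ 2 = (1 - ‖z‖ ^ 2) * (1 - ‖w‖ ^ 2) / ‖1 + conj w * z‖ ^ 2 := by
  have h0 := one_add_ne_zero hz hw
  have h1 : ‖1 + conj w * z‖ ^ 2 ≠ 0 := by simpa using h0
  rw [discAdd, norm_div, div_pow, eq_div_iff h1, sub_mul, div_mul_cancel₀ _ h1]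
  simp only [← Complex.normSq_eq_norm_sq, Complex.normSq_apply, Complex.add_re, Complex.add_im,
    Complex.mul_re, Complex.mul_im, Complex.conj_re, Complex.conj_im, Complex.one_re,
    Complex.one_im]
  ring

lemma norm_discAdd_lt (hz : ‖z‖ < 1) (hw : ‖w‖ < 1) : ‖discAdd z w‖ < 1 := by
  have h := one_sub_normSq_discAdd hz hw
  have h0 : 0 < ‖1 + conj w * z‖ := norm_pos_iff.2 (one_add_ne_zero hz hw)
  have h1 : 0 < 1 - ‖discAdd z w‖ ^ 2 := by
    rw [h]
    have : 0 < 1 - ‖z‖ ^ 2 := by nlinarith [norm_nonneg z]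
    have : 0 < 1 - ‖w‖ ^ 2 := by nlinarith [norm_nonneg w]
    positivity
  nlinarith [norm_nonneg (discAdd z w)]

lemma ring_inverse_intertwine {R : Type*} [Ring R] {x y v : R} (hx : IsUnit x) (hy : IsUnit y)
    (h : v * x = y * v) : v * Ring.inverse x = Ring.inverse y * v := by
  calc v * Ring.inverse x = Ring.inverse y * (y * v) * Ring.inverse x := by
        rw [← mul_assoc (Ring.inverse y), Ring.inverse_mul_cancel _ hy, one_mul]
    _ = Ring.inverse y * v * (x * Ring.inverse x) := by rw [← h]; simp only [mul_assoc]
    _ = _ := by rw [Ring.mul_inverse_cancel _ hx, mul_one]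

lemma conj_mul_self_of_norm (hu : ‖u‖ = 1) : conj u * u = 1 := by
  rw [mul_comm, Complex.mul_conj, Complex.normSq_eq_norm_sq, hu]; simp

/-- Conjugating a Möbius transform of `T` by an implementing unitary. -/
lemma Impl.mul_phi (hT : ∀ c : ℂ, ‖c‖ < 1 → IsUnit (1 - conj c • T)) (hW : Impl T W u' w)
    (hz : ‖z‖ < 1) :
    W * phi z T = ((u' * ((1 + conj w * (conj u' * z)) / conj (1 + conj w * (conj u' * z)))) •
      phi (discAdd (conj u' * z) w) T) * W := by
  set ζ := conj u' * z with hζ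
  have hu := hW.norm_u
  have hζ1 : ‖ζ‖ < 1 := by rw [hζ, norm_mul, Complex.norm_conj, hu, one_mul]; exact hz
  have hw := hW.norm_z
  have hne := one_add_ne_zero hζ1 hw
  set k := 1 + conj w * ζ with hk
  have hkc : conj k ≠ 0 := by simpa using hne
  have huu := conj_mul_self_of_norm hu
  have hzζ : z = u' * ζ := by rw [hζ]; linear_combination (-z) * huu
  have hzc : conj z = conj u' * conj ζ := by rw [hzζ, map_mul]
  set z' := discAdd ζ w with hz'
  have hzw1 : ‖z'‖ < 1 := norm_discAdd_lt hζ1 hw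
  have hkz : k * z' = ζ + w := by rw [hz', discAdd, mul_div_cancel₀ _ hne]
  have hkzc : conj k * conj z' = conj ζ + conj w := by rw [← map_mul, hkz, map_add]
  have hkce : conj k = 1 + w * conj ζ := by rw [hk]; simp
  set A := 1 - conj w • T with hA
  have hAu : IsUnit A := hT w hw
  set Z := 1 - conj z' • T with hZ
  have hZu : IsUnit Z := hT z' hzw1
  -- the numerator and denominator after substitution
  have hnum : (u' • phi w T - z • 1) * A = (u' * k) • (T - z' • 1) := by
    rw [sub_mul, smul_mul_assoc, phi, mul_assoc, Ring.inverse_mul_cancel _ hAu, mul_one,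
      smul_mul_assoc, one_mul, hA, hzζ, smul_sub, smul_sub, smul_sub, smul_smul, smul_smul,
      smul_smul, mul_assoc u' k z', hkz, hk]
    module
  have hden : (1 - conj z • (u' • phi w T)) * A = conj k • Z := by
    rw [sub_mul, one_mul, smul_mul_assoc, smul_mul_assoc, phi, mul_assoc,
      Ring.inverse_mul_cancel _ hAu, mul_one, hZ, smul_sub (conj k), smul_smul (conj k), hkzc,
      hkce, hA, hzc, smul_smul,
      show conj u' * conj ζ * u' = conj ζ by linear_combination conj ζ * huu]
    module
  have hdenU : IsUnit (1 - conj z • (u' • phi w T)) := by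
    have h1 : (1 - conj z • (u' • phi w T)) = (conj k • Z) * Ring.inverse A := by
      rw [← hden, mul_assoc, Ring.mul_inverse_cancel _ hAu, mul_one]
    rw [h1]
    refine IsUnit.mul ?_ ?_
    · exact hZu.smul (Units.mk0 (conj k) hkc)
    · exact hAu.ringInverse
  have hT1 : W * (T - z • 1) = (u' • phi w T - z • 1) * W := by
    rw [mul_sub, sub_mul, hW.rel, mul_smul_comm, smul_mul_assoc, smul_mul_assoc, mul_one, one_mul]
  have hT2 : W * (1 - conj z • T) = (1 - conj z • (u' • phi w T)) * W := by
    rw [mul_sub, sub_mul, mul_smul_comm, hW.rel, smul_mul_assoc, smul_mul_assoc, smul_mul_assoc,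
      mul_one, one_mul]
  have hT3 := ring_inverse_intertwine (hT z hz) hdenU hT2
  have hfin : (u' • phi w T - z • 1) * Ring.inverse (1 - conj z • (u' • phi w T))
      = (u' * (k / conj k)) • phi z' T := by
    have h1 : (u' * (k / conj k)) • phi z' T * (1 - conj z • (u' • phi w T))
        = (u' • phi w T - z • 1) := by
      have h2 : (u' * (k / conj k)) • phi z' T * (1 - conj z • (u' • phi w T)) * A
        = (u' • phi w T - z • 1) * A := by
        rw [mul_assoc, hden, hnum, phi, mul_smul_comm, smul_mul_assoc, mul_assoc (T - z' • 1),
          Ring.inverse_mul_cancel _ hZu, mul_one, smul_smul]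
        congr 1
        field_simp
      exact hAu.mul_right_cancel h2
    rw [← h1, mul_assoc, Ring.mul_inverse_cancel _ hdenU, mul_one]
  calc W * phi z T = W * (T - z • 1) * Ring.inverse (1 - conj z • T) := by
        rw [phi, mul_assoc]
    _ = (u' • phi w T - z • 1) * (W * Ring.inverse (1 - conj z • T)) := by
        rw [hT1, mul_assoc]
    _ = _ := by rw [hT3, ← mul_assoc, hfin]

lemma Impl.mul (hT : ∀ c : ℂ, ‖c‖ < 1 → IsUnit (1 - conj c • T)) (hW : Impl T W u' w)
    (hV : Impl T V u z) :
    Impl T (W * V) (u * (u' * ((1 + conj w * (conj u' * z)) / conj (1 + conj w * (conj u' * z)))))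
      (discAdd (conj u' * z) w) := by
  have hζ1 : ‖conj u' * z‖ < 1 := by
    rw [norm_mul, Complex.norm_conj, hW.norm_u, one_mul]; exact hV.norm_z
  have hne := one_add_ne_zero hζ1 hW.norm_z
  refine ⟨mul_mem hW.mem hV.mem, ?_, norm_discAdd_lt hζ1 hW.norm_z, ?_⟩
  · rw [norm_mul, norm_mul, norm_div, Complex.norm_conj, div_self (norm_ne_zero_iff.2 hne),
      hV.norm_u, hW.norm_u]
    norm_num
  · rw [mul_assoc, hV.rel, ← mul_assoc, mul_smul_comm, hW.mul_phi hT hV.norm_z, smul_mul_assoc,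
      smul_mul_assoc, smul_mul_assoc, smul_mul_assoc, mul_assoc, smul_smul]

lemma Impl.mul_real (hT : ∀ c : ℂ, ‖c‖ < 1 → IsUnit (1 - conj c • T)) {r s : ℝ}
    (hW : Impl T W 1 r) (hV : Impl T V 1 s) : Impl T (W * V) 1 (discAdd s r) := by
  have := hW.mul hT hV
  have h0 : conj (1 + conj (r : ℂ) * (conj (1 : ℂ) * s)) = 1 + conj (r : ℂ) * (conj (1 : ℂ) * s) := by
    simp
  rw [h0, div_self] at this
  · simpa using this
  · have := one_add_ne_zero hV.norm_z hW.norm_z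
    simpa using this

lemma Impl.rel_star (hV : Impl T V u z) : V * star T = star (u • phi z T) * V := by
  have h := congrArg star hV.rel
  rw [star_mul, star_mul] at h
  have h1 := (Unitary.mem_iff.1 hV.mem).1
  have h2 := (Unitary.mem_iff.1 hV.mem).2
  calc V * star T = V * (star T * star V) * V := by
        rw [mul_assoc, mul_assoc, h1, mul_one]
    _ = (V * star V) * star (u • phi z T) * V := by rw [h]; simp only [mul_assoc]
    _ = _ := by rw [h2, one_mul]

/-- Operators intertwining in the same way as an implementing unitary are multiples of it. -/
lemma Impl.eq_smul [Nontrivial K] (hirr : IrreducibleOp T) (hV : Impl T V u z)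
    (h1 : W * T = (u • phi z T) * W) (h2 : W * star T = star (u • phi z T) * W) :
    ∃ c : ℂ, W = c • V := by
  have e1 := (Unitary.mem_iff.1 hV.mem).1
  have e2 := (Unitary.mem_iff.1 hV.mem).2
  have key : ∀ A B : K →L[ℂ] K, V * A = B * V → W * A = B * W →
      (star V * W) * A = A * (star V * W) := by
    intro A B hA hB
    have : star V * B = A * star V := by
      calc star V * B = star V * (B * V) * star V := by rw [mul_assoc, mul_assoc, e2, mul_one]
        _ = _ := by rw [← hA, ← mul_assoc, e1, one_mul]
    rw [mul_assoc, hB, ← mul_assoc, this, mul_assoc]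
  obtain ⟨c, hc⟩ := schur hirr (key _ _ hV.rel h1) (key _ _ hV.rel_star h2)
  refine ⟨c, ?_⟩
  calc W = V * (star V * W) := by rw [← mul_assoc, e2, one_mul]
    _ = _ := by rw [hc, mul_smul_comm, mul_one]

lemma norm_apply_of_unitary (hV : V ∈ unitary (K →L[ℂ] K)) (x : K) : ‖V x‖ = ‖x‖ := by
  have e1 := (Unitary.mem_iff.1 hV).1
  have : ⟪V x, V x⟫_ℂ = ⟪x, x⟫_ℂ := by
    rw [← adjoint_inner_left, ← star_eq_adjoint]
    change ⟪(star V * V) x, x⟫_ℂ = _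
    rw [e1]; rfl
  rw [inner_self_eq_norm_sq_to_K, inner_self_eq_norm_sq_to_K] at this
  have h2 : ‖V x‖ ^ 2 = ‖x‖ ^ 2 := by exact_mod_cast this
  exact (sq_eq_sq₀ (norm_nonneg _) (norm_nonneg _)).1 h2

lemma Impl.unique [Nontrivial K] (hirr : IrreducibleOp T) (hV : Impl T V u z)
    (hW : Impl T W u z) : ∃ c : ℂ, ‖c‖ = 1 ∧ W = c • V := by
  obtain ⟨c, hc⟩ := hV.eq_smul hirr hW.rel hW.rel_star
  refine ⟨c, ?_, hc⟩
  obtain ⟨x, hx⟩ := exists_ne (0 : K)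
  have h := norm_apply_of_unitary hW.mem x
  rw [hc, smul_apply, norm_smul, norm_apply_of_unitary hV.mem] at h
  exact mul_right_cancel₀ (norm_ne_zero_iff.2 hx) (by rw [h, one_mul])

lemma exists_impl (hhom : Homogeneous T) (hz : ‖z‖ < 1) : ∃ V, Impl T V 1 z := by
  obtain ⟨-, U, hU⟩ := hhom.2 0 z hz
  have hm : mobius 0 z T = phi z T := by simp [mobius, phi]
  rw [hm] at hU
  refine ⟨U.symm.toContinuousLinearEquiv.toContinuousLinearMap, ?_, by simp, hz, ?_⟩
  · have : (Unitary.linearIsometryEquiv.symm U.symm : K →L[ℂ] K) ∈ unitary (K →L[ℂ] K) :=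
      (Unitary.linearIsometryEquiv.symm U.symm).2
    exact this
  · ext x
    rw [one_smul]
    change U.symm (T x) = phi z T (U.symm x)
    rw [LinearIsometryEquiv.symm_apply_eq, hU, LinearIsometryEquiv.apply_symm_apply]

/-! ### Behaviour in the parameter -/

lemma continuousAt_inverse (hT : ∀ c : ℂ, ‖c‖ < 1 → IsUnit (1 - conj c • T)) (hz : ‖z‖ < 1) :
    ContinuousAt (fun z : ℂ => Ring.inverse (1 - conj z • T)) z := by
  obtain ⟨a, ha⟩ := hT z hz
  have h1 : ContinuousAt (fun z : ℂ => 1 - conj z • T) z := by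
    have := Complex.continuous_conj
    fun_prop
  have h2 := NormedRing.inverse_continuousAt a
  rw [ha] at h2
  exact ContinuousAt.comp (f := fun z : ℂ => 1 - conj z • T) h2 h1

lemma continuousAt_phi (hT : ∀ c : ℂ, ‖c‖ < 1 → IsUnit (1 - conj c • T)) (hz : ‖z‖ < 1) :
    ContinuousAt (fun z : ℂ => phi z T) z := by
  refine ContinuousAt.mul ?_ (continuousAt_inverse hT hz)
  fun_prop

lemma phi_real_sub (hT : ∀ c : ℂ, ‖c‖ < 1 → IsUnit (1 - conj c • T)) {r : ℝ}
    (hr : ‖(r : ℂ)‖ < 1) :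
    phi r T - T = (r : ℂ) • ((T * T - 1) * Ring.inverse (1 - conj (r : ℂ) • T)) := by
  have hu := hT r hr
  apply hu.mul_right_cancel
  rw [sub_mul, smul_mul_assoc, phi, mul_assoc, mul_assoc, Ring.inverse_mul_cancel _ hu,
    mul_one, mul_one, mul_sub, mul_one, Complex.conj_ofReal, mul_smul_comm]
  module

end TwoShift

namespace TwoShift

open scoped InnerProductSpace ComplexConjugate
open Filter Topology

variable {K : Type*} [NormedAddCommGroup K] [InnerProductSpace ℂ K] [CompleteSpace K]

lemma weak_op_tendsto {ι : Type*} {l : Filter ι} {f : ι → K} {ξ : K} {C : ℝ}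
    (hb : ∀ᶠ i in l, ‖f i‖ ≤ C) (hf : ∀ y, Tendsto (fun i => ⟪y, f i⟫_ℂ) l (𝓝 ⟪y, ξ⟫_ℂ))
    {a : ι → K →L[ℂ] K} {a₀ : K →L[ℂ] K} (ha : Tendsto a l (𝓝 a₀)) (y : K) :
    Tendsto (fun i => ⟪y, a i (f i)⟫_ℂ) l (𝓝 ⟪y, a₀ ξ⟫_ℂ) := by
  have h1 : Tendsto (fun i => ⟪y, a₀ (f i)⟫_ℂ) l (𝓝 ⟪y, a₀ ξ⟫_ℂ) := by
    simp only [← adjoint_inner_left]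
    exact hf _
  have h2 : Tendsto (fun i => ⟪y, (a i - a₀) (f i)⟫_ℂ) l (𝓝 0) := by
    refine squeeze_zero_norm' (a := fun i => ‖y‖ * (‖a i - a₀‖ * C)) ?_ ?_
    · filter_upwards [hb] with i hi
      refine (norm_inner_le_norm _ _).trans ?_
      gcongr
      exact (le_opNorm _ _).trans (by gcongr)
    · have h3 := (tendsto_iff_norm_sub_tendsto_zero.1 ha)
      simpa using (h3.mul_const C).const_mul ‖y‖
  have := h1.add h2
  simpa [inner_sub_right] using this

/-- A choice of unitaries implementing the hyperbolic automorphisms with real parameter. -/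
structure Ctx (T : K →L[ℂ] K) (V : ℝ → K →L[ℂ] K) : Prop where
  irr : IrreducibleOp T
  unit : ∀ c : ℂ, ‖c‖ < 1 → IsUnit (1 - conj c • T)
  impl : ∀ r : ℝ, |r| < 1 → Impl T (V r) 1 r

variable {T : K →L[ℂ] K} {V : ℝ → K →L[ℂ] K}

lemma norm_ofReal_lt {r : ℝ} (hr : |r| < 1) : ‖(r : ℂ)‖ < 1 := by simpa using hr

/-- The group law for real parameters. -/
def ra (s r : ℝ) : ℝ := (s + r) / (1 + r * s)

lemma discAdd_ofReal (s r : ℝ) : discAdd s r = (ra s r : ℂ) := by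
  simp [discAdd, ra]

lemma abs_ra_lt {s r : ℝ} (hs : |s| < 1) (hr : |r| < 1) : |ra s r| < 1 := by
  have := norm_discAdd_lt (norm_ofReal_lt hs) (norm_ofReal_lt hr)
  rw [discAdd_ofReal] at this
  simpa using this

lemma Ctx.norm_V (h : Ctx T V) {r : ℝ} (hr : |r| < 1) (x : K) : ‖V r x‖ = ‖x‖ :=
  norm_apply_of_unitary (h.impl r hr).mem x

lemma Ctx.V_ra [Nontrivial K] (h : Ctx T V) {s r : ℝ} (hs : |s| < 1) (hr : |r| < 1) :
    ∃ c : ℂ, ‖c‖ = 1 ∧ V (ra s r) = c • (V r * V s) := by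
  have h1 := (h.impl r hr).mul_real h.unit (h.impl s hs)
  rw [discAdd_ofReal] at h1
  exact h1.unique h.irr (h.impl _ (abs_ra_lt hs hr))

lemma Ctx.V_zero [Nontrivial K] (h : Ctx T V) : ∃ c : ℂ, ‖c‖ = 1 ∧ V 0 = c • 1 := by
  have h1 : Impl T 1 1 ((0 : ℝ) : ℂ) := ⟨one_mem _, by simp, by simp, by simp [phi]⟩
  exact h1.unique h.irr (h.impl 0 (by simp))

lemma eventually_abs_lt {l : Filter ℝ} {r₀ : ℝ} (hl : l ≤ 𝓝 r₀) {δ : ℝ} (hr₀ : |r₀| < δ) :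
    ∀ᶠ r in l, |r| < δ :=
  hl ((isOpen_lt continuous_abs continuous_const).mem_nhds hr₀)

lemma Ctx.weak_limit [Nontrivial K] (h : Ctx T V) {r₀ : ℝ} (hr₀ : |r₀| < 1) (l : Ultrafilter ℝ)
    (hl : (l : Filter ℝ) ≤ 𝓝 r₀) :
    ∃ c : ℂ, ‖c‖ ≤ 1 ∧
      ∀ x y, Tendsto (fun r => ⟪y, V r x⟫_ℂ) l (𝓝 (c * ⟪y, V r₀ x⟫_ℂ)) := by
  have hev := eventually_abs_lt hl hr₀
  have hb : ∀ x, ∀ᶠ r in (l : Filter ℝ), ‖V r x‖ ≤ ‖x‖ := fun x => by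
    filter_upwards [hev] with r hr
    exact (h.norm_V hr x).le
  choose ξ hξ1 hξ2 using fun x => exists_weak_limit l (fun r => V r x) (hb x)
  let W₀ : K →ₗ[ℂ] K :=
    { toFun := ξ
      map_add' := fun x x' => by
        refine ext_inner_left ℂ fun y => ?_
        refine tendsto_nhds_unique (hξ2 (x + x') y) ?_
        simp only [map_add, inner_add_right]
        exact (hξ2 x y).add (hξ2 x' y)
      map_smul' := fun c x => by
        refine ext_inner_left ℂ fun y => ?_
        refine tendsto_nhds_unique (hξ2 (c • x) y) ?_
        simp only [map_smul, inner_smul_right, RingHom.id_apply]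
        exact (hξ2 x y).const_mul c }
  let W : K →L[ℂ] K := W₀.mkContinuous 1 (fun x => by rw [one_mul]; exact hξ1 x)
  have hWx : ∀ x, W x = ξ x := fun x => rfl
  have hr₀' := norm_ofReal_lt hr₀
  have hphi : Tendsto (fun r : ℝ => phi (r : ℂ) T) l (𝓝 (phi (r₀ : ℂ) T)) := by
    have h1 : ContinuousAt (fun z : ℂ => phi z T) (r₀ : ℂ) := continuousAt_phi h.unit hr₀'
    have h2 : ContinuousAt (fun r : ℝ => phi (r : ℂ) T) r₀ :=
      ContinuousAt.comp (f := fun r : ℝ => (r : ℂ)) h1 Complex.continuous_ofReal.continuousAt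
    exact h2.tendsto.mono_left hl
  have key : ∀ (S : K →L[ℂ] K) (a : ℝ → K →L[ℂ] K) (a₀ : K →L[ℂ] K), Tendsto a l (𝓝 a₀) →
      (∀ r, |r| < 1 → V r * S = a r * V r) → W * S = a₀ * W := by
    intro S a a₀ ha hrel
    ext x
    refine ext_inner_left ℂ fun y => ?_
    refine tendsto_nhds_unique (hξ2 (S x) y) ?_
    refine (weak_op_tendsto (hb x) (hξ2 x) ha y).congr' ?_
    filter_upwards [hev] with r hr
    have : V r (S x) = a r (V r x) := DFunLike.congr_fun (hrel r hr) x
    rw [this]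
  have h1 : W * T = ((1 : ℂ) • phi (r₀ : ℂ) T) * W := by
    rw [one_smul]
    refine key T (fun r => phi (r : ℂ) T) _ hphi fun r hr => ?_
    have := (h.impl r hr).rel
    rwa [one_smul] at this
  have h2 : W * star T = star ((1 : ℂ) • phi (r₀ : ℂ) T) * W := by
    rw [one_smul]
    refine key (star T) (fun r => star (phi (r : ℂ) T)) _
      ((continuous_star.tendsto _).comp hphi) fun r hr => ?_
    have := (h.impl r hr).rel_star
    rwa [one_smul] at this
  obtain ⟨c, hc⟩ := (h.impl r₀ hr₀).eq_smul h.irr h1 h2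
  refine ⟨c, ?_, fun x y => ?_⟩
  · obtain ⟨x, hx⟩ := exists_ne (0 : K)
    have h3 := hξ1 x
    rw [← hWx, hc, smul_apply, norm_smul, h.norm_V hr₀] at h3
    exact le_of_mul_le_mul_right (by rwa [one_mul]) (norm_pos_iff.2 hx)
  · have := hξ2 x y
    rwa [← hWx, hc, smul_apply, inner_smul_right] at this

lemma tendsto_ra_left {r : ℝ} : Tendsto (fun s => ra s r) (𝓝 0) (𝓝 r) := by
  have h : ContinuousAt (fun s => (s + r) / (1 + r * s)) 0 :=
    ContinuousAt.div (by fun_prop) (by fun_prop) (by simp)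
  have h2 := h.tendsto
  simpa [ra] using h2

/-- A Baire category argument: matrix coefficients cannot be uniformly small near zero. -/
lemma Ctx.exists_lower_bound [Nontrivial K] [TopologicalSpace.SeparableSpace K] (h : Ctx T V)
    {x : K} (hx : x ≠ 0) :
    ∃ y : K, ∃ c > 0, ∃ δ > 0, ∀ s : ℝ, |s| < δ → c ≤ ‖⟪y, V s x⟫_ℂ‖ := by
  have hx0 : 0 < ‖x‖ := norm_pos_iff.2 hx
  set c := ‖x‖ ^ 2 / 2 with hc
  have hc0 : 0 < c := by positivity
  set y : ℕ → K := TopologicalSpace.denseSeq K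
  let F : Option ℕ → Set ℝ := fun o => o.elim {r | 1 / 2 ≤ |r|}
    fun k => {r | |r| ≤ 1 / 2 ∧ c ≤ ‖⟪y k, V r x⟫_ℂ‖}
  have hFc : ∀ o, IsClosed (F o) := by
    rintro (_ | k)
    · exact isClosed_le continuous_const continuous_abs
    · rw [isClosed_iff_ultrafilter]
      intro r₀ l hl hF
      have hle : |r₀| ≤ 1 / 2 := by
        have hcl : IsClosed {r : ℝ | |r| ≤ 1 / 2} := isClosed_le continuous_abs continuous_const
        refine isClosed_iff_ultrafilter.1 hcl r₀ l hl ?_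
        exact Filter.mem_of_superset hF fun r hr => hr.1
      have hlt : |r₀| < 1 := by linarith
      refine ⟨hle, ?_⟩
      obtain ⟨d, hd1, hd2⟩ := h.weak_limit hlt l hl
      have h1 : c ≤ ‖d * ⟪y k, V r₀ x⟫_ℂ‖ := by
        refine ge_of_tendsto (hd2 x (y k)).norm ?_
        exact Filter.mem_of_superset hF fun r hr => hr.2
      rw [norm_mul] at h1
      exact h1.trans (mul_le_of_le_one_left (norm_nonneg _) hd1)
  have hFu : ⋃ o, F o = Set.univ := by
    rw [Set.eq_univ_iff_forall]
    intro r
    rw [Set.mem_iUnion]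
    rcases le_total (1 / 2) |r| with hr | hr
    · exact ⟨none, hr⟩
    · have hr1 : |r| < 1 := by linarith
      obtain ⟨k, hk⟩ := (TopologicalSpace.denseRange_denseSeq K).exists_dist_lt (V r x)
        (half_pos hx0)
      refine ⟨some k, hr, ?_⟩
      have h1 : ⟪y k, V r x⟫_ℂ = ⟪V r x, V r x⟫_ℂ - ⟪V r x - y k, V r x⟫_ℂ := by
        rw [inner_sub_left]; ring
      have h2 : ‖⟪V r x, V r x⟫_ℂ‖ = ‖x‖ ^ 2 := by
        rw [inner_self_eq_norm_sq_to_K, h.norm_V hr1]; simp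
      have h3 : ‖⟪V r x - y k, V r x⟫_ℂ‖ ≤ ‖x‖ / 2 * ‖x‖ := by
        refine (norm_inner_le_norm _ _).trans ?_
        rw [h.norm_V hr1]
        gcongr
        rw [← dist_eq_norm]; exact hk.le
      have h4 := norm_sub_norm_le ⟪V r x, V r x⟫_ℂ ⟪V r x - y k, V r x⟫_ℂ
      rw [← h1, h2] at h4
      rw [hc]
      linarith [h4, h3, (by ring : ‖x‖ / 2 * ‖x‖ = ‖x‖ ^ 2 / 2)]
  have hd := dense_iUnion_interior_of_closed hFc hFu
  obtain ⟨r₀, hr₀, hr₀'⟩ := hd.exists_mem_open (isOpen_lt continuous_abs continuous_const)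
    (⟨0, by simp⟩ : {r : ℝ | |r| < 1 / 2}.Nonempty)
  have hr₀' : |r₀| < 1 / 2 := hr₀'
  have hlt : |r₀| < 1 := by linarith
  obtain ⟨o, ho⟩ := Set.mem_iUnion.1 hr₀
  rcases o with _ | k
  · have : r₀ ∈ F none := interior_subset ho
    have : 1 / 2 ≤ |r₀| := this
    linarith
  · have hn : ∀ᶠ r in 𝓝 r₀, c ≤ ‖⟪y k, V r x⟫_ℂ‖ := by
      filter_upwards [mem_interior_iff_mem_nhds.1 ho] with r hr using hr.2
    have hn' : ∀ᶠ s in 𝓝 (0 : ℝ), c ≤ ‖⟪y k, V (ra s r₀) x⟫_ℂ‖ := tendsto_ra_left.eventually hn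
    obtain ⟨δ, hδ, hδ'⟩ := Metric.eventually_nhds_iff.1 hn'
    refine ⟨star (V r₀) (y k), c, hc0, min δ 1, by positivity, fun s hs => ?_⟩
    have hs1 : |s| < 1 := hs.trans_le (min_le_right _ _)
    have := hδ' (y := s) (by rw [dist_zero_right]; exact hs.trans_le (min_le_left _ _))
    obtain ⟨d, hd1, hd2⟩ := h.V_ra hs1 hlt
    rw [hd2, smul_apply, inner_smul_right, norm_mul, hd1, one_mul] at this
    rw [star_eq_adjoint, adjoint_inner_left]
    exact this

lemma Ctx.norm_weak_limit_zero [Nontrivial K] [TopologicalSpace.SeparableSpace K] (h : Ctx T V)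
    (l : Ultrafilter ℝ) (hl : (l : Filter ℝ) ≤ 𝓝 0) {c : ℂ} (hc : ‖c‖ ≤ 1)
    (hlim : ∀ x y, Tendsto (fun r => ⟪y, V r x⟫_ℂ) l (𝓝 (c * ⟪y, V 0 x⟫_ℂ))) : ‖c‖ = 1 := by
  by_contra hne
  have hc1 : ‖c‖ < 1 := lt_of_le_of_ne hc hne
  obtain ⟨x, hx⟩ := exists_ne (0 : K)
  obtain ⟨y, d, hd, δ, hδ, hlow⟩ := h.exists_lower_bound hx
  obtain ⟨c₀, hc₀, hV0⟩ := h.V_zero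
  have hP : ∀ k : ℕ, ∀ δ > 0, ∀ ε > 0, ∃ s : ℝ, |s| < δ ∧ |s| < 1 ∧
      ‖⟪y, V s x⟫_ℂ‖ < ‖c‖ ^ k * (‖y‖ * ‖x‖) + ε := by
    intro k
    induction k with
    | zero =>
      intro δ hδ ε hε
      refine ⟨0, by simpa, by simp, ?_⟩
      have := norm_inner_le_norm (𝕜 := ℂ) y (V 0 x)
      rw [h.norm_V (by simp)] at this
      simp only [pow_zero, one_mul]
      linarith
    | succ k ih =>
      intro δ hδ ε hε
      obtain ⟨s, hs1, hs2, hs3⟩ := ih δ hδ (ε / 2) (by linarith)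
      have h1 := (hlim x (star (V s) y)).norm
      have h2 : ‖c * ⟪star (V s) y, V 0 x⟫_ℂ‖ < ‖c‖ ^ (k + 1) * (‖y‖ * ‖x‖) + ε := by
        rw [norm_mul, hV0, smul_apply, inner_smul_right, norm_mul, hc₀, one_mul, star_eq_adjoint,
          adjoint_inner_left, show (1 : K →L[ℂ] K) x = x from rfl]
        calc ‖c‖ * ‖⟪y, V s x⟫_ℂ‖ ≤ ‖c‖ * (‖c‖ ^ k * (‖y‖ * ‖x‖) + ε / 2) := by gcongr
          _ = ‖c‖ ^ (k + 1) * (‖y‖ * ‖x‖) + ‖c‖ * (ε / 2) := by ring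
          _ < _ := by nlinarith [norm_nonneg c]
      have h3 : ∀ᶠ t in (l : Filter ℝ), |ra t s| < δ := 
        (tendsto_ra_left.mono_left hl).eventually (eventually_abs_lt le_rfl hs1)
      obtain ⟨t, ht1, ht2, ht3⟩ := ((h1.eventually (gt_mem_nhds h2)).and
        (h3.and (eventually_abs_lt hl (by simp : |(0 : ℝ)| < 1)))).exists
      refine ⟨ra t s, ht2, abs_ra_lt ht3 hs2, ?_⟩
      obtain ⟨d', hd1, hd2⟩ := h.V_ra ht3 hs2
      rw [hd2, smul_apply, inner_smul_right, norm_mul, hd1, one_mul]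
      rw [star_eq_adjoint, adjoint_inner_left] at ht1
      exact ht1
  have ht : Tendsto (fun k : ℕ => ‖c‖ ^ k * (‖y‖ * ‖x‖)) atTop (𝓝 0) := by
    simpa using (tendsto_pow_atTop_nhds_zero_of_lt_one (norm_nonneg c) hc1).mul_const (‖y‖ * ‖x‖)
  obtain ⟨k, hk⟩ := (ht.eventually (gt_mem_nhds (half_pos hd))).exists
  obtain ⟨s, hs1, -, hs3⟩ := hP k δ hδ (d / 2) (half_pos hd)
  linarith [hlow s hs1]

lemma Ctx.tendsto_coeff [Nontrivial K] [TopologicalSpace.SeparableSpace K] (h : Ctx T V)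
    (x : K) : Tendsto (fun r => ‖⟪x, V r x⟫_ℂ‖) (𝓝 0) (𝓝 (‖x‖ ^ 2)) := by
  rw [tendsto_iff_ultrafilter]
  intro l hl
  obtain ⟨c, hc, hlim⟩ := h.weak_limit (by simp : |(0 : ℝ)| < 1) l hl
  have hc1 := h.norm_weak_limit_zero l hl hc hlim
  obtain ⟨c₀, hc₀, hV0⟩ := h.V_zero
  have := (hlim x x).norm
  rw [hV0, smul_apply, inner_smul_right, norm_mul, norm_mul, hc1, hc₀, show (1 : K →L[ℂ] K) x = x from rfl,
    inner_self_eq_norm_sq_to_K] at this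
  simpa using this

lemma Ctx.tendsto_sub_smul [Nontrivial K] [TopologicalSpace.SeparableSpace K] (h : Ctx T V)
    {x : K} (hx : ‖x‖ = 1) :
    Tendsto (fun r => ‖V r x - ⟪x, V r x⟫_ℂ • x‖) (𝓝 0) (𝓝 0) := by
  have h1 := h.tendsto_coeff x
  have h2 : Tendsto (fun r => Real.sqrt (1 - ‖⟪x, V r x⟫_ℂ‖ ^ 2)) (𝓝 0) (𝓝 0) := by
    have : Tendsto (fun r => Real.sqrt (1 - ‖⟪x, V r x⟫_ℂ‖ ^ 2)) (𝓝 0)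
        (𝓝 (Real.sqrt (1 - (‖x‖ ^ 2) ^ 2))) :=
      (Real.continuous_sqrt.tendsto _).comp ((h1.pow 2).const_sub 1)
    simpa [hx] using this
  refine h2.congr' ?_
  filter_upwards [eventually_abs_lt le_rfl (by simp : |(0 : ℝ)| < 1)] with r hr
  set v := V r x
  set c := ⟪x, v⟫_ℂ with hc
  have hv : ‖v‖ = 1 := by rw [h.norm_V hr, hx]
  have h0 : ⟪v - c • x, c • x⟫_ℂ = 0 := by
    rw [inner_smul_right, inner_sub_left, inner_smul_left, inner_self_eq_norm_sq_to_K, hx, hc,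
      inner_conj_symm]
    simp
  have h3 := norm_add_sq_eq_norm_sq_add_norm_sq_of_inner_eq_zero _ _ h0
  rw [sub_add_cancel, hv, norm_smul, hx, mul_one] at h3
  rw [show 1 - ‖c‖ ^ 2 = ‖v - c • x‖ ^ 2 by linarith, Real.sqrt_sq (norm_nonneg _)]

end TwoShift

namespace TwoShift

open scoped InnerProductSpace ComplexConjugate
open Filter Topology MeasureTheory

lemma conj_mul_self_ne_one {w : ℂ} (hw : ‖w‖ < 1) : 1 - conj w * w ≠ 0 := by
  have h := one_add_ne_zero (z := -w) (w := w) (by simpa) hw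
  intro h'
  apply h
  linear_combination h'

lemma discAdd_neg_cancel {z w : ℂ} (hz : ‖z‖ < 1) (hw : ‖w‖ < 1) :
    discAdd (discAdd z w) (-w) = z := by
  have h1 := one_add_ne_zero hz hw
  have h2 := conj_mul_self_ne_one hw
  have h3 := one_add_ne_zero (norm_discAdd_lt hz hw) (w := -w) (by simpa)
  rw [discAdd, div_eq_iff h3, map_neg]
  refine mul_right_cancel₀ h1 ?_
  have h4 : discAdd z w * (1 + conj w * z) = z + w := div_mul_cancel₀ _ h1
  linear_combination (1 + conj w * z) * h4 

lemma discAdd_cancel_neg {z w : ℂ} (hz : ‖z‖ < 1) (hw : ‖w‖ < 1) :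
    discAdd (discAdd z (-w)) w = z := by
  have := discAdd_neg_cancel hz (w := -w) (by simpa)
  simpa using this

lemma hasDerivAt_discAdd {u z w : ℂ} (hu : ‖u‖ = 1) (hz : ‖z‖ < 1) (hw : ‖w‖ < 1) :
    HasDerivAt (fun z => discAdd (conj u * z) w)
      (conj u * (1 - conj w * w) / (1 + conj w * (conj u * z)) ^ 2) z := by
  have h1 := one_add_ne_zero (z := conj u * z) (w := w) (by simpa [hu]) hw
  have h2 : HasDerivAt (fun z => conj u * z) (conj u) z := by
    simpa using (hasDerivAt_id z).const_mul (conj u)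
  have h3 := (h2.add_const w).div ((h2.const_mul (conj w)).const_add 1) h1
  refine h3.congr_deriv ?_
  congr 1
  ring

lemma det_restrictScalars_toSpanSingleton (c : ℂ) :
    ((ContinuousLinearMap.toSpanSingleton ℂ c).restrictScalars ℝ).det = ‖c‖ ^ 2 := by
  simp [ContinuousLinearMap.det, LinearMap.det_restrictScalars,
      Algebra.norm_complex_eq, Complex.normSq_eq_norm_sq]

/-- Invariance of the hyperbolic area of the disc. -/
lemma integral_discAdd {A : Type*} [NormedAddCommGroup A] [NormedSpace ℝ A] {u w : ℂ}
    (hu : ‖u‖ = 1) (hw : ‖w‖ < 1) (g : ℂ → A) :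
    ∫ z in Metric.ball (0 : ℂ) 1, ((1 - ‖discAdd (conj u * z) w‖ ^ 2) ^ 2 / (1 - ‖z‖ ^ 2) ^ 2) •
      g (discAdd (conj u * z) w) = ∫ v in Metric.ball (0 : ℂ) 1, g v := by
  set f : ℂ → ℂ := fun z => discAdd (conj u * z) w with hf
  have hball : ∀ z, z ∈ Metric.ball (0 : ℂ) 1 ↔ ‖z‖ < 1 := fun z => mem_ball_zero_iff
  have huu := conj_mul_self_of_norm hu
  have hun : ∀ z, ‖z‖ < 1 → ‖conj u * z‖ < 1 := fun z hz => by simpa [hu]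
  have himg : Set.image f (Metric.ball (0 : ℂ) 1) = Metric.ball (0 : ℂ) 1 := by
    ext v
    constructor
    · rintro ⟨z, hz, rfl⟩
      rw [hball] at hz ⊢
      exact norm_discAdd_lt (hun z hz) hw
    · intro hv
      rw [hball] at hv
      have h1 : ‖discAdd v (-w)‖ < 1 := norm_discAdd_lt hv (by simpa)
      refine ⟨u * discAdd v (-w), ?_, ?_⟩
      · rw [hball, norm_mul, hu, one_mul]
        exact h1
      · simp only [hf]
        rw [← mul_assoc, huu, one_mul, discAdd_cancel_neg hv hw]
  have hinj : Set.InjOn f (Metric.ball (0 : ℂ) 1) := by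
    intro z hz z' hz' h
    rw [hball] at hz hz'
    have h1 := congrArg (fun v => u * discAdd v (-w)) h
    simp only [hf] at h1
    rw [discAdd_neg_cancel (hun z hz) hw, discAdd_neg_cancel (hun z' hz') hw, ← mul_assoc,
      ← mul_assoc, mul_comm u, huu, one_mul, one_mul] at h1
    exact h1
  have hder : ∀ z ∈ Metric.ball (0 : ℂ) 1, HasFDerivWithinAt f
      ((ContinuousLinearMap.toSpanSingleton ℂ (conj u * (1 - conj w * w) /
        (1 + conj w * (conj u * z)) ^ 2)).restrictScalars ℝ) (Metric.ball 0 1) z := by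
    intro z hz
    rw [hball] at hz
    exact ((hasDerivAt_discAdd hu hz hw).hasFDerivAt.restrictScalars ℝ).hasFDerivWithinAt
  have := integral_image_eq_integral_abs_det_fderiv_smul volume measurableSet_ball hder hinj g
  rw [himg] at this
  rw [this]
  refine setIntegral_congr_fun measurableSet_ball fun z hz => ?_
  rw [hball] at hz
  simp only [hf]
  congr 1
  have h1 := one_sub_normSq_discAdd (hun z hz) hw
  have h2 : (1 - ‖z‖ ^ 2) ≠ 0 := by nlinarith [norm_nonneg z]
  have h3 := one_add_ne_zero (hun z hz) hw
  have h4 : ‖1 + conj w * (conj u * z)‖ ≠ 0 := norm_ne_zero_iff.2 h3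
  have h5 : ‖1 - conj w * w‖ = 1 - ‖w‖ ^ 2 := by
    have : 1 - conj w * w = ((1 - ‖w‖ ^ 2 : ℝ) : ℂ) := by
      rw [mul_comm, Complex.mul_conj, Complex.normSq_eq_norm_sq]; push_cast; ring
    rw [this, Complex.norm_real, Real.norm_of_nonneg]
    nlinarith [norm_nonneg w]
  rw [det_restrictScalars_toSpanSingleton, abs_of_nonneg (by positivity), h1, norm_div,
    norm_pow, norm_mul (conj u) z, norm_mul (conj u) (1 - conj w * w), h5, Complex.norm_conj, hu]
  field_simp

end TwoShift

namespace TwoShift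

open scoped InnerProductSpace ComplexConjugate
open Filter Topology MeasureTheory

variable {K : Type*} [NormedAddCommGroup K] [InnerProductSpace ℂ K] [CompleteSpace K]

/-- An irreducible homogeneous block shift, with a choice of implementing unitaries. -/
structure Setup (T : K →L[ℂ] K) (V : ℂ → K →L[ℂ] K) (G : ℤ → Submodule ℂ K) : Prop where
  irr : IrreducibleOp T
  unit : ∀ c : ℂ, ‖c‖ < 1 → IsUnit (1 - conj c • T)
  impl : ∀ z : ℂ, ‖z‖ < 1 → Impl T (V z) 1 z
  grading : IsGrading G
  shift : ∀ n, ∀ x ∈ G n, T x ∈ G (n + 1)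

variable {T : K →L[ℂ] K} {V : ℂ → K →L[ℂ] K} {G : ℤ → Submodule ℂ K}

lemma Setup.ctx (h : Setup T V G) : Ctx T (fun r : ℝ => V r) where
  irr := h.irr
  unit := h.unit
  impl := fun r hr => h.impl r (norm_ofReal_lt hr)

lemma phi_zero : phi 0 T = T := by simp [phi]

lemma Setup.exists_gauge (h : Setup T V G) {u : ℂ} (hu : ‖u‖ = 1) :
    ∃ D, Impl T D u 0 ∧ ∀ n, ∀ x ∈ G n, D x = u ^ n • x := by
  obtain ⟨D, hD, hD'⟩ := h.grading.exists_gauge u hu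
  have hu0 : u ≠ 0 := by rintro rfl; simp at hu
  refine ⟨D, ⟨hD, hu, by simp, ?_⟩, hD'⟩
  refine h.grading.op_ext fun n x hx => ?_
  rw [phi_zero]
  change D (T x) = u • T (D x)
  rw [hD' n x hx, hD' _ _ (h.shift n x hx), map_smul, smul_smul, zpow_add_one₀ hu0, mul_comm]

lemma IsGrading.gauge_proj (hG : IsGrading G) {u : ℂ} {D : K →L[ℂ] K} (n : ℤ)
    (hD : ∀ x ∈ G n, D x = u ^ n • x) : D * proj (G n) = u ^ n • proj (G n) := by
  ext x
  exact hD _ (hG.proj_mem n x)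

lemma IsGrading.gauge_proj_star (hG : IsGrading G) {u : ℂ} (hu : ‖u‖ = 1) {D : K →L[ℂ] K} (n : ℤ)
    (hD : ∀ x ∈ G n, D x = u ^ n • x) : D * proj (G n) * star D = proj (G n) := by
  have h1 := hG.gauge_proj n hD
  have h2 : proj (G n) * star D = conj (u ^ n) • proj (G n) := by
    have := congrArg star h1
    rwa [star_mul, star_smul, hG.star_proj] at this
  rw [h1, smul_mul_assoc, h2, smul_smul, mul_comm, conj_mul_self_of_norm (by simp [hu]), one_smul]

/-- The moving projections. -/
def mp (V : ℂ → K →L[ℂ] K) (P : K →L[ℂ] K) (z : ℂ) : K →L[ℂ] K := V z * P * star (V z)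

lemma smul_conj_eq {c : ℂ} (hc : ‖c‖ = 1) (a P : K →L[ℂ] K) :
    (c • a) * P * star (c • a) = a * P * star a := by
  rw [star_smul, smul_mul_assoc, smul_mul_assoc, mul_smul_comm, smul_smul]
  have := conj_mul_self_of_norm hc
  rw [mul_comm] at this
  rw [show star c = conj c from rfl, this, one_smul]

lemma Setup.conj_mp [Nontrivial K] (h : Setup T V G) {W : K →L[ℂ] K} {u w z : ℂ}
    (hW : Impl T W u w) (hz : ‖z‖ < 1) (n : ℤ) :
    W * mp V (proj (G n)) z * star W = mp V (proj (G n)) (discAdd (conj u * z) w) := by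
  have h1 := hW.mul h.unit (h.impl z hz)
  obtain ⟨D, hD, hD'⟩ := h.exists_gauge h1.norm_u
  have h2 := (h.impl _ h1.norm_z).mul h.unit hD
  simp only [mul_zero, add_zero, map_one, div_one, mul_one] at h2
  rw [show discAdd 0 (discAdd (conj u * z) w) = discAdd (conj u * z) w by simp [discAdd]] at h2
  obtain ⟨c, hc, hc'⟩ := h2.unique h.irr h1
  calc W * mp V (proj (G n)) z * star W = (W * V z) * proj (G n) * star (W * V z) := by
        rw [star_mul, mp]; simp only [mul_assoc]
    _ = V (discAdd (conj u * z) w) * (D * proj (G n) * star D) *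
          star (V (discAdd (conj u * z) w)) := by
        rw [hc', smul_conj_eq hc, star_mul]; simp only [mul_assoc]
    _ = _ := by rw [h.grading.gauge_proj_star h1.norm_u n (hD' n), mp]

lemma Setup.mp_zero [Nontrivial K] (h : Setup T V G) (n : ℤ) :
    mp V (proj (G n)) 0 = proj (G n) := by
  obtain ⟨c, hc, hc'⟩ := h.ctx.V_zero
  simp only [Complex.ofReal_zero] at hc'
  rw [mp, hc', smul_conj_eq hc, one_mul, star_one, mul_one]

lemma Setup.star_V [Nontrivial K] (h : Setup T V G) {r : ℝ} (hr : |r| < 1) :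
    ∃ c : ℂ, ‖c‖ = 1 ∧ star (V r) = c • V ((-r : ℝ) : ℂ) := by
  obtain ⟨c, hc, h1⟩ := h.ctx.V_ra hr (r := -r) (by simpa)
  obtain ⟨d, hd, h2⟩ := h.ctx.V_zero
  have h3 : ra r (-r) = 0 := by simp [ra]
  rw [h3, h2] at h1
  have hm := (Unitary.mem_iff.1 (h.impl r (norm_ofReal_lt hr)).mem)
  have h4 := congrArg (fun a => conj d • (a * star (V r))) h1
  simp only [smul_mul_assoc, one_mul, mul_assoc, hm.2, mul_one, smul_smul,
    conj_mul_self_of_norm hd, one_smul] at h4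
  exact ⟨conj d * c, by simp [hc, hd], h4⟩

lemma IsGrading.norm_one_sub_proj_le (hG : IsGrading G) (n : ℤ) : ‖1 - proj (G n)‖ ≤ 1 := by
  have := hG.hasProj n
  rw [hG.proj_eq, ← Submodule.starProjection_orthogonal']
  exact Submodule.starProjection_norm_le _

lemma norm_one_sub_proj_mul_le (hG : IsGrading G) {n : ℤ} [FiniteDimensional ℂ (G n)]
    (W : K →L[ℂ] K) (c : Fin (Module.finrank ℂ (G n)) → ℂ) :
    ‖(1 - proj (G n)) * W * proj (G n)‖ ≤
      ∑ i, ‖W (stdOrthonormalBasis ℂ (G n) i) - c i • (stdOrthonormalBasis ℂ (G n) i : K)‖ := by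
  set b := stdOrthonormalBasis ℂ (G n) with hb
  refine opNorm_le_bound _ (Finset.sum_nonneg fun _ _ => norm_nonneg _) fun x => ?_
  set y : G n := ⟨proj (G n) x, hG.proj_mem n x⟩ with hy
  have hyx : ‖y‖ ≤ ‖x‖ := by
    change ‖proj (G n) x‖ ≤ _
    exact (le_opNorm _ _).trans (by
      have := hG.norm_proj_le n
      nlinarith [norm_nonneg x])
  have h1 : proj (G n) x = ∑ i, ⟪b i, y⟫_ℂ • (b i : K) := by
    have := congrArg (Submodule.subtype (G n)) (b.sum_repr' y)
    rw [map_sum] at this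
    exact this.symm
  have hP : ∀ v, (1 - proj (G n)) v = v - proj (G n) v := fun v => rfl
  have h2 : ((1 - proj (G n)) * W * proj (G n)) x =
      ∑ i, ⟪b i, y⟫_ℂ • (1 - proj (G n)) (W (b i) - c i • (b i : K)) := by
    change (1 - proj (G n)) (W (proj (G n) x)) = _
    rw [h1, map_sum, map_sum]
    refine Finset.sum_congr rfl fun i _ => ?_
    rw [map_smul, map_smul, map_sub, map_smul, hP (b i : K), hG.proj_of_mem (b i).2, sub_self,
      smul_zero, sub_zero]
  have hQ : ∀ v, ‖(1 - proj (G n)) v‖ ≤ ‖v‖ := fun v => by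
    have := (le_opNorm (1 - proj (G n)) v)
    nlinarith [hG.norm_one_sub_proj_le n, norm_nonneg v]
  rw [h2, Finset.sum_mul]
  refine norm_sum_le_of_le _ fun i _ => ?_
  rw [norm_smul, mul_comm]
  refine mul_le_mul (hQ _) ?_ (norm_nonneg _) (norm_nonneg _)
  refine (norm_inner_le_norm _ _).trans ?_
  rw [b.norm_eq_one, one_mul]
  exact hyx

lemma Setup.tendsto_norm_off [Nontrivial K] [TopologicalSpace.SeparableSpace K]
    (h : Setup T V G) (n : ℤ) [FiniteDimensional ℂ (G n)] :
    Tendsto (fun r : ℝ => ‖(1 - proj (G n)) * V r * proj (G n)‖) (𝓝 0) (𝓝 0) := by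
  refine squeeze_zero (fun _ => norm_nonneg _) (fun r => norm_one_sub_proj_mul_le h.grading (V r)
    (fun i => ⟪(stdOrthonormalBasis ℂ (G n) i : K), V r (stdOrthonormalBasis ℂ (G n) i)⟫_ℂ)) ?_
  have : Tendsto (fun r : ℝ => ∑ i, ‖V r (stdOrthonormalBasis ℂ (G n) i) -
      ⟪(stdOrthonormalBasis ℂ (G n) i : K), V r (stdOrthonormalBasis ℂ (G n) i)⟫_ℂ •
      (stdOrthonormalBasis ℂ (G n) i : K)‖) (𝓝 0)
      (𝓝 (∑ _i : Fin (Module.finrank ℂ (G n)), (0 : ℝ))) := by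
    refine tendsto_finsetSum _ fun i _ => h.ctx.tendsto_sub_smul ?_
    exact (stdOrthonormalBasis ℂ (G n)).norm_eq_one i
  simpa using this

lemma norm_mul_star_unitary {W : K →L[ℂ] K} (hW : W ∈ unitary (K →L[ℂ] K)) (a : K →L[ℂ] K) :
    ‖W * a * star W‖ = ‖a‖ := by
  rw [CStarRing.norm_mul_mem_unitary _ (Unitary.star_mem hW), CStarRing.norm_mem_unitary_mul _ hW]

lemma Setup.off_star [Nontrivial K] (h : Setup T V G) (n : ℤ) {r : ℝ} (hr : |r| < 1) :
    ‖(1 - proj (G n)) * star (V r) * proj (G n)‖ =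
      ‖(1 - proj (G n)) * V ((-r : ℝ) : ℂ) * proj (G n)‖ := by
  obtain ⟨c, hc, hc'⟩ := h.star_V hr
  rw [hc', mul_smul_comm, smul_mul_assoc, norm_smul, hc, one_mul]

lemma Setup.norm_mp_sub [Nontrivial K] (h : Setup T V G) (n : ℤ) {r : ℝ} (hr : |r| < 1) :
    ‖mp V (proj (G n)) r - proj (G n)‖ ≤ ‖(1 - proj (G n)) * V r * proj (G n)‖ +
      ‖(1 - proj (G n)) * V ((-r : ℝ) : ℂ) * proj (G n)‖ := by
  set P := proj (G n) with hP
  have hV := (h.impl r (norm_ofReal_lt hr)).mem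
  have hm := Unitary.mem_iff.1 hV
  have h1 : mp V P r - P = ((1 - P) * V r * P) * star (V r) -
      P * (V r * (1 - P)) * star (V r) := by
    have : P * (V r * (1 - P)) * star (V r) = P * (V r * star (V r)) - P * V r * P * star (V r) := by
      noncomm_ring
    rw [this, hm.2, mp]
    noncomm_ring
  have h2 : ‖P * (V r * (1 - P))‖ = ‖(1 - P) * V ((-r : ℝ) : ℂ) * P‖ := by
    rw [← h.off_star n hr, ← norm_star, star_mul, star_mul, star_sub, star_one, h.grading.star_proj]
  rw [h1]
  refine (norm_sub_le _ _).trans ?_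
  rw [CStarRing.norm_mul_mem_unitary _ (Unitary.star_mem hV),
    CStarRing.norm_mul_mem_unitary _ (Unitary.star_mem hV), h2]

lemma exists_unit_rotation (z : ℂ) : ∃ u : ℂ, ‖u‖ = 1 ∧ z = conj u * ((‖z‖ : ℝ) : ℂ) := by
  rcases eq_or_ne z 0 with rfl | hz
  · exact ⟨1, by simp, by simp⟩
  · have hz' : ((‖z‖ : ℝ) : ℂ) ≠ 0 := by simpa using hz
    refine ⟨conj (z / (‖z‖ : ℝ)), ?_, ?_⟩
    · rw [Complex.norm_conj, norm_div, Complex.norm_real, norm_norm, div_self (by simpa using hz)]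
    · rw [Complex.conj_conj, div_mul_cancel₀ _ hz']

lemma Setup.norm_mp_sub_complex [Nontrivial K] (h : Setup T V G) (n : ℤ) {z : ℂ} (hz : ‖z‖ < 1) :
    ‖mp V (proj (G n)) z - proj (G n)‖ = ‖mp V (proj (G n)) ((‖z‖ : ℝ) : ℂ) - proj (G n)‖ := by
  obtain ⟨u, hu, huz⟩ := exists_unit_rotation z
  obtain ⟨D, hD, hD'⟩ := h.exists_gauge hu
  have h1 := h.conj_mp hD (z := ((‖z‖ : ℝ) : ℂ)) (by simpa) n
  rw [show discAdd (conj u * ((‖z‖ : ℝ) : ℂ)) 0 = z by simp [discAdd, ← huz]] at h1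
  have h2 := h.grading.gauge_proj_star hu n (hD' n)
  rw [← norm_mul_star_unitary hD.mem (mp V (proj (G n)) ((‖z‖ : ℝ) : ℂ) - _), mul_sub, sub_mul,
    h1, h2]

lemma Setup.tendsto_mp_zero [Nontrivial K] [TopologicalSpace.SeparableSpace K]
    (h : Setup T V G) (n : ℤ) [FiniteDimensional ℂ (G n)] :
    Tendsto (fun z : ℂ => ‖mp V (proj (G n)) z - proj (G n)‖) (𝓝 0) (𝓝 0) := by
  have h1 := h.tendsto_norm_off n
  have h2 : Tendsto (fun r : ℝ => -r) (𝓝 0) (𝓝 0) := by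
    simpa using (continuous_neg.tendsto (0 : ℝ))
  have h3 := h1.add (h1.comp h2)
  have h4 : Tendsto (fun z : ℂ => ‖z‖) (𝓝 0) (𝓝 0) := by
    simpa using (continuous_norm.tendsto (0 : ℂ))
  have h5 := h3.comp h4
  rw [add_zero] at h5
  refine squeeze_zero' (Eventually.of_forall fun _ => norm_nonneg _) ?_ h5
  filter_upwards [Metric.ball_mem_nhds (0 : ℂ) one_pos] with z hz
  rw [mem_ball_zero_iff] at hz
  rw [h.norm_mp_sub_complex n hz]
  exact h.norm_mp_sub n (by simpa)

lemma Setup.continuousOn_mp [Nontrivial K] [TopologicalSpace.SeparableSpace K]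
    (h : Setup T V G) (n : ℤ) [FiniteDimensional ℂ (G n)] :
    ContinuousOn (mp V (proj (G n))) (Metric.ball 0 1) := by
  intro w hw
  have hw' : ‖w‖ < 1 := mem_ball_zero_iff.1 hw
  refine ContinuousAt.continuousWithinAt ?_
  rw [ContinuousAt, tendsto_iff_norm_sub_tendsto_zero]
  have h0 : Tendsto (fun z => discAdd z (-w)) (𝓝 w) (𝓝 0) := by
    have : ContinuousAt (fun z => discAdd z (-w)) w := by
      have h1 := hasDerivAt_discAdd (u := 1) (by simp) hw' (w := -w) (by simpa)
      simpa using h1.continuousAt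
    have h2 := this.tendsto
    simpa [discAdd] using h2
  refine ((h.tendsto_mp_zero n).comp h0).congr' ?_
  filter_upwards [Metric.isOpen_ball.mem_nhds hw] with z hz
  have hz' : ‖z‖ < 1 := mem_ball_zero_iff.1 hz
  have hI := h.impl w hw'
  have hz1 : ‖discAdd z (-w)‖ < 1 := norm_discAdd_lt hz' (by simpa)
  have h1 := h.conj_mp hI hz1 n
  have h2 := h.conj_mp hI (z := 0) (by simp) n
  rw [map_one, one_mul, discAdd_cancel_neg hz' hw'] at h1
  rw [mul_zero, h.mp_zero, show discAdd 0 w = w by simp [discAdd]] at h2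
  rw [Function.comp_apply, ← norm_mul_star_unitary hI.mem (mp V (proj (G n)) _ - _), mul_sub, sub_mul, h1, h2]

lemma Setup.norm_mp_le (h : Setup T V G) (n : ℤ) {z : ℂ} (hz : ‖z‖ < 1) :
    ‖mp V (proj (G n)) z‖ ≤ 1 := by
  rw [mp, norm_mul_star_unitary (h.impl z hz).mem]
  exact h.grading.norm_proj_le n

end TwoShift

namespace TwoShift

open scoped InnerProductSpace ComplexConjugate
open Filter Topology MeasureTheory

variable {K : Type*} [NormedAddCommGroup K] [InnerProductSpace ℂ K] [CompleteSpace K]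

variable {T : K →L[ℂ] K} {V : ℂ → K →L[ℂ] K} {G : ℤ → Submodule ℂ K}

/-- A bump on the disc in terms of the invariant density, translated by `w`. -/
def bump (δ : ℝ) (w v : ℂ) : ℝ := max 0 (1 - ‖discAdd v (-w)‖ ^ 2 - δ) / (1 - ‖v‖ ^ 2) ^ 2

lemma one_sub_sq_pos {v : ℂ} (hv : ‖v‖ < 1) : 0 < 1 - ‖v‖ ^ 2 := by nlinarith [norm_nonneg v]

lemma bump_nonneg (δ : ℝ) (w v : ℂ) : 0 ≤ bump δ w v := by
  unfold bump; positivity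

lemma one_sub_normSq_discAdd_le {v w : ℂ} (hv : ‖v‖ < 1) (hw : ‖w‖ ≤ 1 / 2) :
    1 - ‖discAdd v (-w)‖ ^ 2 ≤ 4 * (1 - ‖v‖ ^ 2) := by
  have hw1 : ‖-w‖ < 1 := by rw [norm_neg]; linarith
  rw [one_sub_normSq_discAdd hv hw1, norm_neg]
  have h1 : 1 / 2 ≤ ‖1 + conj (-w) * v‖ := by
    have := norm_sub_norm_le (1 : ℂ) (-(conj (-w) * v))
    rw [sub_neg_eq_add, norm_neg, norm_mul, Complex.norm_conj, norm_neg, norm_one] at this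
    nlinarith [norm_nonneg w, norm_nonneg v]
  have h2 := one_sub_sq_pos hv
  rw [div_le_iff₀ (by positivity)]
  have h3 : 1 / 4 ≤ ‖1 + conj (-w) * v‖ ^ 2 := by nlinarith
  nlinarith [sq_nonneg ‖w‖]

lemma bump_eq_zero {δ : ℝ} {v w : ℂ} (hv : ‖v‖ < 1) (hw : ‖w‖ ≤ 1 / 2)
    (h : 1 - ‖v‖ ^ 2 ≤ δ / 4) : bump δ w v = 0 := by
  have := one_sub_normSq_discAdd_le hv hw
  rw [bump, max_eq_left (by linarith), zero_div]

lemma norm_bump_le {δ : ℝ} (hδ : 0 < δ) {v w : ℂ} (hv : ‖v‖ < 1) (hw : ‖w‖ ≤ 1 / 2) :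
    ‖bump δ w v‖ ≤ 16 / δ ^ 2 := by
  rw [Real.norm_of_nonneg (bump_nonneg _ _ _)]
  rcases le_total (1 - ‖v‖ ^ 2) (δ / 4) with h | h
  · rw [bump_eq_zero hv hw h]; positivity
  · have h1 : max 0 (1 - ‖discAdd v (-w)‖ ^ 2 - δ) ≤ 1 :=
      max_le zero_le_one (by nlinarith [norm_nonneg (discAdd v (-w))])
    rw [bump, div_le_div_iff₀ (by have := one_sub_sq_pos hv; positivity) (by positivity)]
    have h2 : δ ^ 2 ≤ 16 * (1 - ‖v‖ ^ 2) ^ 2 := by nlinarith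
    nlinarith [sq_nonneg δ]

lemma continuousOn_discAdd {w : ℂ} (hw : ‖w‖ < 1) :
    ContinuousOn (fun v => discAdd v w) (Metric.ball 0 1) := by
  intro v hv
  have := hasDerivAt_discAdd (u := 1) (by simp) (mem_ball_zero_iff.1 hv) hw
  simpa using this.continuousAt.continuousWithinAt

lemma continuousOn_bump {δ : ℝ} {w : ℂ} (hw : ‖w‖ < 1) :
    ContinuousOn (bump δ w) (Metric.ball 0 1) := by
  have h := continuousOn_discAdd (w := -w) (by simpa)
  refine ContinuousOn.div ?_ (by fun_prop) fun v hv => ?_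
  · exact continuousOn_const.sup ((continuousOn_const.sub (h.norm.pow 2)).sub continuousOn_const)
  · have := one_sub_sq_pos (mem_ball_zero_iff.1 hv)
    positivity

lemma integrableOn_of_continuousOn_ball {A : Type*} [NormedAddCommGroup A] {f : ℂ → A} {C : ℝ}
    (hf : ContinuousOn f (Metric.ball 0 1)) (hC : ∀ v, ‖v‖ < 1 → ‖f v‖ ≤ C) :
    IntegrableOn f (Metric.ball 0 1) := by
  have : IsFiniteMeasure (volume.restrict (Metric.ball (0 : ℂ) 1)) :=
    ⟨by simpa using measure_ball_lt_top⟩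
  refine Integrable.of_bound (hf.aestronglyMeasurable measurableSet_ball) C ?_
  filter_upwards [ae_restrict_mem measurableSet_ball] with v hv
  exact hC v (mem_ball_zero_iff.1 hv)

lemma integrableOn_bump {δ : ℝ} (hδ : 0 < δ) {w : ℂ} (hw : ‖w‖ ≤ 1 / 2) :
    IntegrableOn (bump δ w) (Metric.ball 0 1) :=
  integrableOn_of_continuousOn_ball (continuousOn_bump (by linarith))
    fun _ hv => norm_bump_le hδ hv hw

section
variable [Nontrivial K] [TopologicalSpace.SeparableSpace K]

lemma Setup.integrableOn_mp (h : Setup T V G) (n : ℤ) [FiniteDimensional ℂ (G n)]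
    {δ : ℝ} (hδ : 0 < δ) {w : ℂ} (hw : ‖w‖ ≤ 1 / 2) :
    IntegrableOn (fun v => bump δ w v • mp V (proj (G n)) v) (Metric.ball 0 1) := by
  refine integrableOn_of_continuousOn_ball (C := 16 / δ ^ 2)
    ((continuousOn_bump (by linarith)).smul (h.continuousOn_mp n)) fun v hv => ?_
  rw [norm_smul]
  have h1 := norm_bump_le hδ hv hw
  have h2 := h.norm_mp_le n hv
  nlinarith [norm_nonneg (bump δ w v), norm_nonneg (mp V (proj (G n)) v)]

lemma discAdd_zero (z : ℂ) : discAdd z 0 = z := by simp [discAdd]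

lemma Setup.conj_integral (h : Setup T V G) (n : ℤ) [FiniteDimensional ℂ (G n)]
    {δ : ℝ} (hδ : 0 < δ) {W : K →L[ℂ] K} {u w : ℂ} (hW : Impl T W u w) :
    W * (∫ v in Metric.ball (0 : ℂ) 1, bump δ 0 v • mp V (proj (G n)) v) * star W =
      ∫ v in Metric.ball (0 : ℂ) 1, bump δ w v • mp V (proj (G n)) v := by
  have hi := h.integrableOn_mp n hδ (w := 0) (by simp)
  rw [← integral_const_mul_of_integrable hi, ← integral_mul_const_of_integrable (hi.const_mul W),
    ← integral_discAdd hW.norm_u hW.norm_z (fun v => bump δ w v • mp V (proj (G n)) v)]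
  refine setIntegral_congr_fun measurableSet_ball fun z hz => ?_
  have hz' : ‖z‖ < 1 := mem_ball_zero_iff.1 hz
  have hz1 : ‖conj u * z‖ < 1 := by simpa [hW.norm_u]
  have h1 := (one_sub_sq_pos hz').ne'
  have h2 := (one_sub_sq_pos (norm_discAdd_lt hz1 hW.norm_z)).ne'
  rw [mul_smul_comm, smul_mul_assoc, h.conj_mp hW hz', smul_smul]
  congr 1
  rw [bump, bump, discAdd_neg_cancel hz1 hW.norm_z, neg_zero, discAdd_zero, norm_mul,
    Complex.norm_conj, hW.norm_u, one_mul]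
  field_simp

lemma bump_rotate (δ : ℝ) (v : ℂ) : bump δ 0 v = max 0 (1 - ‖v‖ ^ 2 - δ) / (1 - ‖v‖ ^ 2) ^ 2 := by
  rw [bump, neg_zero, discAdd_zero]

lemma bump_sub_le {δ : ℝ} (hδ : 0 < δ) {r : ℝ} (hr : |r| ≤ 1 / 2) {v : ℂ} (hv : ‖v‖ < 1) :
    |bump δ r v - bump δ 0 v| ≤ 64 / δ * |r| := by
  have hr' : ‖(r : ℂ)‖ ≤ 1 / 2 := by simpa using hr
  rcases le_total (1 - ‖v‖ ^ 2) (δ / 4) with h | h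
  · rw [bump_eq_zero hv hr' h, bump_eq_zero hv (by simp) h, sub_zero, abs_zero]; positivity
  have hv0 := one_sub_sq_pos hv
  have hw1 : ‖-(r : ℂ)‖ < 1 := by rw [norm_neg]; linarith
  set D := ‖1 + conj (-(r : ℂ)) * v‖ with hD
  have hD1 : 1 / 2 ≤ D := by
    have := norm_sub_norm_le (1 : ℂ) (-(conj (-(r : ℂ)) * v))
    rw [sub_neg_eq_add, norm_neg, norm_mul, Complex.norm_conj, norm_neg, norm_one] at this
    nlinarith [norm_nonneg (r : ℂ), norm_nonneg v]
  have hD2 : D ^ 2 = 1 - 2 * r * v.re + r ^ 2 * ‖v‖ ^ 2 := by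
    rw [hD, ← Complex.normSq_eq_norm_sq, ← Complex.normSq_eq_norm_sq, Complex.normSq_apply,
      Complex.normSq_apply]
    simp
    ring
  have hre : |v.re| ≤ 1 := (Complex.abs_re_le_norm v).trans hv.le
  have h1 : |(1 - r ^ 2) - D ^ 2| ≤ 4 * |r| := by
    rw [hD2]
    have e1 : (1 - r ^ 2) - (1 - 2 * r * v.re + r ^ 2 * ‖v‖ ^ 2) =
      r * (2 * v.re - r * (1 + ‖v‖ ^ 2)) := by ring
    rw [e1, abs_mul, mul_comm]
    gcongr
    refine (abs_sub _ _).trans ?_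
    rw [abs_mul, abs_mul, abs_of_nonneg (by positivity : 0 ≤ 1 + ‖v‖ ^ 2), abs_two]
    nlinarith [abs_nonneg r, norm_nonneg v]
  have h2 : |(1 - ‖discAdd v (-(r : ℂ))‖ ^ 2) - (1 - ‖v‖ ^ 2)| ≤ (1 - ‖v‖ ^ 2) * (16 * |r|) := by
    rw [one_sub_normSq_discAdd hv hw1, norm_neg, ← hD]
    have e1 : (1 - ‖v‖ ^ 2) * (1 - ‖(r : ℂ)‖ ^ 2) / D ^ 2 - (1 - ‖v‖ ^ 2) =
        (1 - ‖v‖ ^ 2) * (((1 - r ^ 2) - D ^ 2) / D ^ 2) := by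
      have : D ≠ 0 := by linarith
      rw [Complex.norm_real, Real.norm_eq_abs, sq_abs]
      field_simp
    rw [e1, abs_mul, abs_of_pos hv0]
    gcongr
    rw [abs_div, abs_of_nonneg (sq_nonneg D), div_le_iff₀ (by positivity)]
    have : 1 / 4 ≤ D ^ 2 := by nlinarith
    nlinarith [abs_nonneg r]
  have h3 : |max 0 (1 - ‖discAdd v (-(r : ℂ))‖ ^ 2 - δ) - max 0 (1 - ‖v‖ ^ 2 - δ)| ≤
      (1 - ‖v‖ ^ 2) * (16 * |r|) := by
    refine (abs_max_sub_max_le_max _ _ _ _).trans ?_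
    simp only [sub_self, abs_zero, sub_sub_sub_cancel_right]
    exact max_le (by positivity) h2
  rw [bump_rotate, bump, ← sub_div, abs_div, abs_of_pos (by positivity : 0 < (1 - ‖v‖ ^ 2) ^ 2),
    div_le_iff₀ (by positivity)]
  refine h3.trans ?_
  have : 64 / δ * |r| * (1 - ‖v‖ ^ 2) ^ 2 = (1 - ‖v‖ ^ 2) * (16 * |r| * (4 * (1 - ‖v‖ ^ 2) / δ)) := by
    field_simp; ring
  rw [this]
  refine mul_le_mul_of_nonneg_left ?_ hv0.le
  have : 1 ≤ 4 * (1 - ‖v‖ ^ 2) / δ := by rw [le_div_iff₀ hδ]; linarith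
  nlinarith [abs_nonneg r]

lemma Setup.norm_conj_integral_sub (h : Setup T V G) (n : ℤ) [FiniteDimensional ℂ (G n)]
    {δ : ℝ} (hδ : 0 < δ) : ∃ C, 0 ≤ C ∧ ∀ r : ℝ, |r| ≤ 1 / 2 →
    ‖V r * (∫ v in Metric.ball (0 : ℂ) 1, bump δ 0 v • mp V (proj (G n)) v) * star (V r) -
      ∫ v in Metric.ball (0 : ℂ) 1, bump δ 0 v • mp V (proj (G n)) v‖ ≤ C * |r| := by
  refine ⟨64 / δ * (volume (Metric.ball (0 : ℂ) 1)).toReal, by positivity, fun r hr => ?_⟩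
  have hr' : ‖(r : ℂ)‖ ≤ 1 / 2 := by simpa using hr
  rw [h.conj_integral n hδ (h.impl r (by linarith)),
    ← integral_sub (h.integrableOn_mp n hδ hr') (h.integrableOn_mp n hδ (by simp))]
  refine (norm_setIntegral_le_of_norm_le_const (C := 64 / δ * |r|) measure_ball_lt_top
    fun v hv => ?_).trans (le_of_eq ?_)
  · have hv' : ‖v‖ < 1 := mem_ball_zero_iff.1 hv
    rw [← sub_smul, norm_smul]
    have h1 := bump_sub_le hδ hr hv'
    have h2 := h.norm_mp_le n hv'
    rw [Real.norm_eq_abs]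
    nlinarith [abs_nonneg (bump δ r v - bump δ 0 v), norm_nonneg (mp V (proj (G n)) v)]
  · rw [Measure.real]; ring

end
end TwoShift

namespace TwoShift

open scoped InnerProductSpace ComplexConjugate
open Filter Topology MeasureTheory

variable {K : Type*} [NormedAddCommGroup K] [InnerProductSpace ℂ K] [CompleteSpace K]

variable {T : K →L[ℂ] K} {V : ℂ → K →L[ℂ] K} {G : ℤ → Submodule ℂ K}

lemma exp_I_zpow_injective {m n : ℤ} (h : Complex.exp Complex.I ^ m = Complex.exp Complex.I ^ n) :
    m = n := by
  rw [← Complex.exp_int_mul, ← Complex.exp_int_mul, Complex.exp_eq_exp_iff_exists_int] at h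
  obtain ⟨k, hk⟩ := h
  have h1 : ((m - n : ℤ) : ℂ) = ((2 * k : ℤ) : ℂ) * (Real.pi : ℂ) := by
    have : Complex.I * ((m : ℂ) - n - 2 * k * Real.pi) = 0 := by linear_combination hk
    have := (mul_eq_zero.1 this).resolve_left Complex.I_ne_zero
    push_cast
    linear_combination this
  have h2 : ((m - n : ℤ) : ℝ) = ((2 * k : ℤ) : ℝ) * Real.pi := by exact_mod_cast h1
  by_cases hk0 : k = 0
  · subst hk0
    have : ((m - n : ℤ) : ℝ) = 0 := by simpa using h2
    have : m - n = 0 := by exact_mod_cast this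
    omega
  · exfalso
    refine irrational_pi ⟨((m - n : ℤ) : ℚ) / ((2 * k : ℤ) : ℚ), ?_⟩
    push_cast
    push_cast at h2
    have : (k : ℝ) ≠ 0 := by exact_mod_cast hk0
    rw [h2]
    field_simp

/-- An operator fixed by all gauge transformations preserves the grading. -/
lemma Setup.mem_of_gauge (h : Setup T V G) {b : K →L[ℂ] K}
    (hb : ∀ (D : K →L[ℂ] K) (u : ℂ), Impl T D u 0 → D * b = b * D) {n : ℤ} {x : K} (hx : x ∈ G n) :
    b x ∈ G n := by
  have hu : ‖Complex.exp Complex.I‖ = 1 := by simpa using Complex.norm_exp_ofReal_mul_I 1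
  set u := Complex.exp Complex.I with hu'
  obtain ⟨D, hD, hD'⟩ := h.exists_gauge hu
  have h1 : D (b x) = u ^ n • b x := by
    have := DFunLike.congr_fun (hb D u hD) x
    change D (b x) = b (D x) at this
    rw [this, hD' n x hx, map_smul]
  refine h.grading.mem_of_proj fun m hm => ?_
  have h2 : D * proj (G m) = u ^ m • proj (G m) := h.grading.gauge_proj m (hD' m)
  have h3 : proj (G m) * D = u ^ m • proj (G m) := by
    have e := congrArg star h2
    rw [star_mul, star_smul, h.grading.star_proj] at e
    calc proj (G m) * D = (u ^ m * conj (u ^ m)) • (proj (G m) * D) := by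
          rw [mul_comm, conj_mul_self_of_norm (by simp [hu]), one_smul]
      _ = u ^ m • ((proj (G m) * star D) * D) := by
          rw [e, mul_smul, smul_mul_assoc]; rfl
      _ = _ := by rw [mul_assoc, (Unitary.mem_iff.1 hD.mem).1, mul_one]
  have h4 : u ^ n • proj (G m) (b x) = u ^ m • proj (G m) (b x) := by
    have := DFunLike.congr_fun h3 (b x)
    change proj (G m) (D (b x)) = u ^ m • proj (G m) (b x) at this
    rw [← this, h1, map_smul]
  rw [← sub_eq_zero, ← sub_smul, smul_eq_zero, sub_eq_zero] at h4
  exact h4.resolve_left fun h5 => hm (exp_I_zpow_injective h5).symm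

lemma IsGrading.commute_proj (hG : IsGrading G) {b : K →L[ℂ] K} (hb : ∀ n, ∀ x ∈ G n, b x ∈ G n)
    (n : ℤ) : b * proj (G n) = proj (G n) * b := by
  refine hG.op_ext fun m x hx => ?_
  change b (proj (G n) x) = proj (G n) (b x)
  rcases eq_or_ne n m with rfl | hne
  · rw [hG.proj_of_mem hx, hG.proj_of_mem (hb _ _ hx)]
  · rw [hG.proj_of_mem_ne hne hx, hG.proj_of_mem_ne hne (hb _ _ hx), map_zero]

lemma davis_kahan {P b W : K →L[ℂ] K} {m C : ℝ} (hm : 0 < m) (hP : P * P = P) (hP1 : ‖P‖ ≤ 1)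
    (hQ1 : ‖1 - P‖ ≤ 1)
    (hbP : b * P = P * b) (hb : ‖b - (m : ℂ) • P‖ ≤ m / 4) (hW : W ∈ unitary (K →L[ℂ] K))
    (hC : ‖W * b * star W - b‖ ≤ C) : ‖(1 - P) * star W * P‖ ≤ 2 * C / m := by
  have hW1 := (Unitary.mem_iff.1 hW).1
  have hW2 := (Unitary.mem_iff.1 hW).2
  set N := ‖(1 - P) * star W * P‖ with hN
  set d := b - (m : ℂ) • P with hd
  have hb' : b = (m : ℂ) • P + d := by rw [hd]; abel
  have hdP : d * P = P * d := by rw [hd, sub_mul, mul_sub, hbP, smul_mul_assoc, mul_smul_comm]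
  have key : (m : ℂ) • ((1 - P) * star W * P) =
      -((1 - P) * star W * (W * b * star W - b) * P) + d * ((1 - P) * star W * P) -
        (1 - P) * star W * P * (d * P) := by
    have e1 : (1 - P) * star W * (W * b * star W - b) * P =
        (1 - P) * b * star W * P - (1 - P) * star W * (b * P) := by
      have : (1 - P) * star W * (W * b * star W - b) * P =
        (1 - P) * (star W * W) * b * star W * P - (1 - P) * star W * (b * P) := by noncomm_ring
      rw [this, hW1, mul_one]
    have e2 : (1 - P) * b = d * (1 - P) := by
      rw [hd, sub_mul, one_mul, mul_sub, mul_one, sub_mul, smul_mul_assoc, hP, hbP]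
      abel
    have e3 : b * P = (m : ℂ) • P + P * (d * P) := by
      rw [show b * P = ((m : ℂ) • P + d) * P by rw [← hb'], add_mul, smul_mul_assoc, hP]
      have : P * (d * P) = d * P := by rw [hdP, ← mul_assoc, hP]
      rw [this]
    rw [e1, e2, e3, mul_add, mul_smul_comm]
    simp only [mul_assoc]
    abel
  have hL : ‖(m : ℂ) • ((1 - P) * star W * P)‖ = m * N := by
    rw [norm_smul, Complex.norm_real, Real.norm_of_nonneg hm.le]
  have hC0 : 0 ≤ C := (norm_nonneg _).trans hC
  have b1 : ‖(1 - P) * star W * (W * b * star W - b) * P‖ ≤ C := by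
    have hs : ‖(1 - P) * star W‖ ≤ 1 := by
      rwa [CStarRing.norm_mul_mem_unitary _ (Unitary.star_mem hW)]
    calc _ ≤ ‖(1 - P) * star W‖ * ‖W * b * star W - b‖ * ‖P‖ :=
          (norm_mul_le _ _).trans (by gcongr; exact norm_mul_le _ _)
      _ ≤ 1 * C * 1 := by gcongr
      _ = C := by ring
  have hN0 : 0 ≤ N := norm_nonneg _
  have b2 : ‖d * ((1 - P) * star W * P)‖ ≤ m / 4 * N := (norm_mul_le _ _).trans (by gcongr)
  have b3 : ‖(1 - P) * star W * P * (d * P)‖ ≤ N * (m / 4 * 1) :=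
    (norm_mul_le _ _).trans (by gcongr; exact (norm_mul_le _ _).trans (by gcongr))
  have b4 : m * N ≤ C + m / 4 * N + N * (m / 4 * 1) := by
    rw [← hL, key]
    refine (norm_sub_le _ _).trans (add_le_add ((norm_add_le _ _).trans (add_le_add ?_ b2)) b3)
    rw [norm_neg]; exact b1
  rw [le_div_iff₀ hm]
  linarith

section
variable [Nontrivial K] [TopologicalSpace.SeparableSpace K]

lemma integral_bump_pos {δ : ℝ} (hδ : 0 < δ) (hδ1 : δ < 1) :
    0 < ∫ v in Metric.ball (0 : ℂ) 1, bump δ 0 v := by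
  rw [setIntegral_pos_iff_support_of_nonneg_ae (Eventually.of_forall fun v => bump_nonneg _ _ _)
    (integrableOn_bump hδ (by simp))]
  have h1 : 0 < Real.sqrt (1 - δ) := Real.sqrt_pos.2 (by linarith)
  refine (Metric.measure_ball_pos volume (0 : ℂ) h1).trans_le (measure_mono fun v hv => ?_)
  rw [mem_ball_zero_iff, Real.lt_sqrt (norm_nonneg _)] at hv
  have hv1 : ‖v‖ < 1 := by nlinarith [norm_nonneg v]
  refine ⟨?_, mem_ball_zero_iff.2 hv1⟩
  rw [Function.mem_support, bump_rotate, max_eq_right (by linarith)]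
  exact div_ne_zero (by linarith) (pow_ne_zero _ (one_sub_sq_pos hv1).ne')

lemma Setup.exists_lipschitz (h : Setup T V G) (n : ℤ) [FiniteDimensional ℂ (G n)] :
    ∃ C, 0 ≤ C ∧ ∀ r : ℝ, |r| ≤ 1 / 2 → ‖(1 - proj (G n)) * V r * proj (G n)‖ ≤ C * |r| := by
  obtain ⟨ρ, hρ, hρ'⟩ := Metric.eventually_nhds_iff.1
    ((h.tendsto_mp_zero n).eventually (gt_mem_nhds (show (0 : ℝ) < 1 / 4 by norm_num)))
  set ε := min ρ (1 / 2) with hε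
  have hε0 : 0 < ε := by positivity
  have hε1 : ε ≤ 1 / 2 := min_le_right _ _
  set δ := 1 - ε ^ 2 with hδ
  have hδ0 : 0 < δ := by nlinarith
  have hδ1 : δ < 1 := by nlinarith
  set m := ∫ v in Metric.ball (0 : ℂ) 1, bump δ 0 v with hm
  have hm0 : 0 < m := integral_bump_pos hδ0 hδ1
  set b := ∫ v in Metric.ball (0 : ℂ) 1, bump δ 0 v • mp V (proj (G n)) v with hb
  obtain ⟨C, hC0, hC⟩ := h.norm_conj_integral_sub n hδ0
  have hbg : ∀ k, ∀ x ∈ G k, b x ∈ G k := by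
    intro k x hx
    refine h.mem_of_gauge (fun D u hD => ?_) hx
    have h1 := h.conj_integral n hδ0 hD
    rw [← hb] at h1
    calc D * b = D * b * (star D * D) := by rw [(Unitary.mem_iff.1 hD.mem).1, mul_one]
      _ = D * b * star D * D := by simp only [mul_assoc]
      _ = b * D := by rw [h1]
  have hbP := h.grading.commute_proj hbg n
  have hbm : ‖b - (m : ℂ) • proj (G n)‖ ≤ m / 4 := by
    have hi1 := h.integrableOn_mp n hδ0 (w := 0) (by simp)
    have hi2 := integrableOn_bump hδ0 (w := 0) (by simp)
    have e1 : (m : ℂ) • proj (G n) = ∫ v in Metric.ball (0 : ℂ) 1, bump δ 0 v • proj (G n) := by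
      rw [integral_smul_const]; rfl
    rw [e1, hb, ← integral_sub hi1 (hi2.smul_const _)]
    refine (norm_integral_le_of_norm_le (hi2.mul_const (1 / 4)) ?_).trans (le_of_eq ?_)
    · filter_upwards [ae_restrict_mem measurableSet_ball] with v hv
      have hv1 : ‖v‖ < 1 := mem_ball_zero_iff.1 hv
      rw [← smul_sub, norm_smul, Real.norm_of_nonneg (bump_nonneg _ _ _)]
      rcases lt_or_ge ‖v‖ ε with hv2 | hv2
      · have := hρ' (y := v) (by rw [dist_zero_right]; exact hv2.trans_le (min_le_left _ _))
        exact mul_le_mul_of_nonneg_left this.le (bump_nonneg _ _ _)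
      · have : bump δ 0 v = 0 := by
          rw [bump_rotate, max_eq_left (by nlinarith), zero_div]
        rw [this, zero_mul, zero_mul]
    · rw [integral_mul_const]; ring
  refine ⟨2 * C / m, by positivity, fun r hr => ?_⟩
  have hr' : |(-r)| ≤ 1 / 2 := by rwa [abs_neg]
  have h1 := h.off_star n (r := -r) (by linarith)
  rw [neg_neg] at h1
  rw [← h1]
  have hV := (h.impl ((-r : ℝ) : ℂ) (norm_ofReal_lt (by linarith))).mem
  have h2 := davis_kahan hm0 (h.grading.proj_mul_self n) (h.grading.norm_proj_le n)
    (h.grading.norm_one_sub_proj_le n) hbP hbm hV (hC (-r) hr')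
  rw [abs_neg] at h2
  refine h2.trans (le_of_eq ?_)
  ring

end
end TwoShift

namespace TwoShift

open scoped InnerProductSpace ComplexConjugate
open Filter Topology

variable {K : Type*} [NormedAddCommGroup K] [InnerProductSpace ℂ K] [CompleteSpace K]

variable {T : K →L[ℂ] K}

lemma exists_bound_phi (hT : ∀ c : ℂ, ‖c‖ < 1 → IsUnit (1 - conj c • T)) :
    ∃ C, 0 ≤ C ∧ ∀ r : ℝ, |r| ≤ 1 / 2 → ‖phi r T - T‖ ≤ C * |r| := by
  have hc : ContinuousOn (fun r : ℝ => Ring.inverse (1 - conj (r : ℂ) • T))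
      (Set.Icc (-(1 / 2)) (1 / 2)) := by
    intro r hr
    have hr' : |r| < 1 := by rw [abs_lt]; constructor <;> linarith [hr.1, hr.2]
    have h1 := continuousAt_inverse hT (norm_ofReal_lt hr')
    exact (ContinuousAt.comp (f := fun r : ℝ => (r : ℂ)) h1
      Complex.continuous_ofReal.continuousAt).continuousWithinAt
  obtain ⟨C, hC⟩ := isCompact_Icc.exists_bound_of_continuousOn hc
  refine ⟨‖T * T - 1‖ * max C 0, by positivity, fun r hr => ?_⟩
  have h1 := hC r (by rw [Set.mem_Icc]; exact abs_le.1 hr)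
  rw [phi_real_sub hT (norm_ofReal_lt (by linarith)), norm_smul, Complex.norm_real,
    Real.norm_eq_abs, mul_comm]
  gcongr
  exact (norm_mul_le _ _).trans (by gcongr; exact h1.trans (le_max_left _ _))

/-- The orbit map of `a` under conjugation is Lipschitz at the identity. -/
def Lip (V : ℝ → K →L[ℂ] K) (a : K →L[ℂ] K) : Prop :=
  ∃ C, 0 ≤ C ∧ ∀ r : ℝ, |r| ≤ 1 / 2 → ‖V r * a * star (V r) - a‖ ≤ C * |r|

variable {V : ℝ → K →L[ℂ] K}

lemma Ctx.mem (h : Ctx T V) {r : ℝ} (hr : |r| ≤ 1 / 2) : V r ∈ unitary (K →L[ℂ] K) :=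
  (h.impl r (by linarith)).mem

lemma Lip.star_mem {a : K →L[ℂ] K} (ha : Lip V a) : Lip V (star a) := by
  obtain ⟨C, h0, hC⟩ := ha
  refine ⟨C, h0, fun r hr => ?_⟩
  have := hC r hr
  rw [← norm_star] at this
  simpa [mul_assoc] using this

lemma Lip.mul (h : Ctx T V) {a b : K →L[ℂ] K} (ha : Lip V a) (hb : Lip V b) : Lip V (a * b) := by
  obtain ⟨C, h0, hC⟩ := ha
  obtain ⟨C', h0', hC'⟩ := hb
  refine ⟨C * ‖b‖ + ‖a‖ * C', by positivity, fun r hr => ?_⟩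
  have hm := (Unitary.mem_iff.1 (h.mem hr))
  have e : V r * (a * b) * star (V r) - a * b =
      (V r * a * star (V r) - a) * (V r * b * star (V r)) + a * (V r * b * star (V r) - b) := by
    have : (V r * a * star (V r)) * (V r * b * star (V r)) = V r * (a * b) * star (V r) := by
      calc _ = V r * a * (star (V r) * V r) * b * star (V r) := by simp only [mul_assoc]
        _ = _ := by rw [hm.1, mul_one]; simp only [mul_assoc]
    rw [sub_mul, mul_sub, this]; abel
  have h1 := hC r hr
  have h2 := hC' r hr
  rw [e]
  calc _ ≤ ‖V r * a * star (V r) - a‖ * ‖V r * b * star (V r)‖ +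
        ‖a‖ * ‖V r * b * star (V r) - b‖ :=
        (norm_add_le _ _).trans (add_le_add (norm_mul_le _ _) (norm_mul_le _ _))
    _ ≤ (C * |r|) * ‖b‖ + ‖a‖ * (C' * |r|) := by
        rw [norm_mul_star_unitary (h.mem hr)]
        gcongr
    _ = _ := by ring

lemma Lip.add {a b : K →L[ℂ] K} (ha : Lip V a) (hb : Lip V b) : Lip V (a + b) := by
  obtain ⟨C, h0, hC⟩ := ha
  obtain ⟨C', h0', hC'⟩ := hb
  refine ⟨C + C', by positivity, fun r hr => ?_⟩
  have e : V r * (a + b) * star (V r) - (a + b) =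
      (V r * a * star (V r) - a) + (V r * b * star (V r) - b) := by noncomm_ring
  rw [e, add_mul]
  exact (norm_add_le _ _).trans (add_le_add (hC r hr) (hC' r hr))

lemma Lip.smul {a : K →L[ℂ] K} (ha : Lip V a) (c : ℂ) : Lip V (c • a) := by
  obtain ⟨C, h0, hC⟩ := ha
  refine ⟨‖c‖ * C, by positivity, fun r hr => ?_⟩
  rw [mul_smul_comm, smul_mul_assoc, ← smul_sub, norm_smul, mul_assoc ‖c‖]
  exact mul_le_mul_of_nonneg_left (hC r hr) (norm_nonneg c)

lemma Ctx.lip_one (h : Ctx T V) : Lip V 1 := by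
  refine ⟨0, le_rfl, fun r hr => ?_⟩
  rw [mul_one, (Unitary.mem_iff.1 (h.mem hr)).2]
  simp

lemma Ctx.lip_self (h : Ctx T V) : Lip V T := by
  obtain ⟨C, h0, hC⟩ := exists_bound_phi h.unit
  refine ⟨C, h0, fun r hr => ?_⟩
  have h1 := (h.impl r (by linarith)).rel
  rw [h1, one_smul, mul_assoc, (Unitary.mem_iff.1 (h.mem hr)).2, mul_one]
  exact hC r hr

/-- Operators of degree `d` with Lipschitz orbit. -/
structure Hom (V : ℝ → K →L[ℂ] K) (G : ℤ → Submodule ℂ K) (a : K →L[ℂ] K) (d : ℤ) : Prop where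
  deg : ∀ n, ∀ x ∈ G n, a x ∈ G (n + d)
  lip : Lip V a

variable {G : ℤ → Submodule ℂ K}

lemma Hom.star_mem (hG : IsGrading G) {a : K →L[ℂ] K} {d : ℤ} (ha : Hom V G a d) :
    Hom V G (star a) (-d) :=
  ⟨fun n x hx => by simpa [sub_eq_add_neg] using hG.adjoint_mem ha.deg n x hx, ha.lip.star_mem⟩

lemma Hom.mul (h : Ctx T V) {a b : K →L[ℂ] K} {d d' : ℤ} (ha : Hom V G a d) (hb : Hom V G b d') :
    Hom V G (a * b) (d' + d) :=
  ⟨fun n x hx => by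
    have := ha.deg _ _ (hb.deg n x hx)
    rwa [add_assoc] at this, Lip.mul h ha.lip hb.lip⟩

/-- Some degree zero operator with Lipschitz orbit separates a two dimensional piece. -/
lemma Ctx.exists_nonscalar (h : Ctx T V) (hG : IsGrading G)
    (hs : ∀ n, ∀ x ∈ G n, T x ∈ G (n + 1)) {n : ℤ} (h2 : Module.finrank ℂ (G n) = 2) :
    ∃ a, IsSelfAdjoint a ∧ Hom V G a 0 ∧ ¬ ∃ c : ℂ, ∀ x ∈ G n, a x = c • x := by
  by_contra! hcon
  have hT : Hom V G T 1 := ⟨hs, h.lip_self⟩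
  have hcon' : ∀ a, Hom V G a 0 → ∃ c : ℂ, ∀ x ∈ G n, a x = c • x := by
    intro a ha
    have ha' := ha.star_mem hG
    rw [neg_zero] at ha'
    obtain ⟨c1, hc1⟩ := hcon (a + star a) (by simp [IsSelfAdjoint, add_comm])
      ⟨fun n x hx => (G (n + 0)).add_mem (ha.deg n x hx) (ha'.deg n x hx), ha.lip.add ha'.lip⟩
    obtain ⟨c2, hc2⟩ := hcon (Complex.I • (a + (-1 : ℂ) • star a))
      (by simp [IsSelfAdjoint]; abel)
      ⟨fun n x hx => (G (n + 0)).smul_mem _ ((G (n + 0)).add_mem (ha.deg n x hx)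
        ((G (n + 0)).smul_mem _ (ha'.deg n x hx))), (ha.lip.add (ha'.lip.smul _)).smul _⟩
    refine ⟨(c1 - Complex.I * c2) / 2, fun x hx => ?_⟩
    have e1 : a x + star a x = c1 • x := hc1 x hx
    have e2 : Complex.I • (a x + (-1 : ℂ) • star a x) = c2 • x := hc2 x hx
    have e3 : a x + (-1 : ℂ) • star a x = -(Complex.I * c2) • x := by
      have : -(Complex.I * c2) • x = -(Complex.I • (c2 • x)) := by rw [neg_smul, mul_smul]
      rw [this, ← e2, smul_smul, Complex.I_mul_I]
      module
    have e4 : (2 : ℂ) • a x = (c1 - Complex.I * c2) • x := by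
      rw [sub_eq_add_neg, add_smul, ← e1, ← e3]; module
    rw [div_eq_inv_mul, mul_smul, ← e4, smul_smul, inv_mul_cancel₀ two_ne_zero, one_smul]
  have hfd : FiniteDimensional ℂ (G n) := Module.finite_of_finrank_pos (by omega)
  let b := (stdOrthonormalBasis ℂ (G n)).reindex (finCongr h2)
  set x : K := (b 0 : K) with hx
  set y : K := (b 1 : K) with hy
  have hxn : x ∈ G n := (b 0).2
  have hyn : y ∈ G n := (b 1).2
  have hx1 : ‖x‖ = 1 := b.norm_eq_one 0
  have hy1 : ‖y‖ = 1 := b.norm_eq_one 1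
  have hxy : ⟪y, x⟫_ℂ = 0 := b.inner_eq_zero (show (1 : Fin 2) ≠ 0 by decide)
  let S : Submodule ℂ K := Submodule.span ℂ {v | ∃ a d, Hom V G a d ∧ a x = v}
  have hstab : ∀ (t : K →L[ℂ] K) (k : ℤ), Hom V G t k → ∀ v ∈ S.topologicalClosure,
      t v ∈ S.topologicalClosure := by
    intro t k ht v hv
    have h1 : S ≤ S.comap (t : K →ₗ[ℂ] K) := by
      refine Submodule.span_le.2 ?_
      rintro _ ⟨a, d, ha, rfl⟩
      exact Submodule.subset_span ⟨t * a, _, ht.mul h ha, rfl⟩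
    have h3 : Set.MapsTo t S S := fun v hv => h1 hv
    exact map_mem_closure t.continuous hv h3
  have hxS : x ∈ S.topologicalClosure :=
    S.le_topologicalClosure (Submodule.subset_span ⟨1, 0, ⟨fun n x hx => by simpa using hx,
      h.lip_one⟩, rfl⟩)
  have hyS : ∀ v ∈ S.topologicalClosure, ⟪y, v⟫_ℂ = 0 := by
    have h1 : S ≤ (innerSL ℂ y).toLinearMap.ker := by
      refine Submodule.span_le.2 ?_
      rintro _ ⟨a, d, ha, rfl⟩
      change ⟪y, a x⟫_ℂ = 0
      rcases eq_or_ne d 0 with rfl | hd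
      · obtain ⟨c, hc⟩ := hcon' a ha
        rw [hc x hxn, inner_smul_right, hxy, mul_zero]
      · exact hG.orth n (n + d) (by omega) y hyn _ (ha.deg n x hxn)
    intro v hv
    exact Submodule.topologicalClosure_minimal _ h1 (innerSL ℂ y).isClosed_ker hv
  rcases h.irr S.topologicalClosure S.isClosed_topologicalClosure (hstab T 1 hT)
    (hstab _ _ (hT.star_mem hG)) with h3 | h3
  · rw [h3, Submodule.mem_bot] at hxS
    rw [hxS, norm_zero] at hx1
    exact zero_ne_one hx1
  · have := hyS y (h3 ▸ Submodule.mem_top)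
    rw [inner_self_eq_zero] at this
    rw [this, norm_zero] at hy1
    exact zero_ne_one hy1

end TwoShift

namespace TwoShift

open scoped InnerProductSpace ComplexConjugate
open Filter Topology

variable {K : Type*} [NormedAddCommGroup K] [InnerProductSpace ℂ K] [CompleteSpace K]

variable {T : K →L[ℂ] K} {V : ℂ → K →L[ℂ] K} {G : ℤ → Submodule ℂ K}

/-- A self-adjoint operator preserving a two dimensional subspace is diagonalised there. -/
lemma exists_eigenbasis {M : Submodule ℂ K} (h2 : Module.finrank ℂ M = 2) {a : K →L[ℂ] K}
    (ha : IsSelfAdjoint a) (hM : ∀ x ∈ M, a x ∈ M) :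
    ∃ (x y : K) (p q : ℝ), x ∈ M ∧ y ∈ M ∧ ‖x‖ = 1 ∧ ‖y‖ = 1 ∧ ⟪x, y⟫_ℂ = 0 ∧
      a x = (p : ℂ) • x ∧ a y = (q : ℂ) • y ∧ ∀ z ∈ M, z = ⟪x, z⟫_ℂ • x + ⟪y, z⟫_ℂ • y := by
  have hfd : FiniteDimensional ℂ M := Module.finite_of_finrank_pos (by omega)
  let f : M →ₗ[ℂ] M := (a : K →ₗ[ℂ] K).restrict hM
  have hf : f.IsSymmetric := by
    intro x y
    change ⟪a x, (y : K)⟫_ℂ = ⟪(x : K), a y⟫_ℂ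
    rw [← adjoint_inner_right, ← star_eq_adjoint, ha.star_eq]
  let b := hf.eigenvectorBasis h2
  have hb : ∀ i, a (b i : K) = ((hf.eigenvalues h2 i : ℝ) : ℂ) • (b i : K) := fun i =>
    congrArg (Submodule.subtype M) (hf.apply_eigenvectorBasis h2 i)
  refine ⟨b 0, b 1, hf.eigenvalues h2 0, hf.eigenvalues h2 1, (b 0).2, (b 1).2, b.norm_eq_one 0,
    b.norm_eq_one 1, b.inner_eq_zero (by decide), hb 0, hb 1, fun z hz => ?_⟩
  have := congrArg (Submodule.subtype M) (b.sum_repr' ⟨z, hz⟩)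
  rw [Fin.sum_univ_two] at this
  exact this.symm

lemma exists_phase_factor (c : ℂ) : ∃ d : ℂ, ‖d‖ = 1 ∧ d * c = ((‖c‖ : ℝ) : ℂ) := by
  rcases eq_or_ne c 0 with rfl | hc
  · exact ⟨1, by simp, by simp⟩
  · have h0 : ((‖c‖ : ℝ) : ℂ) ≠ 0 := by simpa using hc
    refine ⟨conj c / (‖c‖ : ℝ), ?_, ?_⟩
    · rw [norm_div, Complex.norm_conj, Complex.norm_real, norm_norm, div_self (by simpa using hc)]
    · rw [div_mul_eq_mul_div, div_eq_iff h0, mul_comm, Complex.mul_conj, Complex.normSq_eq_norm_sq]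
      push_cast; ring

lemma Setup.exists_phase [Nontrivial K] [TopologicalSpace.SeparableSpace K] (h : Setup T V G)
    {n : ℤ} (h2 : Module.finrank ℂ (G n) = 2) :
    ∃ (V' : ℝ → K →L[ℂ] K) (v : K), Ctx T V' ∧ v ∈ G n ∧ v ≠ 0 ∧
      ∃ C, 0 ≤ C ∧ ∀ r : ℝ, |r| ≤ 1 / 2 → ‖V' r v - v‖ ≤ C * |r| := by
  have hfd : FiniteDimensional ℂ (G n) := Module.finite_of_finrank_pos (by omega)
  obtain ⟨a, ha, haH, hns⟩ := h.ctx.exists_nonscalar h.grading h.shift h2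
  have haM : ∀ x ∈ G n, a x ∈ G n := fun x hx => by simpa using haH.deg n x hx
  obtain ⟨x, y, p, q, hx, hy, hx1, hy1, hxy, hax, hay, hz⟩ := exists_eigenbasis h2 ha haM
  have hpq : (q : ℂ) - p ≠ 0 := by
    intro hpq
    rw [sub_eq_zero] at hpq
    refine hns ⟨p, fun z hzn => ?_⟩
    rw [hz z hzn, map_add, map_smul, map_smul, hax, hay, hpq]
    module
  obtain ⟨C1, hC1, hC1'⟩ := h.exists_lipschitz n
  obtain ⟨C2, hC2, hC2'⟩ := haH.lip
  -- distance from the orbit of `x` to the line through `x`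
  set C := C1 + (C2 + (‖a‖ + |p|) * C1) / ‖(q : ℂ) - p‖ with hC
  have hC0 : 0 ≤ C := by positivity
  set c : ℝ → ℂ := fun r => ⟪x, V r x⟫_ℂ with hc
  have key : ∀ r : ℝ, |r| ≤ 1 / 2 → ‖V r x - c r • x‖ ≤ C * |r| := by
    intro r hr
    have hr1 : |r| < 1 := by linarith
    set w := V r x with hw
    set P := proj (G n) with hP
    have hPx : P x = x := h.grading.proj_of_mem hx
    have b1 : ‖w - P w‖ ≤ C1 * |r| := by
      have : ((1 - P) * V r * P) x = w - P w := by
        change V r (P x) - P (V r (P x)) = _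
        rw [hPx]
      rw [← this]
      refine (le_opNorm _ _).trans ?_
      rw [hx1, mul_one]
      exact hC1' r hr
    have b2 : ‖a w - (p : ℂ) • w‖ ≤ C2 * |r| := by
      have : (V r * a * star (V r) - a) w = (p : ℂ) • w - a w := by
        change V r (a ((star (V r) * V r) x)) - a w = _
        rw [(Unitary.mem_iff.1 (h.ctx.impl r hr1).mem).1, show (1 : K →L[ℂ] K) x = x from rfl, hax,
          map_smul]
      rw [norm_sub_rev, ← this]
      refine (le_opNorm _ _).trans ?_
      rw [hw, h.ctx.norm_V hr1, hx1, mul_one]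
      exact hC2' r hr
    have hPw := hz (P w) (h.grading.proj_mem n w)
    have e1 : ⟪x, P w⟫_ℂ = c r := by rw [← h.grading.inner_proj, hPx]
    rw [e1] at hPw
    set β := ⟪y, P w⟫_ℂ with hβ
    have e2 : a (P w) - (p : ℂ) • P w = (((q : ℂ) - p) * β) • y := by
      rw [hPw, map_add, map_smul, map_smul, hax, hay]; module
    have e3 : a (P w) - (p : ℂ) • P w =
        (a w - (p : ℂ) • w) - (a (w - P w) - (p : ℂ) • (w - P w)) := by
      rw [map_sub]; module
    have b3 : ‖(q : ℂ) - p‖ * ‖β‖ ≤ (C2 + (‖a‖ + |p|) * C1) * |r| := by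
      have : ‖(((q : ℂ) - p) * β) • y‖ = ‖(q : ℂ) - p‖ * ‖β‖ := by
        rw [norm_smul, norm_mul, hy1, mul_one]
      rw [← this, ← e2, e3]
      calc _ ≤ ‖a w - (p : ℂ) • w‖ + (‖a (w - P w)‖ + ‖(p : ℂ) • (w - P w)‖) :=
            (norm_sub_le _ _).trans (by gcongr; exact norm_sub_le _ _)
        _ ≤ C2 * |r| + (‖a‖ * (C1 * |r|) + |p| * (C1 * |r|)) := by
            rw [norm_smul, Complex.norm_real, Real.norm_eq_abs]
            gcongr
            exact (le_opNorm _ _).trans (by gcongr)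
        _ = _ := by ring
    have hpos : 0 < ‖(q : ℂ) - p‖ := norm_pos_iff.2 hpq
    have b4 : ‖β‖ ≤ (C2 + (‖a‖ + |p|) * C1) / ‖(q : ℂ) - p‖ * |r| := by
      rw [div_mul_eq_mul_div, le_div_iff₀ hpos, mul_comm]
      exact b3
    have e4 : w - c r • x = (w - P w) + β • y := by
      rw [show w - c r • x = (w - P w) + (P w - c r • x) by abel]
      congr 1
      rw [hPw]; abel
    rw [e4, hC, add_mul]
    refine (norm_add_le _ _).trans (add_le_add b1 ?_)
    rwa [norm_smul, hy1, mul_one]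
  choose d hd1 hd2 using fun r => exists_phase_factor (c r)
  refine ⟨fun r => d r • V r, x, ⟨h.irr, h.unit, fun r hr => ?_⟩, hx,
    norm_ne_zero_iff.1 (by rw [hx1]; exact one_ne_zero), 2 * C, by positivity, fun r hr => ?_⟩
  · have hI := h.ctx.impl r hr
    refine ⟨?_, hI.norm_u, hI.norm_z, ?_⟩
    · have hm := Unitary.mem_iff.1 hI.mem
      have h3 := conj_mul_self_of_norm (hd1 r)
      have h3' : d r * conj (d r) = 1 := by rw [mul_comm]; exact h3
      rw [Unitary.mem_iff, star_smul, smul_mul_smul_comm, smul_mul_smul_comm, hm.1, hm.2]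
      constructor
      · change (conj (d r) * d r) • _ = _
        rw [h3, one_smul]
      · change (d r * conj (d r)) • _ = _
        rw [h3', one_smul]
    · rw [smul_mul_assoc, hI.rel, mul_smul_comm]
  · have hr1 : |r| < 1 := by linarith
    have k1 := key r hr
    have k2 : |1 - ‖c r‖| ≤ C * |r| := by
      have := abs_norm_sub_norm_le (V r x) (c r • x)
      rw [h.ctx.norm_V hr1, norm_smul, hx1, mul_one] at this
      exact this.trans k1
    have e1 : (d r • V r) x - x = d r • (V r x - c r • x) + (((‖c r‖ - 1 : ℝ)) : ℂ) • x := by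
      rw [smul_sub, smul_smul, hd2, smul_apply]
      push_cast
      module
    rw [e1]
    refine (norm_add_le _ _).trans ?_
    rw [norm_smul, hd1, one_mul, norm_smul, hx1, mul_one, Complex.norm_real, Real.norm_eq_abs,
      abs_sub_comm]
    linarith

end TwoShift

namespace TwoShift

open scoped InnerProductSpace ComplexConjugate
open Filter Topology

variable {K : Type*} [NormedAddCommGroup K] [InnerProductSpace ℂ K] [CompleteSpace K]

variable {T : K →L[ℂ] K} {V : ℝ → K →L[ℂ] K}

/-- Vectors with Lipschitz orbit at the identity. -/
def lipDom (V : ℝ → K →L[ℂ] K) : Submodule ℂ K where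
  carrier := {v | ∃ C, 0 ≤ C ∧ ∀ r : ℝ, |r| ≤ 1 / 2 → ‖V r v - v‖ ≤ C * |r|}
  zero_mem' := ⟨0, le_rfl, fun r _ => by simp⟩
  add_mem' := by
    rintro v w ⟨C, h0, hC⟩ ⟨C', h0', hC'⟩
    refine ⟨C + C', by positivity, fun r hr => ?_⟩
    rw [map_add, add_sub_add_comm, add_mul]
    exact (norm_add_le _ _).trans (add_le_add (hC r hr) (hC' r hr))
  smul_mem' := by
    rintro c v ⟨C, h0, hC⟩
    refine ⟨‖c‖ * C, by positivity, fun r hr => ?_⟩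
    rw [map_smul, ← smul_sub, norm_smul, mul_assoc]
    exact mul_le_mul_of_nonneg_left (hC r hr) (norm_nonneg c)

/-- The difference quotient of the Möbius transform. -/
def dphi (T : K →L[ℂ] K) (r : ℝ) : K →L[ℂ] K :=
  (T * T - 1) * Ring.inverse (1 - conj (r : ℂ) • T)

lemma Ctx.tendsto_phi (h : Ctx T V) : Tendsto (fun r : ℝ => phi (r : ℂ) T) (𝓝 0) (𝓝 T) := by
  have h1 := continuousAt_phi h.unit (z := ((0 : ℝ) : ℂ)) (by simp)
  have h2 := (ContinuousAt.comp (f := fun r : ℝ => (r : ℂ)) h1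
    Complex.continuous_ofReal.continuousAt).tendsto
  simpa [Function.comp_def, phi_zero] using h2

lemma Ctx.tendsto_dphi (h : Ctx T V) : Tendsto (dphi T) (𝓝 0) (𝓝 (T * T - 1)) := by
  have h1 := continuousAt_inverse h.unit (z := ((0 : ℝ) : ℂ)) (by simp)
  have h2 := (ContinuousAt.comp (f := fun r : ℝ => (r : ℂ)) h1
    Complex.continuous_ofReal.continuousAt).tendsto.const_mul (T * T - 1)
  change Tendsto (fun r : ℝ => (T * T - 1) * Ring.inverse (1 - conj (r : ℂ) • T)) (𝓝 0) _
  simpa [Function.comp_def, dphi] using h2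

lemma Ctx.V_apply_sub (h : Ctx T V) {r : ℝ} (hr : |r| < 1) (v : K) :
    V r (T v) - T v = phi r T (V r v - v) + (r : ℂ) • dphi T r v := by
  have h1 : V r (T v) = phi r T (V r v) := by
    have := DFunLike.congr_fun (h.impl r hr).rel v
    rwa [one_smul] at this
  have h2 := DFunLike.congr_fun (phi_real_sub h.unit (norm_ofReal_lt hr)) v
  have h3 : phi r T v - T v = (r : ℂ) • dphi T r v := h2
  rw [h1, ← h3, map_sub]; abel

lemma Ctx.V_star_apply_sub (h : Ctx T V) {r : ℝ} (hr : |r| < 1) (v : K) :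
    V r (star T v) - star T v =
      star (phi r T) (V r v - v) + (r : ℂ) • star (dphi T r) v := by
  have h1 : V r (star T v) = star (phi r T) (V r v) := by
    have := DFunLike.congr_fun (h.impl r hr).rel_star v
    rwa [one_smul] at this
  have h2 := congrArg star (phi_real_sub h.unit (norm_ofReal_lt hr))
  rw [star_sub, star_smul, show star (r : ℂ) = r from Complex.conj_ofReal r] at h2
  have h3 : star (phi r T) v - star T v = (r : ℂ) • star (dphi T r) v := DFunLike.congr_fun h2 v
  rw [h1, ← h3, map_sub]; abel

lemma Ctx.apply_mem_lipDom (h : Ctx T V) {v : K} (hv : v ∈ lipDom V) :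
    T v ∈ lipDom V ∧ star T v ∈ lipDom V := by
  obtain ⟨C, h0, hC⟩ := hv
  obtain ⟨C', h0', hC'⟩ := exists_bound_phi h.unit
  have hphi : ∀ r : ℝ, |r| ≤ 1 / 2 → ‖phi r T‖ ≤ ‖T‖ + C' := fun r hr => by
    have h1 := hC' r hr
    have h2 := norm_le_insert' (phi r T) T
    nlinarith
  refine ⟨⟨(‖T‖ + C') * C + C' * ‖v‖, by positivity, fun r hr => ?_⟩,
    ⟨(‖T‖ + C') * C + C' * ‖v‖, by positivity, fun r hr => ?_⟩⟩
  · have h2 := DFunLike.congr_fun (phi_real_sub h.unit (norm_ofReal_lt (by linarith : |r| < 1))) v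
    have h3 : phi r T v - T v = (r : ℂ) • dphi T r v := h2
    rw [h.V_apply_sub (by linarith), ← h3]
    calc _ ≤ ‖phi r T‖ * ‖V r v - v‖ + ‖phi r T - T‖ * ‖v‖ :=
          (norm_add_le _ _).trans (add_le_add (le_opNorm _ _) (le_opNorm (phi r T - T) v))
      _ ≤ (‖T‖ + C') * (C * |r|) + (C' * |r|) * ‖v‖ := by
          gcongr
          exacts [hphi r hr, hC r hr, hC' r hr]
      _ = _ := by ring
  · have h2 := congrArg star (phi_real_sub h.unit (norm_ofReal_lt (by linarith : |r| < 1)))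
    rw [star_smul, show star (r : ℂ) = r from Complex.conj_ofReal r] at h2
    have h3 : star (phi r T - T) v = (r : ℂ) • star (dphi T r) v := DFunLike.congr_fun h2 v
    rw [h.V_star_apply_sub (by linarith), ← h3]
    calc _ ≤ ‖star (phi r T)‖ * ‖V r v - v‖ + ‖star (phi r T - T)‖ * ‖v‖ :=
          (norm_add_le _ _).trans (add_le_add (le_opNorm _ _) (le_opNorm _ v))
      _ ≤ (‖T‖ + C') * (C * |r|) + (C' * |r|) * ‖v‖ := by
          rw [norm_star, norm_star]
          gcongr
          exacts [hphi r hr, hC r hr, hC' r hr]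
      _ = _ := by ring

/-- A (weak) infinitesimal generator of the hyperbolic one-parameter family. -/
lemma Ctx.exists_generator (h : Ctx T V) : ∃ X : K →ₗ[ℂ] K,
    (∀ v ∈ lipDom V, X (T v) = T (X v) + T (T v) - v) ∧
    (∀ v ∈ lipDom V, X (star T v) = star T (X v) + star T (star T v) - v) ∧
    ∀ v ∈ lipDom V, ∀ w ∈ lipDom V, ⟪X v, w⟫_ℂ = -⟪v, X w⟫_ℂ := by
  let l : Ultrafilter ℝ := Ultrafilter.of (𝓝[≠] (0 : ℝ))
  have hl' : (l : Filter ℝ) ≤ 𝓝[≠] 0 := Ultrafilter.of_le _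
  have hl : (l : Filter ℝ) ≤ 𝓝 0 := hl'.trans nhdsWithin_le_nhds
  have hl0 : ∀ᶠ r in (l : Filter ℝ), r ≠ 0 := hl' self_mem_nhdsWithin
  have hl1 : ∀ᶠ r in (l : Filter ℝ), |r| < 1 / 2 := eventually_abs_lt hl (by norm_num)
  let q : ℝ → K → K := fun r v => (r : ℂ)⁻¹ • (V r v - v)
  have hq : ∀ v ∈ lipDom V, ∃ C, ∀ᶠ r in (l : Filter ℝ), ‖q r v‖ ≤ C := by
    rintro v ⟨C, h0, hC⟩
    refine ⟨C, ?_⟩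
    filter_upwards [hl0, hl1] with r hr hr1
    have : 0 < |r| := abs_pos.2 hr
    simp only [q]
    rw [norm_smul, norm_inv, Complex.norm_real, Real.norm_eq_abs, inv_mul_le_iff₀ this, mul_comm]
    exact hC r hr1.le
  have hex : ∀ v : lipDom V, ∃ ξ : K, ∀ y, Tendsto (fun r => ⟪y, q r v⟫_ℂ) l (𝓝 ⟪y, ξ⟫_ℂ) := by
    intro v
    obtain ⟨C, hC⟩ := hq v v.2
    obtain ⟨ξ, -, hξ⟩ := exists_weak_limit l (fun r => q r v) hC
    exact ⟨ξ, hξ⟩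
  choose ξ hξ using hex
  let X₀ : lipDom V →ₗ[ℂ] K :=
    { toFun := ξ
      map_add' := fun x x' => by
        refine ext_inner_left ℂ fun y => ?_
        refine tendsto_nhds_unique (hξ (x + x') y) ?_
        have e : ∀ r, q r ((x + x' : lipDom V) : K) = q r x + q r x' := fun r => by
          simp only [q, Submodule.coe_add, map_add]; module
        simp only [e, inner_add_right]
        exact (hξ x y).add (hξ x' y)
      map_smul' := fun c x => by
        refine ext_inner_left ℂ fun y => ?_
        refine tendsto_nhds_unique (hξ (c • x) y) ?_
        have e : ∀ r, q r ((c • x : lipDom V) : K) = c • q r x := fun r => by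
          simp only [q, Submodule.coe_smul, map_smul]; module
        simp only [e, inner_smul_right, RingHom.id_apply]
        exact (hξ x y).const_mul c }
  obtain ⟨X, hX⟩ := X₀.exists_extend
  have hX' : ∀ v (hv : v ∈ lipDom V), X v = ξ ⟨v, hv⟩ := fun v hv =>
    DFunLike.congr_fun hX ⟨v, hv⟩
  have hlim : ∀ v ∈ lipDom V, ∀ y, Tendsto (fun r => ⟪y, q r v⟫_ℂ) l (𝓝 ⟪y, X v⟫_ℂ) :=
    fun v hv y => by rw [hX' v hv]; exact hξ ⟨v, hv⟩ y
  refine ⟨X, fun v hv => ?_, fun v hv => ?_, fun v hv w hw => ?_⟩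
  · obtain ⟨C, hC⟩ := hq v hv
    refine ext_inner_left ℂ fun y => ?_
    refine tendsto_nhds_unique (hlim _ (h.apply_mem_lipDom hv).1 y) ?_
    have t1 := weak_op_tendsto hC (hlim v hv) (h.tendsto_phi.mono_left hl) y
    have t2 : Tendsto (fun r => ⟪y, dphi T r v⟫_ℂ) l (𝓝 ⟪y, (T * T - 1) v⟫_ℂ) :=
      weak_op_tendsto (ξ := v) (Eventually.of_forall fun _ => le_rfl)
        (fun y => tendsto_const_nhds) (h.tendsto_dphi.mono_left hl) y
    have t3 := t1.add t2
    rw [← inner_add_right, show (T * T - 1) v = T (T v) - v from rfl, ← add_sub_assoc] at t3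
    refine t3.congr' ?_
    filter_upwards [hl0, hl1] with r hr hr1
    have hr0 : (r : ℂ) ≠ 0 := by exact_mod_cast hr
    rw [← inner_add_right]
    congr 1
    simp only [q]
    rw [h.V_apply_sub (by linarith), smul_add, smul_smul, inv_mul_cancel₀ hr0, one_smul, map_smul]
  · obtain ⟨C, hC⟩ := hq v hv
    refine ext_inner_left ℂ fun y => ?_
    refine tendsto_nhds_unique (hlim _ (h.apply_mem_lipDom hv).2 y) ?_
    have t1 := weak_op_tendsto hC (hlim v hv)
      ((continuous_star.tendsto _).comp (h.tendsto_phi.mono_left hl)) y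
    have t2 : Tendsto (fun r => ⟪y, star (dphi T r) v⟫_ℂ) l (𝓝 ⟪y, star (T * T - 1) v⟫_ℂ) :=
      weak_op_tendsto (ξ := v) (Eventually.of_forall fun _ => le_rfl)
        (fun y => tendsto_const_nhds)
        ((continuous_star.tendsto _).comp (h.tendsto_dphi.mono_left hl)) y
    have t3 := t1.add t2
    rw [← inner_add_right, star_sub, star_mul, star_one,
      show (star T * star T - 1) v = star T (star T v) - v from rfl, ← add_sub_assoc] at t3
    refine t3.congr' ?_
    filter_upwards [hl0, hl1] with r hr hr1
    have hr0 : (r : ℂ) ≠ 0 := by exact_mod_cast hr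
    rw [← inner_add_right]
    congr 1
    simp only [q, Function.comp_apply]
    rw [h.V_star_apply_sub (by linarith), smul_add, smul_smul, inv_mul_cancel₀ hr0, one_smul,
      map_smul]
  · have t1 : Tendsto (fun r => ⟪q r v, w⟫_ℂ) l (𝓝 ⟪X v, w⟫_ℂ) := by
      have := (Complex.continuous_conj.tendsto _).comp (hlim v hv w)
      simpa [Function.comp_def, inner_conj_symm] using this
    have t2 := hlim w hw v
    obtain ⟨C, hC0, hC⟩ := hv
    obtain ⟨C', hC0', hC'⟩ := hw
    have t3 : Tendsto (fun r => ⟪q r v, w⟫_ℂ + ⟪v, q r w⟫_ℂ) l (𝓝 0) := by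
      refine squeeze_zero_norm' (a := fun r => C * C' * |r|) ?_ ?_
      · filter_upwards [hl0, hl1] with r hr hr1
        have hr0 : (r : ℂ) ≠ 0 := by exact_mod_cast hr
        have hV : ⟪V r v, V r w⟫_ℂ = ⟪v, w⟫_ℂ := by
          rw [← adjoint_inner_right, ← star_eq_adjoint]
          change ⟪v, (star (V r) * V r) w⟫_ℂ = _
          rw [(Unitary.mem_iff.1 (h.mem hr1.le)).1]; rfl
        have e : ⟪q r v, w⟫_ℂ + ⟪v, q r w⟫_ℂ = -((r : ℂ)⁻¹ * ⟪V r v - v, V r w - w⟫_ℂ) := by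
          simp only [q, inner_smul_left, inner_smul_right, inner_sub_left, inner_sub_right,
            hV, map_inv₀, Complex.conj_ofReal]
          ring
        rw [e, norm_neg, norm_mul, norm_inv, Complex.norm_real, Real.norm_eq_abs,
          inv_mul_le_iff₀ (abs_pos.2 hr)]
        calc _ ≤ ‖V r v - v‖ * ‖V r w - w‖ := norm_inner_le_norm _ _
          _ ≤ (C * |r|) * (C' * |r|) := by
              gcongr
              exacts [hC r hr1.le, hC' r hr1.le]
          _ = _ := by ring
      · have : Tendsto (fun r : ℝ => C * C' * |r|) (𝓝 0) (𝓝 (C * C' * |0|)) :=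
          (continuous_const.mul continuous_abs).tendsto 0
        rw [abs_zero, mul_zero] at this
        exact this.mono_left hl
    have := tendsto_nhds_unique (t1.add t2) t3
    exact eq_neg_of_add_eq_zero_left this

end TwoShift

namespace TwoShift

open scoped InnerProductSpace ComplexConjugate
open Filter Topology

variable {K : Type*} [NormedAddCommGroup K] [InnerProductSpace ℂ K] [CompleteSpace K]

variable {T : K →L[ℂ] K} {G : ℤ → Submodule ℂ K}

/-- A family of linear maps, one for each degree, glues to a single linear map. -/
lemma IsGrading.exists_linear (hG : IsGrading G) (L : ℤ → K →ₗ[ℂ] K) :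
    ∃ L₀ : K →ₗ[ℂ] K, ∀ n, ∀ x ∈ G n, L₀ x = L n x := by
  have hO : OrthogonalFamily ℂ (fun n => G n) fun n => (G n).subtypeₗᵢ := by
    intro m n hmn x y
    exact hG.orth m n hmn x x.2 y y.2
  have hinj := hO.independent.dfinsupp_lsum_injective
  obtain ⟨R, hR⟩ := LinearMap.exists_leftInverse_of_injective
    (DFinsupp.lsum ℕ (fun n => (G n).subtype) : (Π₀ n, G n) →ₗ[ℂ] K)
    (LinearMap.ker_eq_bot.2 hinj)
  refine ⟨(DFinsupp.lsum ℕ (fun n => L n ∘ₗ (G n).subtype) : (Π₀ n, G n) →ₗ[ℂ] K) ∘ₗ R,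
    fun n x hx => ?_⟩
  have h1 := LinearMap.congr_fun hR (DFinsupp.single n ⟨x, hx⟩)
  simp only [LinearMap.comp_apply, DFinsupp.lsum_single, Submodule.subtype_apply,
    LinearMap.id_apply] at h1
  rw [LinearMap.comp_apply, h1, DFinsupp.lsum_single]
  rfl

/-- A graded family of spaces carrying compatible raising and lowering operators. -/
structure Rep (T : K →L[ℂ] K) (D : ℤ → Submodule ℂ K) (E F : K →ₗ[ℂ] K) (κ : ℝ) : Prop where
  T_mem : ∀ n, ∀ x ∈ D n, T x ∈ D (n + 1)
  S_mem : ∀ n, ∀ x ∈ D n, star T x ∈ D (n - 1)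
  E_mem : ∀ n, ∀ x ∈ D n, E x ∈ D (n + 1)
  F_mem : ∀ n, ∀ x ∈ D n, F x ∈ D (n - 1)
  FT : ∀ n, ∀ x ∈ D n, F (T x) = T (F x) - x
  FS : ∀ n, ∀ x ∈ D n, F (star T x) = star T (F x) + star T (star T x)
  ET : ∀ n, ∀ x ∈ D n, E (T x) = T (E x) + T (T x)
  ES : ∀ n, ∀ x ∈ D n, E (star T x) = star T (E x) - x
  inner_E : ∀ n, ∀ x ∈ D n, ∀ y ∈ D (n + 1), ⟪E x, y⟫_ℂ = -⟪x, F y⟫_ℂ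
  comm : ∀ n, ∀ x ∈ D n, E (F x) - F (E x) = (2 * n + κ : ℂ) • x

lemma Rep.dual {D : ℤ → Submodule ℂ K} {E F : K →ₗ[ℂ] K} {κ : ℝ} (h : Rep T D E F κ) :
    Rep (star T) (fun n => D (-n)) F E (-κ) where
  T_mem n x hx := by have := h.S_mem _ x hx; rwa [show -(n + 1) = -n - 1 by ring]
  S_mem n x hx := by
    have := h.T_mem _ x hx; rwa [star_star, show -(n - 1) = -n + 1 by ring]
  E_mem n x hx := by have := h.F_mem _ x hx; rwa [show -(n + 1) = -n - 1 by ring]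
  F_mem n x hx := by have := h.E_mem _ x hx; rwa [show -(n - 1) = -n + 1 by ring]
  FT n x hx := h.ES _ x hx
  FS n x hx := by rw [star_star]; exact h.ET _ x hx
  ET n x hx := h.FS _ x hx
  ES n x hx := by rw [star_star]; exact h.FT _ x hx
  inner_E n x hx y hy := by
    have h1 := h.inner_E (-(n + 1)) y hy x (by rwa [show -(n + 1) + 1 = -n by ring])
    have h2 := congrArg conj h1
    rw [map_neg, inner_conj_symm, inner_conj_symm] at h2
    rw [h2, neg_neg]
  comm n x hx := by
    have := h.comm _ x hx
    rw [← neg_sub, this, ← neg_smul]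
    congr 1
    push_cast
    ring

/-- The graded pieces generated from a vector by `T` and its adjoint. -/
inductive Gen (T : K →L[ℂ] K) (v : K) (m : ℤ) : ℤ → K → Prop
  | base : Gen T v m m v
  | zero (n : ℤ) : Gen T v m n 0
  | add {n : ℤ} {x y : K} : Gen T v m n x → Gen T v m n y → Gen T v m n (x + y)
  | smul {n : ℤ} {x : K} (c : ℂ) : Gen T v m n x → Gen T v m n (c • x)
  | up {n : ℤ} {x : K} : Gen T v m n x → Gen T v m (n + 1) (T x)
  | down {n : ℤ} {x : K} : Gen T v m n x → Gen T v m (n - 1) (star T x)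

/-- The submodule given by `Gen`. -/
def genMod (T : K →L[ℂ] K) (v : K) (m n : ℤ) : Submodule ℂ K where
  carrier := {x | Gen T v m n x}
  zero_mem' := Gen.zero n
  add_mem' := Gen.add
  smul_mem' c _ hx := Gen.smul c hx

lemma star_mem_grading (hG : IsGrading G) (hT : ∀ n, ∀ x ∈ G n, T x ∈ G (n + 1)) (n : ℤ)
    (x : K) (hx : x ∈ G n) : star T x ∈ G (n - 1) := hG.adjoint_mem hT n x hx

lemma genMod_le (hG : IsGrading G) (hT : ∀ n, ∀ x ∈ G n, T x ∈ G (n + 1)) {v : K} {m : ℤ}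
    (hv : v ∈ G m) (n : ℤ) : genMod T v m n ≤ G n := by
  intro x hx
  change Gen T v m n x at hx
  induction hx with
  | base => exact hv
  | zero n => exact zero_mem _
  | add _ _ h1 h2 => exact add_mem h1 h2
  | smul c _ h1 => exact Submodule.smul_mem _ c h1
  | up _ h1 => exact hT _ _ h1
  | down _ h1 => exact star_mem_grading hG hT _ _ h1

lemma iSup_genMod_eq_top (hirr : IrreducibleOp T) {v : K} (hv0 : v ≠ 0) (m : ℤ) :
    (⨆ n, genMod T v m n).topologicalClosure = ⊤ := by
  set M := ⨆ n, genMod T v m n with hM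
  have key : ∀ a : K →L[ℂ] K, (∀ n, ∀ x ∈ genMod T v m n, a x ∈ M) →
      ∀ x ∈ M.topologicalClosure, a x ∈ M.topologicalClosure := by
    intro a ha x hx
    have h1 : M ≤ M.comap (a : K →ₗ[ℂ] K) := iSup_le fun n x hx => ha n x hx
    have h2 : Set.MapsTo a (M : Set K) (M : Set K) := fun x hx => h1 hx
    exact h2.closure a.continuous hx
  rcases hirr M.topologicalClosure M.isClosed_topologicalClosure
    (key T fun n x hx => Submodule.mem_iSup_of_mem (n + 1) (Gen.up hx))
    (by
      rw [← star_eq_adjoint]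
      exact key (star T) fun n x hx => Submodule.mem_iSup_of_mem (n - 1) (Gen.down hx)) with h | h
  · exfalso
    have : v ∈ M.topologicalClosure :=
      M.le_topologicalClosure (Submodule.mem_iSup_of_mem m Gen.base)
    rw [h] at this
    exact hv0 this
  · exact h

lemma eq_zero_of_orth_genMod (hirr : IrreducibleOp T) (hG : IsGrading G)
    (hT : ∀ n, ∀ x ∈ G n, T x ∈ G (n + 1)) {v : K} {m : ℤ} (hv : v ∈ G m) (hv0 : v ≠ 0)
    {n : ℤ} {x : K} (hx : x ∈ G n) (h : ∀ y ∈ genMod T v m n, ⟪y, x⟫_ℂ = 0) : x = 0 := by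
  have h1 : (⨆ n, genMod T v m n) ≤ LinearMap.ker (innerSL ℂ x : K →ₗ[ℂ] ℂ) := by
    refine iSup_le fun k y hy => ?_
    change ⟪x, y⟫_ℂ = 0
    rcases eq_or_ne n k with rfl | hk
    · rw [← inner_conj_symm, h y hy, map_zero]
    · exact hG.orth n k hk x hx y (genMod_le hG hT hv k hy)
  have h2 := Submodule.topologicalClosure_minimal _ h1 (innerSL ℂ x).isClosed_ker
  rw [iSup_genMod_eq_top hirr hv0 m] at h2
  have h3 : ⟪x, x⟫_ℂ = 0 := h2 (Submodule.mem_top (x := x))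
  simpa using h3

lemma eq_of_dense {D M : Submodule ℂ K} [FiniteDimensional ℂ D] (hle : D ≤ M)
    (h : ∀ x ∈ M, (∀ y ∈ D, ⟪y, x⟫_ℂ = 0) → x = 0) : D = M := by
  refine le_antisymm hle fun x hx => ?_
  have h1 : x - D.starProjection x = 0 :=
    h _ (M.sub_mem hx (hle (Submodule.starProjection_apply_mem _ _)))
      fun y hy => (Submodule.sub_starProjection_mem_orthogonal (K := D) x) y hy
  rw [sub_eq_zero.1 h1]
  exact Submodule.starProjection_apply_mem _ _

lemma genMod_eq (hirr : IrreducibleOp T) (hG : IsGrading G)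
    (hT : ∀ n, ∀ x ∈ G n, T x ∈ G (n + 1)) {v : K} {m : ℤ} (hv : v ∈ G m) (hv0 : v ≠ 0)
    (n : ℤ) [FiniteDimensional ℂ (genMod T v m n)] : genMod T v m n = G n :=
  eq_of_dense (genMod_le hG hT hv n) fun _ hx h => eq_zero_of_orth_genMod hirr hG hT hv hv0 hx h

lemma Ctx.gen_le_lipDom {V : ℝ → K →L[ℂ] K} (h : Ctx T V) {v : K} (hv : v ∈ lipDom V) (m n : ℤ) :
    genMod T v m n ≤ lipDom V := by
  intro x hx
  change Gen T v m n x at hx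
  induction hx with
  | base => exact hv
  | zero n => exact zero_mem _
  | add _ _ h1 h2 => exact add_mem h1 h2
  | smul c _ h1 => exact Submodule.smul_mem _ c h1
  | up _ h1 => exact (h.apply_mem_lipDom h1).1
  | down _ h1 => exact (h.apply_mem_lipDom h1).2

lemma IsGrading.proj_apply_shift (hG : IsGrading G) {a : K →L[ℂ] K} {d : ℤ}
    (ha : ∀ n, ∀ x ∈ G n, a x ∈ G (n + d)) (n : ℤ) (x : K) :
    proj (G (n + d)) (a x) = a (proj (G n) x) := by
  have : proj (G (n + d)) * a = a * proj (G n) := by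
    refine hG.op_ext fun k y hy => ?_
    change proj (G (n + d)) (a y) = a (proj (G n) y)
    rcases eq_or_ne n k with rfl | hk
    · rw [hG.proj_of_mem hy, hG.proj_of_mem (ha _ _ hy)]
    · rw [hG.proj_of_mem_ne hk hy, map_zero,
        hG.proj_of_mem_ne (by omega : n + d ≠ k + d) (ha _ _ hy)]
  exact DFunLike.congr_fun this x

/-- Existence of the representation on the algebraic domain. -/
lemma Ctx.exists_rep {V : ℝ → K →L[ℂ] K} (h : Ctx T V) (hG : IsGrading G)
    (hT : ∀ n, ∀ x ∈ G n, T x ∈ G (n + 1)) {v : K} {m : ℤ} (hv : v ∈ G m) (hv0 : v ≠ 0)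
    (hl : v ∈ lipDom V) [FiniteDimensional ℂ (G m)] [FiniteDimensional ℂ (G (m - 1))]
    [FiniteDimensional ℂ (G (m + 1))] :
    ∃ E F : K →ₗ[ℂ] K, ∃ κ : ℝ, Rep T (genMod T v m) E F κ := by
  obtain ⟨X, hX1, hX2, hX3⟩ := h.exists_generator
  obtain ⟨E, hE⟩ := hG.exists_linear fun n => (proj (G (n + 1)) : K →ₗ[ℂ] K) ∘ₗ X
  obtain ⟨F, hF⟩ := hG.exists_linear fun n => (proj (G (n - 1)) : K →ₗ[ℂ] K) ∘ₗ X
  replace hE : ∀ n, ∀ x ∈ G n, E x = proj (G (n + 1)) (X x) := hE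
  replace hF : ∀ n, ∀ x ∈ G n, F x = proj (G (n - 1)) (X x) := hF
  have hS := star_mem_grading hG hT
  have hS' : ∀ n, ∀ x ∈ G n, star T x ∈ G (n + (-1)) := hS
  set D := genMod T v m with hD
  have hDG : ∀ n, D n ≤ G n := genMod_le hG hT hv
  have hDl : ∀ n, D n ≤ lipDom V := h.gen_le_lipDom hl m
  have fin : ∀ n, FiniteDimensional ℂ (G n) → D n = G n := fun n hn => by
    have : FiniteDimensional ℂ (D n) := Submodule.finiteDimensional_of_le (hDG n)
    exact genMod_eq h.irr hG hT hv hv0 n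
  have FT : ∀ n, ∀ x ∈ D n, F (T x) = T (F x) - x := fun n x hx => by
    have hx' := hDG n hx
    rw [hF _ _ (hT _ _ hx'), hF _ _ hx', hX1 x (hDl n hx), map_sub, map_add,
      ← hG.proj_apply_shift hT, sub_add_cancel, add_sub_cancel_right,
      hG.proj_of_mem hx', hG.proj_of_mem_ne (by omega) (hT _ _ (hT _ _ hx')), add_zero]
  have FS : ∀ n, ∀ x ∈ D n, F (star T x) = star T (F x) + star T (star T x) := fun n x hx => by
    have hx' := hDG n hx
    rw [hF _ _ (hS _ _ hx'), hF _ _ hx', hX2 x (hDl n hx), map_sub, map_add,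
      ← hG.proj_apply_shift hS', hG.proj_of_mem (hS _ _ (hS _ _ hx')),
      hG.proj_of_mem_ne (by omega) hx', sub_zero]
    rfl
  have ET : ∀ n, ∀ x ∈ D n, E (T x) = T (E x) + T (T x) := fun n x hx => by
    have hx' := hDG n hx
    rw [hE _ _ (hT _ _ hx'), hE _ _ hx', hX1 x (hDl n hx), map_sub, map_add,
      ← hG.proj_apply_shift hT, hG.proj_of_mem (hT _ _ (hT _ _ hx')),
      hG.proj_of_mem_ne (by omega) hx', sub_zero]
  have ES : ∀ n, ∀ x ∈ D n, E (star T x) = star T (E x) - x := fun n x hx => by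
    have hx' := hDG n hx
    rw [hE _ _ (hS _ _ hx'), hE _ _ hx', hX2 x (hDl n hx), map_sub, map_add,
      ← hG.proj_apply_shift hS', add_neg_cancel_right, sub_add_cancel,
      hG.proj_of_mem hx', hG.proj_of_mem_ne (by omega) (hS _ _ (hS _ _ hx')), add_zero]
  have inner_E : ∀ n, ∀ x ∈ D n, ∀ y ∈ D (n + 1), ⟪E x, y⟫_ℂ = -⟪x, F y⟫_ℂ :=
    fun n x hx y hy => by
      rw [hE _ _ (hDG n hx), hF _ _ (hDG _ hy), hG.inner_proj, hG.proj_of_mem (hDG _ hy),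
        hX3 x (hDl n hx) y (hDl _ hy), add_sub_cancel_right, ← hG.inner_proj,
        hG.proj_of_mem (hDG n hx)]
  have hDT : ∀ n, ∀ x ∈ D n, T x ∈ D (n + 1) := fun n x hx => Gen.up hx
  have hDS : ∀ n, ∀ x ∈ D n, star T x ∈ D (n - 1) := fun n x hx => Gen.down hx
  have E_mem : ∀ n, ∀ x ∈ D n, E x ∈ D (n + 1) := by
    intro n x hx
    change Gen T v m n x at hx
    induction hx with
    | base => rw [fin _ inferInstance, hE _ _ hv]; exact hG.proj_mem _ _
    | zero n => rw [map_zero]; exact zero_mem _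
    | add _ _ h1 h2 => rw [map_add]; exact add_mem h1 h2
    | smul c _ h1 => rw [map_smul]; exact Submodule.smul_mem _ c h1
    | up hx h1 => rw [ET _ _ hx]; exact add_mem (hDT _ _ h1) (hDT _ _ (hDT _ _ hx))
    | down hx h1 =>
      rw [ES _ _ hx, sub_add_cancel]
      exact sub_mem (by simpa using hDS _ _ h1) hx
  have F_mem : ∀ n, ∀ x ∈ D n, F x ∈ D (n - 1) := by
    intro n x hx
    change Gen T v m n x at hx
    induction hx with
    | base => rw [fin _ inferInstance, hF _ _ hv]; exact hG.proj_mem _ _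
    | zero n => rw [map_zero]; exact zero_mem _
    | add _ _ h1 h2 => rw [map_add]; exact add_mem h1 h2
    | smul c _ h1 => rw [map_smul]; exact Submodule.smul_mem _ c h1
    | up hx h1 =>
      rw [FT _ _ hx, add_sub_cancel_right]
      exact sub_mem (by simpa using hDT _ _ h1) hx
    | down hx h1 => rw [FS _ _ hx]; exact add_mem (hDS _ _ h1) (hDS _ _ (hDS _ _ hx))
  have up : ∀ (κ : ℂ) n, ∀ x ∈ D n, E (F x) - F (E x) = (2 * n + κ) • x →
      E (F (T x)) - F (E (T x)) = (2 * (n + 1 : ℤ) + κ) • T x := by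
    intro κ n x hx hc
    have hc' := congrArg T hc
    rw [map_sub, map_smul] at hc'
    rw [FT _ _ hx, ET _ _ hx, map_sub, ET _ _ (F_mem _ _ hx), map_add, FT _ _ (E_mem _ _ hx),
      FT _ _ (hDT _ _ hx), FT _ _ hx, map_sub]
    push_cast
    linear_combination (norm := module) hc'
  have down : ∀ (κ : ℂ) n, ∀ x ∈ D n, E (F x) - F (E x) = (2 * n + κ) • x →
      E (F (star T x)) - F (E (star T x)) = (2 * (n - 1 : ℤ) + κ) • star T x := by
    intro κ n x hx hc
    have hc' := DFunLike.congr_arg (star T) hc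
    rw [map_sub, map_smul] at hc'
    rw [FS _ _ hx, ES _ _ hx, map_sub, map_add, FS _ _ (E_mem _ _ hx), ES _ _ (F_mem _ _ hx),
      ES _ _ (hDS _ _ hx), ES _ _ hx, map_sub]
    push_cast
    linear_combination (norm := module) hc'
  have hDm : D m = G m := fin m inferInstance
  let Z : Module.End ℂ K := E ∘ₗ F - F ∘ₗ E - (2 * m : ℂ) • LinearMap.id
  have hZ : ∀ x ∈ G m, Z x ∈ G m := by
    intro x hx
    rw [← hDm] at hx ⊢
    refine sub_mem (sub_mem ?_ ?_) (Submodule.smul_mem _ _ hx)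
    · simpa using E_mem _ _ (F_mem _ _ hx)
    · simpa using F_mem _ _ (E_mem _ _ hx)
  have : Nontrivial (G m) := ⟨⟨⟨v, hv⟩, 0, fun h => hv0 (congrArg Subtype.val h)⟩⟩
  obtain ⟨κ, hκ⟩ := Module.End.exists_eigenvalue (Z.restrict hZ)
  obtain ⟨y, hy⟩ := hκ.exists_hasEigenvector
  have hy0 : (y : K) ≠ 0 := fun h => hy.2 (Subtype.ext h)
  have hyZ : E (F y) - F (E y) = (2 * m + κ) • (y : K) := by
    have h1 : Z (y : K) = κ • (y : K) := congrArg Subtype.val hy.apply_eq_smul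
    have h2 : Z (y : K) = E (F y) - F (E y) - (2 * m : ℂ) • (y : K) := rfl
    rw [h2, sub_eq_iff_eq_add] at h1
    rw [h1, add_comm, add_smul]
  have hyD : (y : K) ∈ D m := by rw [hDm]; exact y.2
  have hGy : ∀ n x, Gen T (y : K) m n x → x ∈ D n ∧ E (F x) - F (E x) = (2 * n + κ) • x := by
    intro n x hx
    induction hx with
    | base => exact ⟨hyD, hyZ⟩
    | zero n => exact ⟨zero_mem _, by simp⟩
    | add _ _ h1 h2 =>
      refine ⟨add_mem h1.1 h2.1, ?_⟩
      rw [map_add, map_add, map_add, map_add, add_sub_add_comm, h1.2, h2.2, smul_add]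
    | smul c _ h1 =>
      refine ⟨Submodule.smul_mem _ c h1.1, ?_⟩
      rw [map_smul, map_smul, map_smul, map_smul, ← smul_sub, h1.2, smul_comm]
    | up _ h1 => exact ⟨hDT _ _ h1.1, up _ _ _ h1.1 h1.2⟩
    | down _ h1 => exact ⟨hDS _ _ h1.1, down _ _ _ h1.1 h1.2⟩
  have hvy : Gen T (y : K) m m v := by
    have : FiniteDimensional ℂ (genMod T (y : K) m m) :=
      Submodule.finiteDimensional_of_le (genMod_le hG hT y.2 m)
    have h1 := genMod_eq h.irr hG hT y.2 hy0 m
    rw [← h1] at hv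
    exact hv
  have comm : ∀ n, ∀ x ∈ D n, E (F x) - F (E x) = (2 * n + κ) • x := by
    intro n x hx
    refine (hGy n x ?_).2
    change Gen T v m n x at hx
    induction hx with
    | base => exact hvy
    | zero n => exact Gen.zero n
    | add _ _ h1 h2 => exact Gen.add h1 h2
    | smul c _ h1 => exact Gen.smul c h1
    | up _ h1 => exact Gen.up h1
    | down _ h1 => exact Gen.down h1
  have hvD : v ∈ D m := Gen.base
  have hκr : (κ.re : ℂ) = κ := by
    have h1 := inner_E (m - 1) (F v) (F_mem _ _ hvD) v (by simpa using hvD)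
    have h2 := congrArg conj (inner_E m v hvD (E v) (E_mem _ _ hvD))
    rw [map_neg, inner_conj_symm, inner_conj_symm] at h2
    have h3 := congrArg (fun z => ⟪z, v⟫_ℂ) (comm m v hvD)
    simp only [inner_sub_left, inner_smul_left] at h3
    have h4 := congrArg Complex.im h3
    rw [h1, ← neg_eq_iff_eq_neg.2 h2, inner_self_eq_norm_sq_to_K, inner_self_eq_norm_sq_to_K,
      inner_self_eq_norm_sq_to_K] at h4
    norm_cast at h4
    have hv1 : ‖v‖ ^ 2 ≠ 0 := by simpa using hv0
    have h5 : κ.im = 0 := by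
      simpa [← Complex.ofReal_pow, Complex.mul_im, hv0] using h4
    exact Complex.ext rfl (by simp [h5])
  rw [← hκr] at comm
  exact ⟨E, F, κ.re, hDT, hDS, E_mem, F_mem, FT, FS, ET, ES, inner_E, comm⟩

end TwoShift

namespace TwoShift

open scoped InnerProductSpace ComplexConjugate
open Filter Topology

variable {K : Type*} [NormedAddCommGroup K] [InnerProductSpace ℂ K] [CompleteSpace K]

variable {T : K →L[ℂ] K} {D G : ℤ → Submodule ℂ K} {E F : K →ₗ[ℂ] K} {κ : ℝ}

lemma Rep.norm_sq_sub (h : Rep T D E F κ) {m : ℤ} {x : K} (hx : x ∈ D m) :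
    ‖E x‖ ^ 2 - ‖F x‖ ^ 2 = (2 * m + κ) * ‖x‖ ^ 2 := by
  have h1 := h.inner_E (m - 1) (F x) (h.F_mem _ _ hx) x (by simpa using hx)
  have h2 := congrArg conj (h.inner_E m x hx (E x) (h.E_mem _ _ hx))
  rw [map_neg, inner_conj_symm, inner_conj_symm] at h2
  have h3 := congrArg (fun z => ⟪z, x⟫_ℂ) (h.comm m x hx)
  simp only [inner_sub_left, inner_smul_left] at h3
  rw [h1, ← neg_eq_iff_eq_neg.2 h2, inner_self_eq_norm_sq_to_K, inner_self_eq_norm_sq_to_K,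
    inner_self_eq_norm_sq_to_K] at h3
  simp only [map_add, map_mul, Complex.conj_ofReal, map_intCast, map_ofNat] at h3
  have h4 : ((‖E x‖ ^ 2 - ‖F x‖ ^ 2 : ℝ) : ℂ) = (((2 * m + κ) * ‖x‖ ^ 2 : ℝ) : ℂ) := by
    have h5 : -(‖F x‖ : ℂ) ^ 2 - -(‖E x‖ : ℂ) ^ 2 = (2 * m + κ) * (‖x‖ : ℂ) ^ 2 := h3
    push_cast
    linear_combination h5
  exact_mod_cast h4

lemma Rep.eq_zero_of_both (h : Rep T D E F κ) {m : ℤ} {x : K} (hx : x ∈ D m) (hE : E x = 0)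
    (hF : F x = 0) : x = 0 := by
  have h1 := h.inner_E m x hx (T x) (h.T_mem _ _ hx)
  rw [hE, h.FT _ _ hx, hF, map_zero, zero_sub, inner_zero_left, inner_neg_right, neg_neg] at h1
  exact inner_self_eq_zero.1 h1.symm

lemma Rep.pos_of_F_eq_zero (h : Rep T D E F κ) {m : ℤ} {x : K} (hx : x ∈ D m) (hx0 : x ≠ 0)
    (hF : F x = 0) : 0 < 2 * m + κ := by
  have h1 := h.norm_sq_sub hx
  have hE : E x ≠ 0 := fun hE => hx0 (h.eq_zero_of_both hx hE hF)
  rw [hF, norm_zero] at h1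
  have h2 : 0 < ‖E x‖ := norm_pos_iff.2 hE
  have h3 : 0 < ‖x‖ := norm_pos_iff.2 hx0
  have h4 : 0 < (2 * m + κ) * ‖x‖ ^ 2 := by rw [← h1]; nlinarith
  exact pos_of_mul_pos_left h4 (by positivity)

lemma Rep.pos_of_pow_F (h : Rep T D E F κ) {m : ℤ} {x : K} (hx : x ∈ D m) (hx0 : x ≠ 0)
    {k : ℕ} (hF : (F ^ k) x = 0) : 0 < 2 * m + κ := by
  induction k generalizing m x with
  | zero => exact absurd hF hx0
  | succ k ih =>
    rw [pow_succ] at hF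
    by_cases hFx : F x = 0
    · exact h.pos_of_F_eq_zero hx hx0 hFx
    · have := ih (h.F_mem _ _ hx) hFx hF
      push_cast at this
      linarith

lemma Rep.neg_of_pow_E (h : Rep T D E F κ) {m : ℤ} {x : K} (hx : x ∈ D m) (hx0 : x ≠ 0)
    {k : ℕ} (hE : (E ^ k) x = 0) : 2 * m + κ < 0 := by
  have := h.dual.pos_of_pow_F (m := -m) (x := x) (by simpa using hx) hx0 hE
  push_cast at this
  linarith

lemma Rep.pow_E_mem (h : Rep T D E F κ) {m : ℤ} {x : K} (hx : x ∈ D m) (k : ℕ) :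
    (E ^ k) x ∈ D (m + k) := by
  induction k generalizing m x with
  | zero => simpa using hx
  | succ k ih =>
    rw [pow_succ]
    have := ih (h.E_mem _ _ hx)
    rwa [show m + 1 + (k : ℤ) = m + (k + 1 : ℕ) by push_cast; ring] at this

lemma Rep.pow_F_mem (h : Rep T D E F κ) {m : ℤ} {x : K} (hx : x ∈ D m) (k : ℕ) :
    (F ^ k) x ∈ D (m - k) := by
  have := h.dual.pow_E_mem (m := -m) (x := x) (by simpa using hx) k
  simpa [sub_eq_add_neg, add_comm] using this

lemma Rep.finiteDimensional (h : Rep T D E F κ) {m : ℤ} {k : ℕ}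
    [FiniteDimensional ℂ (D (m + k))] [FiniteDimensional ℂ (D (m - k))] :
    FiniteDimensional ℂ (D m) := by
  let f : D m →ₗ[ℂ] D (m + k) × D (m - k) :=
    (LinearMap.prod ((E ^ k).restrict fun x hx => h.pow_E_mem hx k)
      ((F ^ k).restrict fun x hx => h.pow_F_mem hx k))
  refine FiniteDimensional.of_injective f ((injective_iff_map_eq_zero f).2 fun x hx => ?_)
  have h1 : (E ^ k) (x : K) = 0 := congrArg Subtype.val (congrArg Prod.fst hx)
  have h2 : (F ^ k) (x : K) = 0 := congrArg Subtype.val (congrArg Prod.snd hx)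
  by_contra hx0
  have hx0' : (x : K) ≠ 0 := fun h => hx0 (Subtype.ext h)
  have := h.neg_of_pow_E x.2 hx0' h1
  have := h.pos_of_pow_F x.2 hx0' h2
  linarith

/-- An irreducible finite-dimensional representation, with pieces of dimension two far out. -/
structure Model (T : K →L[ℂ] K) (G : ℤ → Submodule ℂ K) (E F : K →ₗ[ℂ] K) (κ : ℝ) : Prop where
  irr : IrreducibleOp T
  grading : IsGrading G
  rep : Rep T G E F κ
  fin : ∀ n, FiniteDimensional ℂ (G n)
  dim : ∃ B : ℤ, ∀ n, B < |n| → Module.finrank ℂ (G n) = 2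

lemma IrreducibleOp.star (h : IrreducibleOp T) : IrreducibleOp (star T) := by
  intro M hM h1 h2
  rw [← star_eq_adjoint, star_star] at h2
  exact h M hM h2 h1

lemma IsGrading.neg (hG : IsGrading G) : IsGrading fun n => G (-n) where
  closed n := hG.closed _
  orth m n hmn := hG.orth _ _ (by simpa using hmn)
  span := by
    rw [← hG.span]
    congr 1
    exact (Equiv.neg ℤ).iSup_congr fun n => rfl

lemma Model.dual (h : Model T G E F κ) : Model (star T) (fun n => G (-n)) F E (-κ) where
  irr := TwoShift.IrreducibleOp.star h.irr
  grading := h.grading.neg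
  rep := h.rep.dual
  fin n := h.fin _
  dim := by
    obtain ⟨B, hB⟩ := h.dim
    exact ⟨B, fun n hn => hB _ (by simpa using hn)⟩

lemma Setup.exists_model [Nontrivial K] [TopologicalSpace.SeparableSpace K]
    {V : ℂ → K →L[ℂ] K} (h : Setup T V G)
    (hdim : ∃ B : ℤ, ∀ n, B < |n| → Module.finrank ℂ (G n) = 2) :
    ∃ E F : K →ₗ[ℂ] K, ∃ κ : ℝ, Model T G E F κ := by
  obtain ⟨B, hB⟩ := hdim
  set m : ℤ := |B| + 2 with hm
  have hB' : B ≤ |B| := le_abs_self B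
  have h0 : 0 ≤ |B| := abs_nonneg B
  have hf : ∀ n, B < |n| → FiniteDimensional ℂ (G n) := fun n hn =>
    Module.finite_of_finrank_pos (by rw [hB n hn]; norm_num)
  have f0 : FiniteDimensional ℂ (G m) := hf _ (by rw [abs_of_nonneg (by omega)]; omega)
  have f1 : FiniteDimensional ℂ (G (m - 1)) := hf _ (by rw [abs_of_nonneg (by omega)]; omega)
  have f2 : FiniteDimensional ℂ (G (m + 1)) := hf _ (by rw [abs_of_nonneg (by omega)]; omega)
  obtain ⟨V', v, hC, hv, hv0, hl⟩ :=
    h.exists_phase (hB m (by rw [abs_of_nonneg (by omega)]; omega))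
  obtain ⟨E, F, κ, hR⟩ := hC.exists_rep h.grading h.shift hv hv0 hl
  have hle := genMod_le h.grading h.shift hv
  have hgood : ∀ n, B < |n| → FiniteDimensional ℂ (genMod T v m n) := fun n hn => by
    have := hf n hn
    exact Submodule.finiteDimensional_of_le (hle n)
  have hfin : ∀ n, FiniteDimensional ℂ (genMod T v m n) := by
    intro n
    have hn := abs_nonneg n
    have hn1 := le_abs_self n
    have hn2 := neg_abs_le n
    let k : ℕ := (|B| + |n| + 1).toNat
    have hk : (k : ℤ) = |B| + |n| + 1 := Int.toNat_of_nonneg (by omega)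
    have := hgood (n + k) (by rw [abs_of_nonneg (by omega)]; omega)
    have := hgood (n - k) (by rw [abs_of_nonpos (by omega)]; omega)
    exact hR.finiteDimensional (k := k)
  have heq : genMod T v m = G := funext fun n => by
    have := hfin n
    exact genMod_eq h.irr h.grading h.shift hv hv0 n
  rw [heq] at hR hfin
  exact ⟨E, F, κ, h.irr, h.grading, hR, hfin, B, hB⟩

end TwoShift

namespace TwoShift

open scoped InnerProductSpace ComplexConjugate
open Filter Topology

variable {K : Type*} [NormedAddCommGroup K] [InnerProductSpace ℂ K] [CompleteSpace K]

variable {T : K →L[ℂ] K} {G : ℤ → Submodule ℂ K} {E F : K →ₗ[ℂ] K} {κ : ℝ}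

/-- An invariant graded family of subspaces is trivial. -/
lemma Model.reducing (h : Model T G E F κ) {P : ℤ → Submodule ℂ K} (hP : ∀ n, P n ≤ G n)
    (hT : ∀ n, ∀ x ∈ P n, T x ∈ P (n + 1)) (hS : ∀ n, ∀ x ∈ P n, star T x ∈ P (n - 1)) :
    (∀ n, P n = ⊥) ∨ ∀ n, P n = G n := by
  by_cases h0 : ∀ n, P n = ⊥
  · exact Or.inl h0
  refine Or.inr fun n => ?_
  push Not at h0
  obtain ⟨m, hm⟩ := h0
  obtain ⟨v, hv, hv0⟩ := Submodule.exists_mem_ne_zero_of_ne_bot hm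
  have hle : ∀ n, genMod T v m n ≤ P n := by
    intro n x hx
    change Gen T v m n x at hx
    induction hx with
    | base => exact hv
    | zero n => exact zero_mem _
    | add _ _ h1 h2 => exact add_mem h1 h2
    | smul c _ h1 => exact Submodule.smul_mem _ c h1
    | up _ h1 => exact hT _ _ h1
    | down _ h1 => exact hS _ _ h1
  have := h.fin n
  have : FiniteDimensional ℂ (genMod T v m n) :=
    Submodule.finiteDimensional_of_le ((hle n).trans (hP n))
  have := genMod_eq h.irr h.grading h.rep.T_mem (hP m hv) hv0 n
  exact le_antisymm (hP n) (this ▸ hle n)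

/-- The vectors of a graded piece killed by a power of `F`. -/
def nilPart (G : ℤ → Submodule ℂ K) (F : K →ₗ[ℂ] K) (n : ℤ) : Submodule ℂ K where
  carrier := {x | x ∈ G n ∧ ∃ k, (F ^ k) x = 0}
  zero_mem' := ⟨zero_mem _, 0, map_zero _⟩
  add_mem' := by
    rintro x y ⟨hx, k, hk⟩ ⟨hy, l, hl⟩
    refine ⟨add_mem hx hy, k + l, ?_⟩
    rw [map_add]
    nth_rewrite 1 [add_comm k l]
    rw [pow_add, pow_add, Module.End.mul_apply, Module.End.mul_apply, hk, hl, map_zero,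
      map_zero, add_zero]
  smul_mem' := by
    rintro c x ⟨hx, k, hk⟩
    exact ⟨Submodule.smul_mem _ c hx, k, by rw [map_smul, hk, smul_zero]⟩

lemma Rep.F_mem_nilPart (h : Rep T G E F κ) {n : ℤ} {x : K} (hx : x ∈ nilPart G F n) :
    F x ∈ nilPart G F (n - 1) := by
  obtain ⟨hx, k, hk⟩ := hx
  refine ⟨h.F_mem _ _ hx, k, ?_⟩
  rw [← Module.End.mul_apply, ← pow_succ, pow_succ', Module.End.mul_apply, hk, map_zero]

lemma Rep.E_mem_nilPart (h : Rep T G E F κ) {n : ℤ} {x : K} (hx : x ∈ nilPart G F n) :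
    E x ∈ nilPart G F (n + 1) := by
  obtain ⟨hx, k, hk⟩ := hx
  refine ⟨h.E_mem _ _ hx, k + 1, ?_⟩
  induction k generalizing n x with
  | zero =>
    rw [show x = 0 from hk, map_zero, map_zero]
  | succ k ih =>
    rw [pow_succ, Module.End.mul_apply, show F (E x) = E (F x) - (2 * n + κ : ℂ) • x by
      rw [← h.comm _ _ hx]; abel, map_sub, map_smul, hk, smul_zero, sub_zero]
    exact ih (h.F_mem _ _ hx) (by rwa [pow_succ] at hk)

lemma Rep.T_mem_nilPart (h : Rep T G E F κ) {n : ℤ} {x : K} (hx : x ∈ nilPart G F n) :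
    T x ∈ nilPart G F (n + 1) := by
  obtain ⟨hx, k, hk⟩ := hx
  refine ⟨h.T_mem _ _ hx, k + 1, ?_⟩
  induction k generalizing n x with
  | zero => rw [show x = 0 from hk, map_zero, map_zero]
  | succ k ih =>
    rw [pow_succ, Module.End.mul_apply, h.FT _ _ hx, map_sub, hk, sub_zero]
    exact ih (h.F_mem _ _ hx) (by rwa [pow_succ] at hk)

lemma Rep.nilPart_E_of_dual (G : ℤ → Submodule ℂ K) (E : K →ₗ[ℂ] K) (n : ℤ) :
    nilPart (fun m => G (-m)) E (-n) = nilPart G E n := by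
  ext x
  change (x ∈ G (- -n) ∧ _) ↔ (x ∈ G n ∧ _)
  rw [neg_neg]

lemma Rep.E_mem_nilPart_E (h : Rep T G E F κ) {n : ℤ} {x : K} (hx : x ∈ nilPart G E n) :
    E x ∈ nilPart G E (n + 1) := by
  rw [← Rep.nilPart_E_of_dual] at hx ⊢
  have := h.dual.F_mem_nilPart hx
  rwa [neg_add']

lemma Rep.F_mem_nilPart_E (h : Rep T G E F κ) {n : ℤ} {x : K} (hx : x ∈ nilPart G E n) :
    F x ∈ nilPart G E (n - 1) := by
  rw [← Rep.nilPart_E_of_dual] at hx ⊢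
  have := h.dual.E_mem_nilPart hx
  rwa [show -(n - 1) = -n + 1 by ring]

lemma Rep.S_mem_nilPart_E (h : Rep T G E F κ) {n : ℤ} {x : K} (hx : x ∈ nilPart G E n) :
    star T x ∈ nilPart G E (n - 1) := by
  rw [← Rep.nilPart_E_of_dual] at hx ⊢
  have := h.dual.T_mem_nilPart hx
  rwa [show -(n - 1) = -n + 1 by ring]

lemma Rep.nilPart_F_eq_zero (h : Rep T G E F κ) {n : ℤ} (hn : 2 * n + κ ≤ 0) {x : K}
    (hx : x ∈ nilPart G F n) : x = 0 := by
  by_contra hx0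
  obtain ⟨hx, k, hk⟩ := hx
  have := h.pos_of_pow_F hx hx0 hk
  linarith

lemma Rep.nilPart_E_eq_zero (h : Rep T G E F κ) {n : ℤ} (hn : 0 ≤ 2 * n + κ) {x : K}
    (hx : x ∈ nilPart G E n) : x = 0 := by
  by_contra hx0
  obtain ⟨hx, k, hk⟩ := hx
  have := h.neg_of_pow_E hx hx0 hk
  linarith

/-- The orthogonal complement of the lowest and highest weight parts. -/
def corePart (G : ℤ → Submodule ℂ K) (E F : K →ₗ[ℂ] K) (n : ℤ) : Submodule ℂ K :=
  G n ⊓ ((nilPart G F n)ᗮ ⊓ (nilPart G E n)ᗮ)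

lemma corePart_dual (G : ℤ → Submodule ℂ K) (E F : K →ₗ[ℂ] K) (n : ℤ) :
    corePart (fun m => G (-m)) F E (-n) = corePart G E F n := by
  rw [corePart, corePart, Rep.nilPart_E_of_dual, Rep.nilPart_E_of_dual, neg_neg]
  congr 1
  exact inf_comm _ _

lemma Rep.E_mem_core (h : Rep T G E F κ) {n : ℤ} {x : K} (hx : x ∈ corePart G E F n) :
    E x ∈ corePart G E F (n + 1) := by
  obtain ⟨hx, h1, h2⟩ := hx
  refine ⟨h.E_mem _ _ hx, fun y hy => ?_, fun y hy => ?_⟩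
  · rw [← inner_conj_symm, h.inner_E _ _ hx _ hy.1, ← inner_conj_symm,
      h1 _ (by simpa using h.F_mem_nilPart hy)]
    simp
  · rw [← inner_conj_symm, h.inner_E _ _ hx _ hy.1, ← inner_conj_symm,
      h2 _ (by simpa using h.F_mem_nilPart_E hy)]
    simp

lemma Rep.F_mem_core (h : Rep T G E F κ) {n : ℤ} {x : K} (hx : x ∈ corePart G E F n) :
    F x ∈ corePart G E F (n - 1) := by
  rw [← corePart_dual] at hx ⊢
  have := h.dual.E_mem_core hx
  rwa [show -(n - 1) = -n + 1 by ring]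

lemma Rep.eq_zero_of_E_core (h : Rep T G E F κ) {n : ℤ} {x : K} (hx : x ∈ corePart G E F n)
    (hE : E x = 0) : x = 0 := by
  have h1 : x ∈ nilPart G E n := ⟨hx.1, 1, by rwa [pow_one]⟩
  exact inner_self_eq_zero.1 (hx.2.2 x h1)

lemma Rep.eq_zero_of_F_core (h : Rep T G E F κ) {n : ℤ} {x : K} (hx : x ∈ corePart G E F n)
    (hF : F x = 0) : x = 0 := by
  have h1 : x ∈ nilPart G F n := ⟨hx.1, 1, by rwa [pow_one]⟩
  exact inner_self_eq_zero.1 (hx.2.1 x h1)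

lemma Model.finrank_core (h : Model T G E F κ) (n : ℤ) :
    Module.finrank ℂ (corePart G E F n) = Module.finrank ℂ (corePart G E F (n + 1)) := by
  have hf : ∀ k, FiniteDimensional ℂ (corePart G E F k) := fun k => by
    have := h.fin k
    exact Submodule.finiteDimensional_of_le inf_le_left
  refine le_antisymm ?_ ?_
  · refine LinearMap.finrank_le_finrank_of_injective
      (f := E.restrict (q := corePart G E F (n + 1)) fun x hx => h.rep.E_mem_core hx)
      ((injective_iff_map_eq_zero _).2 fun x hx => Subtype.ext ?_)
    exact h.rep.eq_zero_of_E_core x.2 (congrArg Subtype.val hx)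
  · refine LinearMap.finrank_le_finrank_of_injective
      (f := F.restrict (p := corePart G E F (n + 1)) (q := corePart G E F n) fun x hx => by
        simpa using h.rep.F_mem_core hx)
      ((injective_iff_map_eq_zero _).2 fun x hx => Subtype.ext ?_)
    exact h.rep.eq_zero_of_F_core x.2 (congrArg Subtype.val hx)

lemma Model.T_mem_core_step (h : Model T G E F κ) {n : ℤ}
    (hn : ∀ w ∈ corePart G E F n, T w ∈ corePart G E F (n + 1)) :
    ∀ w ∈ corePart G E F (n + 1), T w ∈ corePart G E F (n + 1 + 1) := by
  have hf : ∀ k, FiniteDimensional ℂ (corePart G E F k) := fun k => by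
    have := h.fin k
    exact Submodule.finiteDimensional_of_le inf_le_left
  let f : corePart G E F n →ₗ[ℂ] corePart G E F (n + 1) :=
    (E + (T : K →ₗ[ℂ] K)).restrict fun x hx => add_mem (h.rep.E_mem_core hx) (hn x hx)
  have hinj : Function.Injective f := (injective_iff_map_eq_zero _).2 fun x hx => by
    have h1 : E (x : K) + T (x : K) = 0 := congrArg Subtype.val hx
    have h2 : E (T (x : K)) = 0 := by
      rw [h.rep.ET _ _ x.2.1, ← map_add, h1, map_zero]
    have h3 := h.rep.eq_zero_of_E_core (hn _ x.2) h2
    rw [h3, add_zero] at h1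
    exact Subtype.ext (h.rep.eq_zero_of_E_core x.2 h1)
  have hsurj := (LinearMap.injective_iff_surjective_of_finrank_eq_finrank (h.finrank_core n)).1 hinj
  intro w hw
  obtain ⟨x, hx⟩ := hsurj ⟨w, hw⟩
  have h1 : E (x : K) + T (x : K) = w := congrArg Subtype.val hx
  rw [← h1, map_add, ← h.rep.ET _ _ x.2.1]
  exact h.rep.E_mem_core (hn _ x.2)

lemma Model.T_mem_core (h : Model T G E F κ) (n : ℤ) :
    ∀ w ∈ corePart G E F n, T w ∈ corePart G E F (n + 1) := by
  have low : ∀ n : ℤ, 2 * ((n + 1 : ℤ) : ℝ) + κ ≤ 0 →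
      ∀ w ∈ corePart G E F n, T w ∈ corePart G E F (n + 1) := by
    intro n hn w hw
    refine ⟨h.rep.T_mem _ _ hw.1, fun y hy => ?_, fun y hy => ?_⟩
    · rw [h.rep.nilPart_F_eq_zero hn hy, inner_zero_left]
    · rw [← adjoint_inner_left, ← star_eq_adjoint]
      exact hw.2.2 _ (by simpa using h.rep.S_mem_nilPart_E hy)
  obtain ⟨m, hm⟩ := exists_int_lt (-κ / 2 - 1)
  have hm' : 2 * ((m + 1 : ℤ) : ℝ) + κ ≤ 0 := by push_cast; linarith
  rcases le_total n m with hnm | hnm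
  · refine low n ?_
    have : ((n + 1 : ℤ) : ℝ) ≤ ((m + 1 : ℤ) : ℝ) := by exact_mod_cast by omega
    linarith
  · induction n, hnm using Int.leInduction with
    | base => exact low m hm'
    | succ k hk ih => exact h.T_mem_core_step ih

lemma Model.core_trivial (h : Model T G E F κ) :
    (∀ n, corePart G E F n = ⊥) ∨ ∀ n, corePart G E F n = G n := by
  refine h.reducing (fun n => inf_le_left) h.T_mem_core fun n x hx => ?_
  have := h.dual.T_mem_core (-n) x (by rwa [corePart_dual])
  rwa [show -n + 1 = -(n - 1) by ring, corePart_dual] at this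

/-- The chain generated by a raising operator from a suitable vector. -/
lemma Rep.chain (h : Rep T G E F κ) {m : ℤ} {x y : K} {ρ : ℂ} (hx : x ∈ G m)
    (hEx : E x = 0) (hy : T x = y) (hSy : star T y = ρ • x) (k : ℕ) :
    (k + 1 : ℂ) • T ((E ^ k) y) = (E ^ (k + 1)) y ∧
      star T ((E ^ (k + 1)) y) = (k + 1 : ℂ) • (E ^ k) y := by
  have hyG : y ∈ G (m + 1) := hy ▸ h.T_mem _ _ hx
  have hk : ∀ k : ℕ, (E ^ k) y ∈ G (m + 1 + k) := fun k => h.pow_E_mem hyG k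
  have hsucc : ∀ k : ℕ, (E ^ (k + 1)) y = E ((E ^ k) y) := fun k => by
    rw [pow_succ']; rfl
  induction k with
  | zero =>
    constructor
    · have := h.ET _ _ hx
      rw [hEx, hy, map_zero, zero_add] at this
      simp [this]
    · have := h.ES _ _ hyG
      rw [hSy, map_smul, hEx, smul_zero] at this
      simpa using (sub_eq_zero.1 this.symm)
  | succ k ih =>
    have h1 := h.ET _ _ (hk k)
    have h2 := h.ES _ _ (hk (k + 1))
    constructor
    · have h3 := congrArg E ih.1
      have h4 := congrArg T ih.1
      rw [map_smul] at h3 h4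
      rw [← hsucc] at h3
      rw [← hsucc] at h1
      push_cast
      linear_combination (norm := module) h3 - (k + 1 : ℂ) • h1 - h4
    · rw [ih.2, map_smul, ← hsucc, ← hsucc] at h2
      push_cast
      linear_combination (norm := module) - h2

end TwoShift

namespace TwoShift

open scoped InnerProductSpace ComplexConjugate
open Filter Topology

variable {K : Type*} [NormedAddCommGroup K] [InnerProductSpace ℂ K] [CompleteSpace K]

variable {T : K →L[ℂ] K} {G : ℤ → Submodule ℂ K} {E F : K →ₗ[ℂ] K} {κ : ℝ}

lemma exists_eigenvector_ne_zero {M : Submodule ℂ K} [FiniteDimensional ℂ M] {a : K →L[ℂ] K}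
    (ha : IsSelfAdjoint a) (hM : ∀ x ∈ M, a x ∈ M) (h0 : ∃ x ∈ M, a x ≠ 0) :
    ∃ x ∈ M, ∃ ρ : ℂ, x ≠ 0 ∧ ρ ≠ 0 ∧ a x = ρ • x := by
  let f : M →ₗ[ℂ] M := (a : K →ₗ[ℂ] K).restrict hM
  have hf : f.IsSymmetric := by
    intro x y
    change ⟪a x, (y : K)⟫_ℂ = ⟪(x : K), a y⟫_ℂ
    rw [← adjoint_inner_right, ← star_eq_adjoint, ha.star_eq]
  let b := hf.eigenvectorBasis rfl
  have hb : ∀ i, a (b i : K) = ((hf.eigenvalues rfl i : ℝ) : ℂ) • (b i : K) := fun i =>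
    congrArg (Submodule.subtype M) (hf.apply_eigenvectorBasis rfl i)
  by_contra! hcon
  have hz : ∀ i, a (b i : K) = 0 := fun i => by
    by_cases h1 : ((hf.eigenvalues rfl i : ℝ) : ℂ) = 0
    · rw [hb, h1, zero_smul]
    · refine absurd (hb i) (hcon _ (b i).2 _ (fun h => ?_) h1)
      have := b.norm_eq_one i
      rw [show b i = 0 from Subtype.ext h, norm_zero] at this
      exact zero_ne_one this
  obtain ⟨x, hx, hax⟩ := h0
  refine hax ?_
  have := congrArg (Submodule.subtype M) (b.sum_repr ⟨x, hx⟩)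
  rw [map_sum] at this
  rw [show x = _ from this.symm, map_sum]
  refine Finset.sum_eq_zero fun i _ => ?_
  rw [map_smul, map_smul, Submodule.subtype_apply, hz, smul_zero]

lemma Model.exists_finrank_two (h : Model T G E F κ) (m : ℤ) :
    (∃ n, n ≤ m ∧ Module.finrank ℂ (G n) = 2) ∧ ∃ n, m < n ∧ Module.finrank ℂ (G n) = 2 := by
  obtain ⟨B, hB⟩ := h.dim
  have h0 := abs_nonneg m
  have h1 := le_abs_self m
  have h2 := neg_abs_le m
  have h3 := abs_nonneg B
  have h4 := le_abs_self B
  exact ⟨⟨-(|B| + |m| + 1), by omega, hB _ (by rw [abs_of_nonpos (by omega)]; omega)⟩,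
    ⟨|B| + |m| + 1, by omega, hB _ (by rw [abs_of_nonneg (by omega)]; omega)⟩⟩

lemma ne_bot_of_finrank_two {M : Submodule ℂ K} (h : Module.finrank ℂ M = 2) : M ≠ ⊥ := by
  rintro rfl
  simp at h

lemma Model.exists_apply_ne_zero (h : Model T G E F κ) (m : ℤ) : ∃ x ∈ G m, T x ≠ 0 := by
  by_contra! hcon
  have hS : ∀ y ∈ G (m + 1), star T y = 0 := fun y hy => by
    have h1 : star T y ∈ G m := by simpa using h.rep.S_mem _ _ hy
    have h2 : ⟪star T y, star T y⟫_ℂ = 0 := by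
      conv_lhs => rw [star_eq_adjoint, adjoint_inner_left, ← star_eq_adjoint]
      rw [hcon _ h1, inner_zero_right]
    exact inner_self_eq_zero.1 h2
  obtain ⟨⟨n1, hn1, hd1⟩, n2, hn2, hd2⟩ := h.exists_finrank_two m
  rcases h.reducing (P := fun n => if m < n then G n else ⊥)
    (fun n => by split_ifs; exacts [le_rfl, bot_le])
    (fun n x hx => by
      split_ifs at hx with h1
      · rw [if_pos (by omega)]; exact h.rep.T_mem _ _ hx
      · rw [(Submodule.mem_bot ℂ).1 hx, map_zero]; exact zero_mem _)
    (fun n x hx => by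
      split_ifs at hx with h1
      · rcases eq_or_ne n (m + 1) with rfl | hn
        · rw [hS _ hx]; exact zero_mem _
        · rw [if_pos (by omega)]; exact h.rep.S_mem _ _ hx
      · rw [(Submodule.mem_bot ℂ).1 hx, map_zero]; exact zero_mem _) with h1 | h1
  · have := h1 n2
    rw [if_pos hn2] at this
    exact ne_bot_of_finrank_two hd2 this
  · have := h1 n1
    rw [if_neg (by omega)] at this
    exact ne_bot_of_finrank_two hd1 this.symm

/-- There are no lowest or highest weight vectors. -/
lemma Model.core_eq (h : Model T G E F κ) (n : ℤ) : corePart G E F n = G n := by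
  rcases h.core_trivial with hc | hc
  swap
  · exact hc n
  exfalso
  have dense : ∀ n, ∀ x ∈ G n, (∀ y ∈ nilPart G F n, ⟪y, x⟫_ℂ = 0) →
      (∀ y ∈ nilPart G E n, ⟪y, x⟫_ℂ = 0) → x = 0 := fun n x hx h1 h2 => by
    have : x ∈ corePart G E F n := ⟨hx, h1, h2⟩
    rw [hc] at this
    exact this
  have hfin : ∀ n, FiniteDimensional ℂ (nilPart G E n) ∧ FiniteDimensional ℂ (nilPart G F n) :=
    fun n => by
      have := h.fin n
      exact ⟨Submodule.finiteDimensional_of_le fun x hx => hx.1,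
        Submodule.finiteDimensional_of_le fun x hx => hx.1⟩
  have hlow : ∀ n : ℤ, 2 * (n : ℝ) + κ ≤ 0 → nilPart G E n = G n := fun n hn => by
    have := (hfin n).1
    refine eq_of_dense (fun x hx => hx.1) fun x hx h1 => dense n x hx (fun y hy => ?_) h1
    rw [h.rep.nilPart_F_eq_zero hn hy, inner_zero_left]
  have hhigh : ∀ n : ℤ, 0 ≤ 2 * (n : ℝ) + κ → nilPart G F n = G n := fun n hn => by
    have := (hfin n).2
    refine eq_of_dense (fun x hx => hx.1) fun x hx h1 => dense n x hx h1 (fun y hy => ?_)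
    rw [h.rep.nilPart_E_eq_zero hn hy, inner_zero_left]
  set m : ℤ := ⌈-κ / 2⌉ - 1 with hm
  have hm1 : 2 * (m : ℝ) + κ < 0 := by
    have : (m : ℝ) < -κ / 2 := Int.lt_ceil.1 (by omega)
    linarith
  have hm2 : 0 ≤ 2 * ((m + 1 : ℤ) : ℝ) + κ := by
    have : -κ / 2 ≤ ((m + 1 : ℤ) : ℝ) := Int.ceil_le.1 (by omega)
    linarith
  have hE : ∀ x ∈ G m, E x = 0 := fun x hx => by
    rw [← hlow m hm1.le] at hx
    exact h.rep.nilPart_E_eq_zero hm2 (h.rep.E_mem_nilPart_E hx)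
  have hF : ∀ x ∈ G (m + 1), F x = 0 := fun x hx => by
    rw [← hhigh (m + 1) hm2] at hx
    have := h.rep.F_mem_nilPart hx
    rw [add_sub_cancel_right] at this
    exact h.rep.nilPart_F_eq_zero hm1.le this
  have := h.fin m
  obtain ⟨x, hx, ρ, hx0, hρ, hxρ⟩ := exists_eigenvector_ne_zero (M := G m)
    (IsSelfAdjoint.star_mul_self T)
    (fun x hx => by simpa using h.rep.S_mem _ _ (h.rep.T_mem _ _ hx))
    (by
      obtain ⟨x, hx, hTx⟩ := h.exists_apply_ne_zero m
      refine ⟨x, hx, fun h0 => hTx ?_⟩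
      have h1 : ⟪T x, T x⟫_ℂ = 0 := by
        rw [← adjoint_inner_right, ← star_eq_adjoint]
        change ⟪x, (star T * T) x⟫_ℂ = 0
        rw [h0, inner_zero_right]
      exact inner_self_eq_zero.1 h1)
  replace hxρ : star T (T x) = ρ • x := hxρ
  have hyG := h.rep.T_mem _ _ hx
  have c1 := h.rep.chain hx (hE x hx) rfl hxρ
  have c2 := h.rep.dual.chain (m := -(m + 1)) (x := T x) (y := ρ • x) (ρ := ρ)
    (by rw [neg_neg]; exact hyG) (hF _ hyG) hxρ (by rw [star_star, map_smul])
  rw [star_star] at c2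
  let v : ℤ → K := fun n =>
    if m < n then (E ^ (n - m - 1).toNat) (T x) else (F ^ (m - n).toNat) (ρ • x)
  have v1 : ∀ k : ℕ, v (m + 1 + k) = (E ^ k) (T x) := fun k => by
    simp only [v]
    rw [if_pos (by omega), show (m + 1 + (k : ℤ) - m - 1).toNat = k by omega]
  have v2 : ∀ k : ℕ, v (m - k) = (F ^ k) (ρ • x) := fun k => by
    simp only [v]
    rw [if_neg (by omega), show (m - (m - (k : ℤ))).toNat = k by omega]
  have hcase : ∀ n, (∃ k : ℕ, n = m + 1 + k) ∨ ∃ k : ℕ, n = m - k := fun n => by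
    rcases lt_or_ge m n with hn | hn
    · exact Or.inl ⟨(n - m - 1).toNat, by omega⟩
    · exact Or.inr ⟨(m - n).toNat, by omega⟩
  have hk0 : ∀ k : ℕ, (k + 1 : ℂ) ≠ 0 := fun k => by exact_mod_cast k.succ_ne_zero
  have key : ∀ (a : K →L[ℂ] K) (z w : K), a z ∈ ℂ ∙ w → ∀ u ∈ ℂ ∙ z, a u ∈ ℂ ∙ w := by
    intro a z w h1 u hu
    obtain ⟨c, rfl⟩ := Submodule.mem_span_singleton.1 hu
    rw [map_smul]
    exact Submodule.smul_mem _ _ h1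
  have self : ∀ z : K, z ∈ ℂ ∙ z := Submodule.mem_span_singleton_self
  rcases h.reducing (P := fun n => ℂ ∙ v n)
    (fun n => by
      rw [Submodule.span_singleton_le_iff_mem]
      rcases hcase n with ⟨k, rfl⟩ | ⟨k, rfl⟩
      · rw [v1]; exact h.rep.pow_E_mem hyG k
      · rw [v2]; exact h.rep.pow_F_mem (Submodule.smul_mem _ _ hx) k)
    (fun n => key T _ _ (by
      rcases hcase n with ⟨k, rfl⟩ | ⟨k, rfl⟩
      · have := v1 (k + 1)
        push_cast at this
        rw [← add_assoc] at this
        rw [v1, this, ← (c1 k).1]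
        exact (Submodule.smul_mem_iff _ (hk0 k)).1 (self _)
      · cases k with
        | zero =>
          have := v1 0
          rw [Nat.cast_zero, add_zero] at this
          rw [v2, Nat.cast_zero, sub_zero, this, pow_zero, pow_zero]
          change T (ρ • x) ∈ ℂ ∙ T x
          rw [map_smul]
          exact Submodule.smul_mem _ _ (self _)
        | succ k =>
          rw [v2, show m - ((k + 1 : ℕ) : ℤ) + 1 = m - k by push_cast; ring, v2, (c2 k).2]
          exact Submodule.smul_mem _ _ (self _)))
    (fun n => key (star T) _ _ (by
      rcases hcase n with ⟨k, rfl⟩ | ⟨k, rfl⟩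
      · cases k with
        | zero =>
          have := v2 0
          rw [Nat.cast_zero, sub_zero] at this
          rw [v1, Nat.cast_zero, add_zero, add_sub_cancel_right, this, pow_zero, pow_zero]
          change star T (T x) ∈ ℂ ∙ (ρ • x)
          rw [hxρ]
          exact self _
        | succ k =>
          rw [v1, show m + 1 + ((k + 1 : ℕ) : ℤ) - 1 = m + 1 + k by push_cast; ring, v1, (c1 k).2]
          exact Submodule.smul_mem _ _ (self _)
      · have := v2 (k + 1)
        push_cast at this
        rw [← sub_sub] at this
        rw [v2, this, ← (c2 k).1]
        exact (Submodule.smul_mem_iff _ (hk0 k)).1 (self _))) with h1 | h1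
  · have := h1 m
    have h2 := v2 0
    rw [Nat.cast_zero, sub_zero, pow_zero] at h2
    simp only [h2, Submodule.span_singleton_eq_bot] at this
    exact smul_ne_zero hρ hx0 this
  · obtain ⟨-, n, -, hn⟩ := h.exists_finrank_two m
    rw [← h1 n] at hn
    have := finrank_span_le_card (R := ℂ) ({v n} : Set K)
    rw [hn] at this
    simp at this

lemma Model.E_injective (h : Model T G E F κ) {n : ℤ} {x : K} (hx : x ∈ G n) (hE : E x = 0) :
    x = 0 := h.rep.eq_zero_of_E_core (h.core_eq n ▸ hx) hE

lemma Model.finrank_eq_two (h : Model T G E F κ) (n : ℤ) : Module.finrank ℂ (G n) = 2 := by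
  have step : ∀ k, Module.finrank ℂ (G k) = Module.finrank ℂ (G (k + 1)) := fun k => by
    have := h.finrank_core k
    rwa [h.core_eq, h.core_eq] at this
  have all : ∀ k l, k ≤ l → Module.finrank ℂ (G k) = Module.finrank ℂ (G l) := fun k l hkl => by
    induction l, hkl using Int.leInduction with
    | base => rfl
    | succ l hl ih => rw [ih, step]
  obtain ⟨-, m, hm, hd⟩ := h.exists_finrank_two n
  rw [all n m hm.le, hd]
end TwoShift

namespace TwoShift

open scoped InnerProductSpace ComplexConjugate
open Filter Topology

variable {K : Type*} [NormedAddCommGroup K] [InnerProductSpace ℂ K] [CompleteSpace K]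

variable {T : K →L[ℂ] K} {G : ℤ → Submodule ℂ K} {E F : K →ₗ[ℂ] K} {κ : ℝ}

/-- In a plane, a vector is a combination of any two independent ones. -/
lemma exists_combination {M : Submodule ℂ K} (h2 : Module.finrank ℂ M = 2) {x z w : K}
    (hx : x ∈ M) (hz : z ∈ M) (hw : w ∈ M) (hx0 : x ≠ 0) (hind : ∀ c : ℂ, z ≠ c • x) :
    ∃ a b : ℂ, w = a • x + b • z := by
  have hfd : FiniteDimensional ℂ M := Module.finite_of_finrank_pos (by omega)
  have hli : LinearIndependent ℂ ![x, z] :=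
    (LinearIndependent.pair_iff' hx0).2 fun a h => hind a h.symm
  have hle : Submodule.span ℂ (Set.range ![x, z]) ≤ M := by
    rw [Submodule.span_le]
    rintro _ ⟨i, rfl⟩
    fin_cases i
    · exact hx
    · exact hz
  have heq : Submodule.span ℂ (Set.range ![x, z]) = M := by
    refine Submodule.eq_of_le_of_finrank_eq hle ?_
    rw [finrank_span_eq_card hli, h2, Fintype.card_fin]
  rw [← heq, Matrix.range_cons_cons_empty, Submodule.mem_span_pair] at hw
  obtain ⟨a, b, hab⟩ := hw
  exact ⟨a, b, hab.symm⟩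

lemma Model.T_injective (h : Model T G E F κ) {n : ℤ} {x : K} (hx : x ∈ G n) (hT : T x = 0) :
    x = 0 := by
  by_contra hx0
  have hFx := h.rep.F_mem _ _ hx
  set z := E (F x) with hz
  have hzG : z ∈ G n := by simpa using h.rep.E_mem _ _ hFx
  have hFz := h.rep.F_mem _ _ hzG
  have e1 : T (F x) = x := by
    have := h.rep.FT _ _ hx
    rw [hT, map_zero] at this
    exact (sub_eq_zero.1 this.symm)
  have e2 : T z = E x := by
    have := h.rep.ET _ _ hFx
    rw [e1, hT, add_zero] at this
    exact this.symm
  have e3 : T (F z) = (2 : ℂ) • z - (2 * n + κ : ℂ) • x := by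
    have h1 := h.rep.FT _ _ hzG
    have h2 := h.rep.comm _ _ hx
    rw [e2] at h1
    rw [← hz] at h2
    linear_combination (norm := module) -h1 - h2
  have e4 : T (E (F z)) = (2 : ℂ) • E z - (2 * n + κ + 2 : ℂ) • E x := by
    have h1 := h.rep.ET _ _ hFz
    rw [e3, map_sub, map_sub, map_smul, map_smul, map_smul, map_smul, hT, e2] at h1
    linear_combination (norm := module) -h1
  have hind : ∀ c : ℂ, z ≠ c • x := by
    intro c hc
    rw [hc, map_smul, hT, smul_zero] at e2
    exact hx0 (h.E_injective hx e2.symm)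
  have hw : E (F z) ∈ G n := by simpa using h.rep.E_mem _ _ hFz
  obtain ⟨a, b, hab⟩ := exists_combination (h.finrank_eq_two n) hx hzG hw hx0 hind
  rw [hab, map_add, map_smul, map_smul, hT, e2] at e4
  have e5 : E (z - ((b + (2 * n + κ + 2)) / 2 : ℂ) • x) = 0 := by
    rw [map_sub, map_smul]
    linear_combination (norm := module) (-1 / 2 : ℂ) • e4
  have e6 := h.E_injective (sub_mem hzG (Submodule.smul_mem _ _ hx)) e5
  exact hind _ (sub_eq_zero.1 e6)

lemma Model.exists_inverse (h : Model T G E F κ) {L : K →ₗ[ℂ] K}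
    (hL : ∀ n, ∀ x ∈ G n, L x ∈ G (n + 1)) (hinj : ∀ n, ∀ x ∈ G n, L x = 0 → x = 0) :
    ∃ R : K →ₗ[ℂ] K, ∀ n, ∀ y ∈ G (n + 1), R y ∈ G n ∧ L (R y) = y := by
  have hex : ∀ n, ∃ R : K →ₗ[ℂ] K, ∀ y ∈ G (n - 1 + 1), R y ∈ G (n - 1) ∧ L (R y) = y := by
    intro n
    have := h.fin (n - 1)
    have := h.fin (n - 1 + 1)
    have hi : Function.Injective (L.restrict (hL (n - 1))) :=
      (injective_iff_map_eq_zero _).2 fun x hx =>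
        Subtype.ext (hinj _ _ x.2 (congrArg Subtype.val hx))
    have hs := (LinearMap.injective_iff_surjective_of_finrank_eq_finrank
      ((h.finrank_eq_two (n - 1)).trans (h.finrank_eq_two (n - 1 + 1)).symm)).1 hi
    let e := LinearEquiv.ofBijective _ ⟨hi, hs⟩
    obtain ⟨R, hR⟩ := ((G (n - 1)).subtype ∘ₗ e.symm.toLinearMap).exists_extend
    refine ⟨R, fun y hy => ?_⟩
    have h1 : R y = (e.symm ⟨y, hy⟩ : G (n - 1)) := LinearMap.congr_fun hR ⟨y, hy⟩
    rw [h1]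
    exact ⟨(e.symm ⟨y, hy⟩).2, congrArg Subtype.val (e.apply_symm_apply ⟨y, hy⟩)⟩
  choose R hR using hex
  obtain ⟨R₀, hR₀⟩ := h.grading.exists_linear R
  refine ⟨R₀, fun n y hy => ?_⟩
  rw [hR₀ _ _ hy]
  have := hR (n + 1) y (by rwa [add_sub_cancel_right])
  rwa [add_sub_cancel_right] at this

/-- Transport from degree zero along the raising operator. -/
structure Transport (G : ℤ → Submodule ℂ K) (E : K →ₗ[ℂ] K) (ι : ℤ → K →ₗ[ℂ] K) : Prop where
  zero : ∀ x, ι 0 x = x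
  mem : ∀ n, ∀ x ∈ G 0, ι n x ∈ G n
  succ : ∀ n, ∀ x ∈ G 0, E (ι n x) = ι (n + 1) x

lemma Model.exists_transport (h : Model T G E F κ) :
    ∃ ι : ℤ → K →ₗ[ℂ] K, Transport G E ι := by
  obtain ⟨R, hR⟩ := h.exists_inverse h.rep.E_mem fun n x hx => h.E_injective hx
  let ι : ℤ → K →ₗ[ℂ] K := fun n => match n with
    | Int.ofNat k => E ^ k
    | Int.negSucc k => R ^ (k + 1)
  have hRk : ∀ k : ℕ, ∀ x ∈ G 0, (R ^ k) x ∈ G (-k) := by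
    intro k x hx
    induction k with
    | zero => simpa using hx
    | succ k ih =>
      rw [pow_succ']
      refine (hR _ _ ?_).1
      rwa [show -((k + 1 : ℕ) : ℤ) + 1 = -k by push_cast; ring]
  refine ⟨ι, fun x => rfl, fun n x hx => ?_, fun n x hx => ?_⟩
  · rcases n with k | k
    · simpa using h.rep.pow_E_mem hx k
    · exact hRk (k + 1) x hx
  · rcases n with k | k
    · change E ((E ^ k) x) = (E ^ (k + 1)) x
      rw [pow_succ']; rfl
    · have h1 : E ((R ^ (k + 1)) x) = (R ^ k) x := by
        rw [pow_succ']
        refine (hR (-(k + 1 : ℕ)) _ ?_).2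
        rw [show -((k + 1 : ℕ) : ℤ) + 1 = -k by push_cast; ring]
        exact hRk k x hx
      change E ((R ^ (k + 1)) x) = ι (Int.negSucc k + 1) x
      rw [h1]
      cases k <;> rfl

variable {ι : ℤ → K →ₗ[ℂ] K}

lemma Model.iota_injective (h : Model T G E F κ) (hι : Transport G E ι) (n : ℤ) {x : K}
    (hx : x ∈ G 0) (h0 : ι n x = 0) : x = 0 := by
  have up : ∀ m, ι m x = 0 → ι (m + 1) x = 0 := fun m hm => by
    rw [← hι.succ _ _ hx, hm, map_zero]
  have down : ∀ m, ι (m + 1) x = 0 → ι m x = 0 := fun m hm => by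
    rw [← hι.succ _ _ hx] at hm
    exact h.E_injective (hι.mem _ _ hx) hm
  have : ∀ m, ι m x = 0 := by
    intro m
    rcases le_total n m with hm | hm
    · induction m, hm using Int.leInduction with
      | base => exact h0
      | succ m _ ih => exact up _ ih
    · induction m, hm using Int.leInductionDown with
      | base => exact h0
      | pred m _ ih => exact down _ (by simpa using ih)
  rw [← hι.zero x]
  exact this 0

/-- Two-sided induction on the integers. -/
lemma int_induction {p : ℤ → Prop} (h0 : p 0) (h1 : ∀ n, p n → p (n + 1))
    (h2 : ∀ n, p (n + 1) → p n) (n : ℤ) : p n := by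
  induction n using Int.induction_on with
  | zero => exact h0
  | succ i hi => exact h1 _ hi
  | pred i hi => exact h2 _ (by simpa using hi)

lemma Model.FE_iota (h : Model T G E F κ) (hι : Transport G E ι) {x : K} (hx : x ∈ G 0) (n : ℤ) :
    F (E (ι n x)) = ι n (F (E x)) - ((n : ℂ) ^ 2 + (κ + 1) * n) • ι n x := by
  have hFE : F (E x) ∈ G 0 := by simpa using h.rep.F_mem _ _ (h.rep.E_mem _ _ hx)
  have step : ∀ n, E (F (E (ι n x))) = F (E (ι (n + 1) x)) +
      (2 * (n + 1 : ℤ) + κ : ℂ) • ι (n + 1) x := fun n => by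
    rw [← h.rep.comm _ _ (hι.mem (n + 1) _ hx), ← hι.succ _ _ hx]
    abel
  induction n using int_induction with
  | h0 => simp [hι.zero]
  | h1 n ih =>
    have h1 := step n
    rw [ih, map_sub, map_smul, hι.succ _ _ hFE, hι.succ _ _ hx] at h1
    push_cast at h1 ⊢
    linear_combination (norm := module) -h1
  | h2 n ih =>
    refine sub_eq_zero.1 (h.E_injective (n := n) ?_ ?_)
    · refine sub_mem ?_ (sub_mem (hι.mem _ _ hFE) (Submodule.smul_mem _ _ (hι.mem _ _ hx)))
      simpa using h.rep.F_mem _ _ (h.rep.E_mem _ _ (hι.mem n _ hx))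
    · have h1 := step n
      rw [map_sub, map_sub, map_smul, hι.succ _ _ hFE, hι.succ _ _ hx]
      rw [hι.succ n _ hx] at h1
      push_cast at h1 ih
      linear_combination (norm := module) h1 + ih

/-- The operator `T⁻¹ E`. -/
lemma Model.exists_B (h : Model T G E F κ) (hι : Transport G E ι) : ∃ B : K →ₗ[ℂ] K,
    (∀ x ∈ G 0, B x ∈ G 0) ∧
    (∀ x ∈ G 0, ∀ n : ℤ, T (ι n (B x) + (n : ℂ) • ι n x) = ι (n + 1) x) ∧
    ∀ x ∈ G 0, B (B x) - (κ + 1 : ℂ) • B x - F (E x) = F (E (B x)) - B (F (E x)) := by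
  obtain ⟨R, hR⟩ := h.exists_inverse (L := (T : K →ₗ[ℂ] K)) h.rep.T_mem
    fun n x hx => h.T_injective hx
  set B := R ∘ₗ E with hB
  have hBm : ∀ n, ∀ x ∈ G n, B x ∈ G n := fun n x hx => (hR n _ (h.rep.E_mem _ _ hx)).1
  have hTB : ∀ n, ∀ x ∈ G n, T (B x) = E x := fun n x hx => (hR n _ (h.rep.E_mem _ _ hx)).2
  have hTi : ∀ n, ∀ x ∈ G n, ∀ y ∈ G n, T x = T y → x = y := fun n x hx y hy hxy =>
    sub_eq_zero.1 (h.T_injective (sub_mem hx hy) (by rw [map_sub, hxy, sub_self]))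
  have hBE : ∀ n, ∀ x ∈ G n, B (E x) = E (B x) + E x := fun n x hx => by
    refine hTi (n + 1) _ (hBm _ _ (h.rep.E_mem _ _ hx)) _
      (add_mem (h.rep.E_mem _ _ (hBm _ _ hx)) (h.rep.E_mem _ _ hx)) ?_
    rw [hTB _ _ (h.rep.E_mem _ _ hx), map_add, ← hTB _ _ hx, h.rep.ET _ _ (hBm _ _ hx)]
  have hBι : ∀ x ∈ G 0, ∀ n : ℤ, B (ι n x) = ι n (B x) + (n : ℂ) • ι n x := by
    intro x hx n
    have hBx := hBm _ _ hx
    have step : ∀ n, B (ι (n + 1) x) = E (B (ι n x)) + ι (n + 1) x := fun n => by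
      rw [← hι.succ _ _ hx, hBE _ _ (hι.mem _ _ hx)]
    induction n using int_induction with
    | h0 => simp [hι.zero]
    | h1 n ih =>
      rw [step, ih, map_add, map_smul, hι.succ _ _ hx, hι.succ _ _ hBx]
      push_cast
      module
    | h2 n ih =>
      refine sub_eq_zero.1 (h.E_injective (n := n) (sub_mem (hBm _ _ (hι.mem _ _ hx))
        (add_mem (hι.mem _ _ hBx) (Submodule.smul_mem _ _ (hι.mem _ _ hx)))) ?_)
      have h1 := step n
      rw [map_sub, map_add, map_smul, hι.succ _ _ hx, hι.succ _ _ hBx]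
      push_cast at ih
      linear_combination (norm := module) ih - h1
  refine ⟨B, hBm 0, fun x hx n => ?_, fun x hx => ?_⟩
  · rw [← hBι x hx, hTB _ _ (hι.mem _ _ hx), hι.succ _ _ hx]
  · have hBx := hBm _ _ hx
    have hFE : F (E x) ∈ G 0 := by simpa using h.rep.F_mem _ _ (h.rep.E_mem _ _ hx)
    have hFB := h.rep.F_mem _ _ hBx
    have e1 : T (F (B x)) = F (E x) + B x := by
      have := h.rep.FT _ _ hBx
      rw [hTB _ _ hx] at this
      rw [this, sub_add_cancel]
    have e2 : B (F (E x) + B x) = E (F (B x)) + (F (E x) + B x) := by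
      refine hTi 0 _ (hBm _ _ (add_mem hFE hBx)) _
        (add_mem (by simpa using h.rep.E_mem _ _ hFB) (add_mem hFE hBx)) ?_
      rw [hTB _ _ (add_mem hFE hBx), map_add T, ← e1, h.rep.ET _ _ hFB]
    have e3 := h.rep.comm _ _ hBx
    rw [map_add] at e2
    push_cast at e3
    linear_combination (norm := module) e2 + e3

end TwoShift

namespace TwoShift

open scoped InnerProductSpace ComplexConjugate
open Filter Topology

variable {K : Type*} [NormedAddCommGroup K] [InnerProductSpace ℂ K] [CompleteSpace K]

variable {T : K →L[ℂ] K} {G : ℤ → Submodule ℂ K} {E F : K →ₗ[ℂ] K} {κ : ℝ}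
variable {ι : ℤ → K →ₗ[ℂ] K} {B : K →ₗ[ℂ] K}

lemma inner_self_eq_ofReal (x : K) : ⟪x, x⟫_ℂ = ((‖x‖ ^ 2 : ℝ) : ℂ) := by
  rw [inner_self_eq_norm_sq_to_K]
  push_cast
  rfl

lemma Model.inner_iota_succ (h : Model T G E F κ) (hι : Transport G E ι) {x y : K} (hx : x ∈ G 0)
    (hy : y ∈ G 0) {g : ℝ} (hg : F (E y) = -(g : ℂ) • y) (n : ℤ) :
    ⟪ι (n + 1) x, ι (n + 1) y⟫_ℂ =
      (((n : ℝ) ^ 2 + (κ + 1) * n + g : ℝ) : ℂ) * ⟪ι n x, ι n y⟫_ℂ := by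
  rw [← hι.succ _ _ hx, h.rep.inner_E _ _ (hι.mem _ _ hx) _ (hι.mem _ _ hy), ← hι.succ _ _ hy,
    h.FE_iota hι hy, hg, map_smul, inner_sub_right, inner_smul_right, inner_smul_right]
  push_cast
  ring

lemma Model.iota_ne_zero (h : Model T G E F κ) (hι : Transport G E ι) (n : ℤ) {x : K}
    (hx : x ∈ G 0) (hx0 : x ≠ 0) : ι n x ≠ 0 := fun h0 => hx0 (h.iota_injective hι n hx h0)

lemma Model.norm_iota_succ (h : Model T G E F κ) (hι : Transport G E ι) {y : K}
    (hy : y ∈ G 0) {g : ℝ} (hg : F (E y) = -(g : ℂ) • y) (n : ℤ) :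
    ‖ι (n + 1) y‖ ^ 2 = ((n : ℝ) ^ 2 + (κ + 1) * n + g) * ‖ι n y‖ ^ 2 := by
  have := h.inner_iota_succ hι hy hy hg n
  rw [inner_self_eq_ofReal, inner_self_eq_ofReal, ← Complex.ofReal_mul] at this
  exact Complex.ofReal_injective this

lemma Model.quadratic_pos (h : Model T G E F κ) (hι : Transport G E ι) {y : K}
    (hy : y ∈ G 0) (hy0 : y ≠ 0) {g : ℝ} (hg : F (E y) = -(g : ℂ) • y) (n : ℤ) :
    0 < (n : ℝ) ^ 2 + (κ + 1) * n + g := by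
  have h1 := h.norm_iota_succ hι hy hg n
  have h2 : 0 < ‖ι (n + 1) y‖ ^ 2 := by
    have := norm_pos_iff.2 (h.iota_ne_zero hι (n + 1) hy hy0)
    positivity
  rw [h1] at h2
  exact pos_of_mul_pos_left h2 (by positivity)

lemma Model.inner_iota_eq_zero (h : Model T G E F κ) (hι : Transport G E ι) {x y : K}
    (hx : x ∈ G 0) (hy : y ∈ G 0) {g : ℝ} (hg : F (E y) = -(g : ℂ) • y)
    (hxy : ⟪x, y⟫_ℂ = 0) (n : ℤ) : ⟪ι n x, ι n y⟫_ℂ = 0 := by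
  rcases eq_or_ne y 0 with rfl | hy0
  · simp
  induction n using int_induction with
  | h0 => simpa [hι.zero] using hxy
  | h1 n ih => rw [h.inner_iota_succ hι hx hy hg, ih, mul_zero]
  | h2 n ih =>
    rw [h.inner_iota_succ hι hx hy hg] at ih
    refine (mul_eq_zero.1 ih).resolve_left ?_
    exact_mod_cast (h.quadratic_pos hι hy hy0 hg n).ne.symm

/-- The relation between `T`, the transport and the operator `B` on degree zero. -/
structure Coupling (T : K →L[ℂ] K) (G : ℤ → Submodule ℂ K) (E F : K →ₗ[ℂ] K) (κ : ℝ)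
    (ι : ℤ → K →ₗ[ℂ] K) (B : K →ₗ[ℂ] K) : Prop where
  mem : ∀ x ∈ G 0, B x ∈ G 0
  shift : ∀ x ∈ G 0, ∀ n : ℤ, T (ι n (B x) + (n : ℂ) • ι n x) = ι (n + 1) x
  quad : ∀ x ∈ G 0, B (B x) - (κ + 1 : ℂ) • B x - F (E x) = F (E (B x)) - B (F (E x))

lemma Coupling.eigen (hB : Coupling T G E F κ ι B) {x : K} (hx : x ∈ G 0) {p : ℂ}
    (hp : B x = p • x) (n : ℤ) : (n + p : ℂ) • T (ι n x) = ι (n + 1) x := by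
  rw [← hB.shift x hx n, hp, ← map_smul]
  congr 1
  rw [map_smul]
  module

lemma Model.eigen_ne_zero (h : Model T G E F κ) (hι : Transport G E ι)
    (hB : Coupling T G E F κ ι B) {x : K} (hx : x ∈ G 0) (hx0 : x ≠ 0) {p : ℂ}
    (hp : B x = p • x) (n : ℤ) : (n + p : ℂ) ≠ 0 := fun h0 =>
  h.iota_ne_zero hι (n + 1) hx hx0 (by rw [← hB.eigen hx hp, h0, zero_smul])

lemma Model.T_iota (h : Model T G E F κ) (hι : Transport G E ι)
    (hB : Coupling T G E F κ ι B) {x : K} (hx : x ∈ G 0) (hx0 : x ≠ 0) {p : ℂ}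
    (hp : B x = p • x) (n : ℤ) : T (ι n x) = (n + p : ℂ)⁻¹ • ι (n + 1) x := by
  rw [eq_inv_smul_iff₀ (h.eigen_ne_zero hι hB hx hx0 hp n), hB.eigen hx hp]

lemma not_smul_of_inner_eq_zero {x y : K} (hy : y ≠ 0) (hxy : ⟪x, y⟫_ℂ = 0) (c : ℂ) :
    y ≠ c • x := by
  intro hc
  apply hy
  rw [← inner_self_eq_zero (𝕜 := ℂ)]
  conv_lhs => rw [hc, inner_smul_left, ← hc, hxy, mul_zero]

/-- Irreducibility excludes a simultaneous orthogonal diagonalisation. -/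
lemma Model.not_diagonal (h : Model T G E F κ) (hι : Transport G E ι)
    (hB : Coupling T G E F κ ι B) {x y : K} (hx : x ∈ G 0) (hy : y ∈ G 0) (hx0 : x ≠ 0)
    (hy0 : y ≠ 0) (hxy : ∀ n, ⟪ι n x, ι n y⟫_ℂ = 0) {p q : ℂ} (hp : B x = p • x)
    (hq : B y = q • y) : False := by
  have key := h.reducing (P := fun n => ℂ ∙ ι n x)
    (fun n => (Submodule.span_singleton_le_iff_mem _ _).2 (hι.mem _ _ hx))
    (fun n z hz => by
      obtain ⟨c, rfl⟩ := Submodule.mem_span_singleton.1 hz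
      rw [map_smul, h.T_iota hι hB hx hx0 hp]
      exact Submodule.smul_mem _ _ (Submodule.smul_mem _ _ (Submodule.mem_span_singleton_self _)))
    (fun n z hz => by
      obtain ⟨c, rfl⟩ := Submodule.mem_span_singleton.1 hz
      rw [map_smul]
      refine Submodule.smul_mem _ _ ?_
      have hyn := h.iota_ne_zero hι (n - 1) hy hy0
      obtain ⟨a, b, hab⟩ := exists_combination (h.finrank_eq_two (n - 1)) (hι.mem _ _ hx)
        (hι.mem _ _ hy) (h.rep.S_mem _ _ (hι.mem n _ hx)) (h.iota_ne_zero hι (n - 1) hx hx0)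
        (not_smul_of_inner_eq_zero hyn (hxy _))
      have h1 : ⟪ι (n - 1) y, star T (ι n x)⟫_ℂ = 0 := by
        rw [star_eq_adjoint, adjoint_inner_right, h.T_iota hι hB hy hy0 hq, sub_add_cancel,
          inner_smul_left, inner_eq_zero_symm.1 (hxy n), mul_zero]
      rw [hab, inner_add_right, inner_smul_right, inner_smul_right,
        inner_eq_zero_symm.1 (hxy (n - 1)), mul_zero, zero_add] at h1
      have hb : b = 0 := (mul_eq_zero.1 h1).resolve_right (by simpa using hyn)
      rw [hab, hb, zero_smul, add_zero]
      exact Submodule.smul_mem _ _ (Submodule.mem_span_singleton_self _))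
  rcases key with h1 | h1
  · have := h1 0
    rw [Submodule.span_singleton_eq_bot] at this
    exact h.iota_ne_zero hι 0 hx hx0 this
  · rw [← h1 0, Submodule.mem_span_singleton] at hy
    obtain ⟨c, hc⟩ := hy
    have h2 := hxy 0
    rw [hι.zero, hι.zero] at h2
    rw [hι.zero] at hc
    exact not_smul_of_inner_eq_zero hy0 h2 c hc.symm

lemma coeff_eq_zero {x y : K} (hx0 : x ≠ 0) (hy0 : y ≠ 0) (hxy : ⟪x, y⟫_ℂ = 0) {u v : ℂ}
    (h : u • x + v • y = 0) : u = 0 ∧ v = 0 := by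
  constructor
  · have := congrArg (fun z => ⟪x, z⟫_ℂ) h
    simpa [inner_add_right, inner_smul_right, hxy, hx0] using this
  · have := congrArg (fun z => ⟪y, z⟫_ℂ) h
    simpa [inner_add_right, inner_smul_right, inner_eq_zero_symm.1 hxy, hy0] using this

lemma floor_eq_of_pos {p q : ℝ} (h : ∀ n : ℤ, 0 < (n + p) * (n + q)) : ⌊p⌋ = ⌊q⌋ := by
  have aux : ∀ p q : ℝ, (∀ n : ℤ, 0 < (n + p) * (n + q)) → ⌊q⌋ ≤ ⌊p⌋ := by
    intro p q h
    by_contra! hlt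
    have h1 := h (-⌊q⌋)
    push_cast at h1
    have h2 := Int.floor_le q
    have h3 := Int.lt_floor_add_one p
    have h4 : (⌊p⌋ : ℝ) + 1 ≤ ⌊q⌋ := by exact_mod_cast hlt
    nlinarith
  exact le_antisymm (aux q p fun n => by rw [mul_comm]; exact h n) (aux p q h)

lemma Coupling.coeffs (hB : Coupling T G E F κ ι B) {x y : K} (hx : x ∈ G 0)
    (hx0 : x ≠ 0) (hy0 : y ≠ 0) (hxy : ⟪x, y⟫_ℂ = 0) {g₁ g₂ : ℝ}
    (h₁ : F (E x) = -(g₁ : ℂ) • x) (h₂ : F (E y) = -(g₂ : ℂ) • y) {a b c d : ℂ}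
    (hBx : B x = a • x + c • y) (hBy : B y = b • x + d • y) :
    a ^ 2 + b * c - (κ + 1) * a + g₁ = 0 ∧ c * (a + d - (κ + 1) + g₂ - g₁) = 0 := by
  have h1 := hB.quad x hx
  rw [h₁, hBx, map_add, map_smul, map_smul, hBx, hBy, map_add, map_smul, map_smul, map_add,
    map_smul, map_smul, h₁, h₂, map_smul, hBx] at h1
  refine coeff_eq_zero hx0 hy0 hxy ?_
  linear_combination (norm := module) h1

lemma Model.not_triangular (h : Model T G E F κ) (hι : Transport G E ι)
    (hB : Coupling T G E F κ ι B) {x y : K} (hx : x ∈ G 0) (hy : y ∈ G 0)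
    (hx0 : x ≠ 0) (hy0 : y ≠ 0) (hxy : ⟪x, y⟫_ℂ = 0) {g₁ g₂ : ℝ} (hg : g₁ ≠ g₂)
    (h₁ : F (E x) = -(g₁ : ℂ) • x) (h₂ : F (E y) = -(g₂ : ℂ) • y) {a b d : ℂ} (hb : b ≠ 0)
    (hBx : B x = a • x) (hBy : B y = b • x + d • y) : False := by
  have hgc : (g₂ : ℂ) - g₁ ≠ 0 := by
    rw [sub_ne_zero]
    exact_mod_cast hg.symm
  have e1 := (hB.coeffs hx hx0 hy0 hxy h₁ h₂ (a := a) (c := 0) (by rw [hBx]; simp) hBy).1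
  obtain ⟨e2, e3⟩ := hB.coeffs (a := d) (c := b) (b := 0) (d := a) hy hy0 hx0
    (inner_eq_zero_symm.1 hxy) h₂ h₁ (by rw [hBy]; abel) (by rw [hBx]; simp)
  have e4 := (mul_eq_zero.1 e3).resolve_left hb
  have e5 : a - ((κ + 1 + g₂ - g₁ + 1) / 2 : ℝ) = 0 := by
    have : (2 * ((g₂ : ℂ) - g₁)) * (a - ((κ + 1 + g₂ - g₁ + 1) / 2 : ℝ)) = 0 := by
      have hd : d = κ + 1 + g₂ - g₁ - a := by linear_combination e4
      subst hd
      push_cast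
      linear_combination e1 - e2
    exact (mul_eq_zero.1 this).resolve_left (mul_ne_zero two_ne_zero hgc)
  set r : ℝ := (κ + 1 + g₂ - g₁ + 1) / 2 with hr
  have ha : a = r := sub_eq_zero.1 e5
  rw [ha] at e1
  have e6 : r ^ 2 - (κ + 1) * r + g₁ = 0 := by
    rw [mul_zero, add_zero] at e1
    exact_mod_cast e1
  have f1 : ⌊r⌋ = ⌊κ + 1 - r⌋ := floor_eq_of_pos fun n => by
    have := h.quadratic_pos hι hx hx0 h₁ n
    nlinarith
  have f2 : ⌊r - 1⌋ = ⌊κ + 1 - r + 1⌋ := floor_eq_of_pos fun n => by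
    have := h.quadratic_pos hι hy hy0 h₂ n
    have h3 : g₂ = 2 * r - (κ + 1) - 1 + g₁ := by rw [hr]; ring
    nlinarith
  rw [Int.floor_sub_one, Int.floor_add_one] at f2
  omega

/-- In degree zero, `F E` is a scalar. -/
lemma Model.exists_scalar (h : Model T G E F κ) (hι : Transport G E ι)
    (hB : Coupling T G E F κ ι B) : ∃ (x y : K) (g : ℝ), x ∈ G 0 ∧ y ∈ G 0 ∧ ‖x‖ = 1 ∧ ‖y‖ = 1 ∧
      ⟪x, y⟫_ℂ = 0 ∧ (∀ z ∈ G 0, z = ⟪x, z⟫_ℂ • x + ⟪y, z⟫_ℂ • y) ∧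
      ∀ z ∈ G 0, F (E z) = -(g : ℂ) • z := by
  have hfd := h.fin 0
  have hM : ∀ x ∈ G 0, (-(F ∘ₗ E)) x ∈ G 0 := fun x hx =>
    neg_mem (by simpa using h.rep.F_mem _ _ (h.rep.E_mem _ _ hx))
  let f : G 0 →ₗ[ℂ] G 0 := (-(F ∘ₗ E)).restrict hM
  have hE : ∀ x ∈ G 0, ∀ y ∈ G 0, ⟪E x, E y⟫_ℂ = ⟪x, -(F (E y))⟫_ℂ := fun x hx y hy => by
    rw [h.rep.inner_E 0 x hx _ (h.rep.E_mem _ _ hy), inner_neg_right]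
  have hf : f.IsSymmetric := by
    rintro ⟨x, hx⟩ ⟨y, hy⟩
    change ⟪-(F (E x)), y⟫_ℂ = ⟪x, -(F (E y))⟫_ℂ
    rw [← hE x hx y hy, ← inner_conj_symm, ← hE y hy x hx, inner_conj_symm]
  have h2 := h.finrank_eq_two 0
  let b := hf.eigenvectorBasis h2
  have hb : ∀ i, F (E (b i : K)) = -((hf.eigenvalues h2 i : ℝ) : ℂ) • (b i : K) := fun i => by
    have h1 : -(F (E (b i : K))) = ((hf.eigenvalues h2 i : ℝ) : ℂ) • (b i : K) :=
      congrArg (Submodule.subtype (G 0)) (hf.apply_eigenvectorBasis h2 i)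
    rw [neg_smul, ← h1, neg_neg]
  set x : K := ((b 0 : G 0) : K) with hxdef
  set y : K := ((b 1 : G 0) : K) with hydef
  have hx : x ∈ G 0 := (b 0).2
  have hy : y ∈ G 0 := (b 1).2
  have hx1 : ‖x‖ = 1 := b.norm_eq_one 0
  have hy1 : ‖y‖ = 1 := b.norm_eq_one 1
  have hx0 : x ≠ 0 := norm_ne_zero_iff.1 (by rw [hx1]; exact one_ne_zero)
  have hy0 : y ≠ 0 := norm_ne_zero_iff.1 (by rw [hy1]; exact one_ne_zero)
  have hxy : ⟪x, y⟫_ℂ = 0 := b.inner_eq_zero (by decide)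
  have hz : ∀ z ∈ G 0, z = ⟪x, z⟫_ℂ • x + ⟪y, z⟫_ℂ • y := fun z hz => by
    have := congrArg (Submodule.subtype (G 0)) (b.sum_repr' ⟨z, hz⟩)
    rw [Fin.sum_univ_two] at this
    exact this.symm
  have h₁ := hb 0
  have h₂ := hb 1
  rw [← hxdef] at h₁
  rw [← hydef] at h₂
  generalize hf.eigenvalues h2 0 = g₁ at h₁
  generalize hf.eigenvalues h2 1 = g₂ at h₂
  refine ⟨x, y, g₁, hx, hy, hx1, hy1, hxy, hz, ?_⟩
  by_cases hg : g₁ = g₂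
  · subst hg
    intro z hzm
    rw [hz z hzm, map_add, map_add, map_smul, map_smul, map_smul, map_smul, h₁, h₂]
    module
  exfalso
  have hBx := hz _ (hB.mem x hx)
  have hBy := hz _ (hB.mem y hy)
  set a := ⟪x, B x⟫_ℂ
  set c := ⟪y, B x⟫_ℂ
  set b' := ⟪x, B y⟫_ℂ
  set d := ⟪y, B y⟫_ℂ
  have e1 := (hB.coeffs hx hx0 hy0 hxy h₁ h₂ hBx hBy).2
  have e2 := (hB.coeffs hy hy0 hx0 (inner_eq_zero_symm.1 hxy) h₂ h₁ (hBy.trans (add_comm _ _))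
    (hBx.trans (add_comm _ _))).2
  by_cases hc : c = 0
  · rw [hc, zero_smul, add_zero] at hBx
    by_cases hb' : b' = 0
    · rw [hb', zero_smul, zero_add] at hBy
      exact h.not_diagonal hι hB hx hy hx0 hy0 (h.inner_iota_eq_zero hι hx hy h₂ hxy) hBx hBy
    · exact h.not_triangular hι hB hx hy hx0 hy0 hxy hg h₁ h₂ hb' hBx hBy
  · by_cases hb' : b' = 0
    · rw [hb', zero_smul, zero_add] at hBy
      exact h.not_triangular hι hB hy hx hy0 hx0 (inner_eq_zero_symm.1 hxy) (Ne.symm hg) h₂ h₁ hc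
        hBy (hBx.trans (add_comm _ _))
    · have e3 := (mul_eq_zero.1 e1).resolve_left hc
      have e4 := (mul_eq_zero.1 e2).resolve_left hb'
      have e5 : (g₁ : ℂ) = g₂ := by linear_combination (e4 - e3) / 2
      exact hg (by exact_mod_cast e5)

/-- A unit vector orthogonal to a given one in a plane. -/
lemma exists_orthogonal_unit {M : Submodule ℂ K} {x y z : K} (hx : x ∈ M) (hy : y ∈ M)
    (hx1 : ‖x‖ = 1) (hy1 : ‖y‖ = 1) (hxy : ⟪x, y⟫_ℂ = 0) (hz1 : ‖z‖ = 1)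
    (hz : z = ⟪x, z⟫_ℂ • x + ⟪y, z⟫_ℂ • y) : ∃ w ∈ M, ‖w‖ = 1 ∧ ⟪z, w⟫_ℂ = 0 := by
  set u := ⟪x, z⟫_ℂ
  set v := ⟪y, z⟫_ℂ
  have hxx : ⟪x, x⟫_ℂ = 1 := by rw [inner_self_eq_norm_sq_to_K, hx1]; simp
  have hyy : ⟪y, y⟫_ℂ = 1 := by rw [inner_self_eq_norm_sq_to_K, hy1]; simp
  have hyx := inner_eq_zero_symm.1 hxy
  have h1 : ⟪z, z⟫_ℂ = 1 := by rw [inner_self_eq_norm_sq_to_K, hz1]; simp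
  have h2 : conj u * u + conj v * v = 1 := by
    rw [← h1, hz]
    simp only [inner_add_left, inner_add_right, inner_smul_left, inner_smul_right, hxx, hyy, hxy,
      hyx]
    ring
  refine ⟨-conj v • x + conj u • y, add_mem (M.smul_mem _ hx) (M.smul_mem _ hy), ?_, ?_⟩
  · have h3 : ⟪-conj v • x + conj u • y, -conj v • x + conj u • y⟫_ℂ = 1 := by
      simp only [inner_add_left, inner_add_right, inner_smul_left, inner_smul_right, hxx, hyy,
        hxy, hyx, map_neg, Complex.conj_conj]
      linear_combination h2
    rw [inner_self_eq_ofReal] at h3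
    have h4 : ‖-conj v • x + conj u • y‖ ^ 2 = 1 := by exact_mod_cast h3
    exact (pow_eq_one_iff_of_nonneg (norm_nonneg _) two_ne_zero).1 h4
  · rw [hz]
    simp only [inner_add_left, inner_add_right, inner_smul_left, inner_smul_right, hxx, hyy, hxy,
      hyx]
    ring

end TwoShift

namespace TwoShift

open scoped InnerProductSpace ComplexConjugate
open Filter Topology

variable {K : Type*} [NormedAddCommGroup K] [InnerProductSpace ℂ K] [CompleteSpace K]

variable {T : K →L[ℂ] K} {G : ℤ → Submodule ℂ K} {E F : K →ₗ[ℂ] K} {κ : ℝ}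
variable {ι : ℤ → K →ₗ[ℂ] K} {B : K →ₗ[ℂ] K}

/-- Two mutually orthogonal orthonormal sequences which are jointly total. -/
structure IsFrame (f₁ f₂ : ℤ → K) : Prop where
  left : Orthonormal ℂ f₁
  right : Orthonormal ℂ f₂
  orth : ∀ m n, ⟪f₁ m, f₂ n⟫_ℂ = 0
  total : ∀ x, (∀ n, ⟪f₁ n, x⟫_ℂ = 0) → (∀ n, ⟪f₂ n, x⟫_ℂ = 0) → x = 0

/-- `T` is a two-shift with explicit weights, for every factorisation of a positive quadratic. -/
def HasNormalForm (T : K →L[ℂ] K) (k γ : ℝ) : Prop :=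
  (∀ n : ℤ, 0 < (n : ℝ) ^ 2 + k * n + γ) ∧
  ∀ (p q c : ℂ) (ω : ℤ → ℂ), p + q = k → p * q = γ → ‖c‖ = 1 →
    (∀ n : ℤ, ‖ω n‖ ^ 2 = (n : ℝ) ^ 2 + k * n + γ) →
    ∃ (f₁ f₂ : ℤ → K) (t : ℝ), 0 < t ∧ IsFrame f₁ f₂ ∧
      (∀ n : ℤ, T (f₁ n) = (ω n / (n + p)) • f₁ (n + 1)) ∧
      ∀ n : ℤ, T (f₂ n) = (ω n / (n + q)) • f₂ (n + 1) +
        (-(t * c) * (ω n / ((n + p) * (n + q)))) • f₁ (n + 1)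

lemma IsFrame.comp_add {f₁ f₂ : ℤ → K} (h : IsFrame f₁ f₂) (m : ℤ) :
    IsFrame (fun n => f₁ (n + m)) fun n => f₂ (n + m) where
  left := h.left.comp _ (add_left_injective m)
  right := h.right.comp _ (add_left_injective m)
  orth _ _ := h.orth _ _
  total x h1 h2 := h.total x (fun n => by simpa using h1 (n - m)) fun n => by
    simpa using h2 (n - m)

lemma HasNormalForm.shift {k γ : ℝ} (h : HasNormalForm T k γ) (m : ℤ) :
    HasNormalForm T (k + 2 * m) ((m : ℝ) ^ 2 + k * m + γ) := by
  refine ⟨fun n => ?_, fun p q c ω hpq hpq' hc hω => ?_⟩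
  · have := h.1 (n + m)
    push_cast at this
    linarith
  · push_cast at hpq hpq'
    obtain ⟨f₁, f₂, t, ht, hf, h1, h2⟩ := h.2 (p - m) (q - m) c (fun n => ω (n - m))
      (by linear_combination hpq) (by linear_combination hpq' - m * hpq) hc (fun n => by
        rw [hω]
        push_cast
        ring)
    refine ⟨_, _, t, ht, hf.comp_add m, fun n => ?_, fun n => ?_⟩
    · have := h1 (n + m)
      rw [add_sub_cancel_right] at this
      rw [this, show n + 1 + m = n + m + 1 by ring]
      congr 2
      push_cast
      ring
    · have := h2 (n + m)
      rw [add_sub_cancel_right] at this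
      rw [this, show n + 1 + m = n + m + 1 by ring]
      congr 3 <;> push_cast <;> ring

lemma exists_product (ω : ℤ → ℂ) (hω : ∀ n, ω n ≠ 0) :
    ∃ Ω : ℤ → ℂ, Ω 0 = 1 ∧ (∀ n, Ω (n + 1) = ω n * Ω n) ∧ ∀ n, Ω n ≠ 0 := by
  let Ω : ℤ → ℂ := fun n => match n with
    | Int.ofNat k => ∏ i ∈ Finset.range k, ω i
    | Int.negSucc k => (∏ i ∈ Finset.range (k + 1), ω (-(i + 1 : ℕ)))⁻¹
  have h0 : Ω 0 = 1 := by
    change ∏ i ∈ Finset.range 0, ω i = 1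
    simp
  have h1 : ∀ n, Ω (n + 1) = ω n * Ω n := by
    rintro (k | k)
    · change ∏ i ∈ Finset.range (k + 1), ω i = ω k * ∏ i ∈ Finset.range k, ω i
      rw [Finset.prod_range_succ, mul_comm]
    · have h2 : ω (Int.negSucc k) * Ω (Int.negSucc k) =
          (∏ i ∈ Finset.range k, ω (-(i + 1 : ℕ)))⁻¹ := by
        change ω (Int.negSucc k) * (∏ i ∈ Finset.range (k + 1), ω (-(i + 1 : ℕ)))⁻¹ = _
        rw [Finset.prod_range_succ, mul_inv, mul_comm, mul_assoc, Int.negSucc_eq]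
        push_cast
        have := hω (-((k : ℤ) + 1))
        rw [inv_mul_cancel₀ this, mul_one]
      rw [h2]
      cases k with
      | zero => simpa using h0
      | succ k => rfl
  refine ⟨Ω, h0, h1, fun n => ?_⟩
  induction n using int_induction with
  | h0 => rw [h0]; exact one_ne_zero
  | h1 n ih => rw [h1]; exact mul_ne_zero (hω n) ih
  | h2 n ih => rw [h1] at ih; exact right_ne_zero_of_mul ih

/-- An upper triangular form of `B` in an orthonormal basis of degree zero. -/
lemma Model.exists_triangular (h : Model T G E F κ) (hι : Transport G E ι)
    (hB : Coupling T G E F κ ι B) {g : ℝ} (hg : ∀ z ∈ G 0, F (E z) = -(g : ℂ) • z)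
    {x y : K} (hx : x ∈ G 0) (hy : y ∈ G 0) (hx1 : ‖x‖ = 1) (hy1 : ‖y‖ = 1) (hxy : ⟪x, y⟫_ℂ = 0)
    (hz : ∀ z ∈ G 0, z = ⟪x, z⟫_ℂ • x + ⟪y, z⟫_ℂ • y) {p q c : ℂ} (hpq : p + q = (κ + 1 : ℝ))
    (hpq' : p * q = g) (hc : ‖c‖ = 1) :
    ∃ (z w : K) (t : ℝ), 0 < t ∧ z ∈ G 0 ∧ w ∈ G 0 ∧ ‖z‖ = 1 ∧ ‖w‖ = 1 ∧ ⟪z, w⟫_ℂ = 0 ∧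
      B z = p • z ∧ B w = (t * c) • z + q • w := by
  push_cast at hpq
  have hx0 : x ≠ 0 := norm_ne_zero_iff.1 (by rw [hx1]; exact one_ne_zero)
  have hy0 : y ≠ 0 := norm_ne_zero_iff.1 (by rw [hy1]; exact one_ne_zero)
  have hquad : ∀ z ∈ G 0, B (B z) - (p + q) • B z + (p * q) • z = 0 := fun z hzm => by
    have := hB.quad z hzm
    rw [hg z hzm, hg _ (hB.mem z hzm), map_smul] at this
    rw [hpq, hpq']
    linear_combination (norm := module) this
  obtain ⟨y', hy', hne⟩ : ∃ y' ∈ G 0, B y' - q • y' ≠ 0 := by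
    by_contra! hcon
    exact h.not_diagonal hι hB hx hy hx0 hy0 (h.inner_iota_eq_zero hι hx hy (hg y hy) hxy)
      (sub_eq_zero.1 (hcon x hx)) (sub_eq_zero.1 (hcon y hy))
  set v := B y' - q • y' with hv
  have hvm : v ∈ G 0 := sub_mem (hB.mem _ hy') (Submodule.smul_mem _ _ hy')
  have hBv : B v = p • v := by
    have := hquad y' hy'
    rw [hv, map_sub, map_smul]
    linear_combination (norm := module) this
  set z := ((‖v‖ : ℝ) : ℂ)⁻¹ • v with hzdef
  have hzm : z ∈ G 0 := Submodule.smul_mem _ _ hvm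
  have hz1 : ‖z‖ = 1 := by
    rw [hzdef, norm_smul, norm_inv, Complex.norm_real, norm_norm,
      inv_mul_cancel₀ (norm_ne_zero_iff.2 hne)]
  have hz0 : z ≠ 0 := norm_ne_zero_iff.1 (by rw [hz1]; exact one_ne_zero)
  have hBz : B z = p • z := by rw [hzdef, map_smul, hBv, smul_comm]
  obtain ⟨w, hwm, hw1, hzw⟩ := exists_orthogonal_unit hx hy hx1 hy1 hxy hz1 (hz z hzm)
  have hw0 : w ≠ 0 := norm_ne_zero_iff.1 (by rw [hw1]; exact one_ne_zero)
  obtain ⟨α, d, hαd⟩ := exists_combination (h.finrank_eq_two 0) hzm hwm (hB.mem w hwm) hz0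
    (not_smul_of_inner_eq_zero hw0 hzw)
  have hα : α ≠ 0 := fun hα => by
    rw [hα, zero_smul, zero_add] at hαd
    exact h.not_diagonal hι hB hzm hwm hz0 hw0 (h.inner_iota_eq_zero hι hzm hwm (hg w hwm) hzw)
      hBz hαd
  have h1 := hquad w hwm
  rw [hαd, map_add, map_smul B α z, map_smul B d w, hBz, hαd] at h1
  have h2 := (coeff_eq_zero hz0 hw0 hzw (u := α * (d - q)) (v := (d - p) * (d - q)) (by
    linear_combination (norm := module) h1)).1
  have hd : d = q := sub_eq_zero.1 ((mul_eq_zero.1 h2).resolve_left hα)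
  rw [hd] at hαd
  obtain ⟨u, hu1, hu⟩ := exists_phase_factor α
  refine ⟨z, (u * c) • w, ‖α‖, norm_pos_iff.2 hα, hzm, Submodule.smul_mem _ _ hwm, hz1, ?_, ?_, hBz,
    ?_⟩
  · rw [norm_smul, norm_mul, hu1, hc, hw1]; norm_num
  · rw [inner_smul_right, hzw, mul_zero]
  · rw [map_smul, hαd, ← hu]
    module

lemma Model.exists_normalForm (h : Model T G E F κ) : ∃ k γ : ℝ, HasNormalForm T k γ := by
  obtain ⟨ι, hι⟩ := h.exists_transport
  obtain ⟨B, hB1, hB2, hB3⟩ := h.exists_B hι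
  have hB : Coupling T G E F κ ι B := ⟨hB1, hB2, hB3⟩
  obtain ⟨x, y, g, hx, hy, hx1, hy1, hxy, hz, hg⟩ := h.exists_scalar hι hB
  have hx0 : x ≠ 0 := norm_ne_zero_iff.1 (by rw [hx1]; exact one_ne_zero)
  refine ⟨κ + 1, g, fun n => h.quadratic_pos hι hx hx0 (hg x hx) n,
    fun p q c ω hpq hpq' hc hω => ?_⟩
  obtain ⟨z, w, t, ht, hzm, hwm, hz1, hw1, hzw, hBz, hBw⟩ :=
    h.exists_triangular hι hB hg hx hy hx1 hy1 hxy hz hpq hpq' hc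
  have hz0 : z ≠ 0 := norm_ne_zero_iff.1 (by rw [hz1]; exact one_ne_zero)
  have hw0 : w ≠ 0 := norm_ne_zero_iff.1 (by rw [hw1]; exact one_ne_zero)
  have hpos := fun n : ℤ => h.quadratic_pos hι hx hx0 (hg x hx) n
  have hω0 : ∀ n, ω n ≠ 0 := fun n h0 => by
    have := hω n
    rw [h0, norm_zero, zero_pow two_ne_zero] at this
    exact (hpos n).ne this
  obtain ⟨Ω, hΩ0, hΩ1, hΩ⟩ := exists_product ω hω0
  have hnorm : ∀ v ∈ G 0, ∀ n, ‖ι n v‖ = ‖Ω n‖ * ‖v‖ := by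
    intro v hv n
    have hsq : ∀ n, ‖ι (n + 1) v‖ = ‖ω n‖ * ‖ι n v‖ := fun n => by
      have := h.norm_iota_succ hι hv (hg v hv) n
      rw [← hω, ← mul_pow] at this
      exact (pow_left_inj₀ (norm_nonneg _) (by positivity) two_ne_zero).1 this
    induction n using int_induction with
    | h0 => rw [hι.zero, hΩ0, norm_one, one_mul]
    | h1 n ih => rw [hsq, ih, hΩ1, norm_mul, mul_assoc]
    | h2 n ih =>
      rw [hsq, hΩ1, norm_mul, mul_assoc] at ih
      exact mul_left_cancel₀ (norm_ne_zero_iff.2 (hω0 n)) ih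
  set f : K → ℤ → K := fun v n => (Ω n)⁻¹ • ι n v with hf
  have hfm : ∀ v ∈ G 0, ∀ n, f v n ∈ G n := fun v hv n => Submodule.smul_mem _ _ (hι.mem _ _ hv)
  have hf1 : ∀ v ∈ G 0, ‖v‖ = 1 → Orthonormal ℂ (f v) := fun v hv hv1 =>
    ⟨fun n => by rw [hf]; simp only [norm_smul, norm_inv]; rw [hnorm v hv, hv1, mul_one,
        inv_mul_cancel₀ (norm_ne_zero_iff.2 (hΩ n))],
      fun m n hmn => h.grading.orth m n hmn _ (hfm v hv m) _ (hfm v hv n)⟩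
  have hzwι : ∀ n, ⟪ι n z, ι n w⟫_ℂ = 0 := h.inner_iota_eq_zero hι hzm hwm (hg w hwm) hzw
  have hsucc : ∀ v n, (Ω n)⁻¹ • ι (n + 1) v = ω n • f v (n + 1) := fun v n => by
    change _ = ω n • (Ω (n + 1))⁻¹ • ι (n + 1) v
    rw [smul_smul, hΩ1, mul_inv, mul_inv_cancel_left₀ (hω0 n)]
  have hnp := fun n => h.eigen_ne_zero hι hB hzm hz0 hBz n
  have hnpq : ∀ n : ℤ, ((n : ℂ) + p) * (n + q) = (((n : ℝ) ^ 2 + (κ + 1) * n + g : ℝ) : ℂ) := by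
    intro n
    push_cast at hpq ⊢
    linear_combination (n : ℂ) * hpq + hpq'
  have hnq : ∀ n : ℤ, (n : ℂ) + q ≠ 0 := fun n h0 => by
    have := hnpq n
    rw [h0, mul_zero] at this
    exact (hpos n).ne (by exact_mod_cast this)
  have hTz := h.T_iota hι hB hzm hz0 hBz
  refine ⟨f z, f w, t, ht, ⟨hf1 z hzm hz1, hf1 w hwm hw1, fun m n => ?_, fun v h1 h2 => ?_⟩,
    fun n => ?_, fun n => ?_⟩
  · by_cases hmn : m = n
    · subst hmn
      rw [hf]
      simp only [inner_smul_left, inner_smul_right]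
      rw [hzwι, mul_zero, mul_zero]
    · exact h.grading.orth m n hmn _ (hfm z hzm m) _ (hfm w hwm n)
  · refine h.grading.eq_zero_of_inner fun n u hu => inner_eq_zero_symm.1 ?_
    have hwn := h.iota_ne_zero hι n hwm hw0
    obtain ⟨a, b, hab⟩ := exists_combination (h.finrank_eq_two n) (hι.mem n _ hzm)
      (hι.mem n _ hwm) hu (h.iota_ne_zero hι n hzm hz0) (not_smul_of_inner_eq_zero hwn (hzwι n))
    have hstrip : ∀ v', ⟪f v' n, v⟫_ℂ = 0 → ⟪ι n v', v⟫_ℂ = 0 := fun v' h' => by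
      change ⟪(Ω n)⁻¹ • ι n v', v⟫_ℂ = 0 at h'
      rw [inner_smul_left] at h'
      exact (mul_eq_zero.1 h').resolve_left (by simpa using hΩ n)
    rw [hab, inner_add_left, inner_smul_left, inner_smul_left, hstrip z (h1 n),
      hstrip w (h2 n)]
    ring
  · change T ((Ω n)⁻¹ • ι n z) = _
    rw [map_smul, hTz, smul_comm, hsucc, smul_smul]
    congr 1
    ring
  · change T ((Ω n)⁻¹ • ι n w) = _
    have e1 := hB.shift w hwm n
    simp only [hBw, map_add, map_smul, hTz] at e1
    have e2 : T (ι n w) = (n + q : ℂ)⁻¹ • ι (n + 1) w -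
        (t * c * ((n + p) * (n + q) : ℂ)⁻¹) • ι (n + 1) z := by
      rw [← e1]
      have := hnq n
      match_scalars <;> field_simp <;> ring
    rw [map_smul, e2, smul_sub, smul_comm, hsucc, smul_comm (Ω n)⁻¹, hsucc]
    match_scalars <;> ring

end TwoShift

namespace TwoShift

open scoped InnerProductSpace ComplexConjugate
open Filter Topology

variable {K : Type*} [NormedAddCommGroup K] [InnerProductSpace ℂ K] [CompleteSpace K]

variable {T : K →L[ℂ] K}

lemma hasSum_e (x : H) : HasSum (fun n => x n • e n) x := by
  convert lp.hasSum_single (E := fun _ : ℤ => ℂ) (p := 2) (by norm_num) x using 2 with n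
  rw [e, ← lp.single_smul, smul_eq_mul, mul_one]

lemma ext_e {F : Type*} [NormedAddCommGroup F] [NormedSpace ℂ F] {a b : H →L[ℂ] F}
    (h : ∀ n, a (e n) = b (e n)) : a = b := by
  ext x
  have h1 := (hasSum_e x).mapL a
  have h2 := (hasSum_e x).mapL b
  simp only [map_smul, h] at h1 h2
  exact h1.unique h2

lemma exists_isometry_of_orthonormal {f : ℤ → K} (hf : Orthonormal ℂ f) :
    ∃ J : H →ₗᵢ[ℂ] K, ∀ n, J (e n) = f n := by
  refine ⟨hf.orthogonalFamily.linearIsometry, fun n => ?_⟩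
  rw [e, OrthogonalFamily.linearIsometry_apply_single]
  simp

lemma inner_isometry_left {J : H →ₗᵢ[ℂ] K} {y : K} (h : ∀ n, ⟪y, J (e n)⟫_ℂ = 0) (u : H) :
    ⟪y, J u⟫_ℂ = 0 := by
  have : (innerSL ℂ y) ∘L J.toContinuousLinearMap = 0 := ext_e fun n => by simpa using h n
  simpa using DFunLike.congr_fun this u

lemma IsFrame.unitarilyEquiv {f₁ f₂ : ℤ → K} (hf : IsFrame f₁ f₂) {w₁ w₂ s : ℤ → ℂ}
    (h₁ : ∀ n, T (f₁ n) = w₁ n • f₁ (n + 1))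
    (h₂ : ∀ n, T (f₂ n) = w₂ n • f₂ (n + 1) + s n • f₁ (n + 1)) :
    ∃ T₁ S T₂ : H →L[ℂ] H, (∀ n, T₁ (e n) = w₁ n • e (n + 1)) ∧
      (∀ n, S (e n) = s n • e (n + 1)) ∧ (∀ n, T₂ (e n) = w₂ n • e (n + 1)) ∧
      UnitarilyEquiv T (blockOp T₁ S T₂) := by
  obtain ⟨J₁, hJ₁⟩ := exists_isometry_of_orthonormal hf.left
  obtain ⟨J₂, hJ₂⟩ := exists_isometry_of_orthonormal hf.right
  have horth : ∀ u v, ⟪J₁ u, J₂ v⟫_ℂ = 0 := fun u v =>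
    inner_isometry_left (fun n => inner_eq_zero_symm.1 (inner_isometry_left (fun m => by
      rw [hJ₁, hJ₂]; exact inner_eq_zero_symm.1 (hf.orth m n)) u)) v
  set j₁ := J₁.toContinuousLinearMap with hj₁
  set j₂ := J₂.toContinuousLinearMap with hj₂
  have a₁₁ : ∀ u, adjoint j₁ (J₁ u) = u := fun u => ext_inner_left ℂ fun v => by
    rw [adjoint_inner_right]; exact J₁.inner_map_map _ _
  have a₂₂ : ∀ u, adjoint j₂ (J₂ u) = u := fun u => ext_inner_left ℂ fun v => by
    rw [adjoint_inner_right]; exact J₂.inner_map_map _ _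
  have a₁₂ : ∀ u, adjoint j₁ (J₂ u) = 0 := fun u => ext_inner_left ℂ fun v => by
    rw [adjoint_inner_right, inner_zero_right]; exact horth _ _
  have a₂₁ : ∀ u, adjoint j₂ (J₁ u) = 0 := fun u => ext_inner_left ℂ fun v => by
    rw [adjoint_inner_right, inner_zero_right]; exact inner_eq_zero_symm.1 (horth _ _)
  set T₁ := adjoint j₁ ∘L T ∘L j₁ with hT₁
  set S := adjoint j₁ ∘L T ∘L j₂ with hS
  set T₂ := adjoint j₂ ∘L T ∘L j₂ with hT₂
  have e₁ : ∀ n, T₁ (e n) = w₁ n • e (n + 1) := fun n => by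
    change adjoint j₁ (T (J₁ (e n))) = _
    rw [hJ₁, h₁, map_smul, ← hJ₁, a₁₁]
  have e₂ : ∀ n, S (e n) = s n • e (n + 1) := fun n => by
    change adjoint j₁ (T (J₂ (e n))) = _
    rw [hJ₂, h₂, map_add, map_smul, map_smul, ← hJ₁, ← hJ₂, a₁₁, a₁₂, smul_zero, zero_add]
  have e₃ : ∀ n, T₂ (e n) = w₂ n • e (n + 1) := fun n => by
    change adjoint j₂ (T (J₂ (e n))) = _
    rw [hJ₂, h₂, map_add, map_smul, map_smul, ← hJ₁, ← hJ₂, a₂₂, a₂₁, smul_zero, add_zero]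
  have c₁ : ∀ u, T (J₁ u) = J₁ (T₁ u) := by
    have : T ∘L j₁ = j₁ ∘L T₁ := ext_e fun n => by
      change T (J₁ (e n)) = J₁ (T₁ (e n))
      rw [e₁, map_smul, hJ₁, hJ₁, h₁]
    exact fun u => DFunLike.congr_fun this u
  have c₂ : ∀ u, T (J₂ u) = J₂ (T₂ u) + J₁ (S u) := by
    have : T ∘L j₂ = j₂ ∘L T₂ + j₁ ∘L S := ext_e fun n => by
      change T (J₂ (e n)) = J₂ (T₂ (e n)) + J₁ (S (e n))
      rw [e₂, e₃, map_smul, map_smul, hJ₂, hJ₂, hJ₁, h₂]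
    exact fun u => DFunLike.congr_fun this u
  let W₀ : WithLp 2 (H × H) →ₗ[ℂ] K :=
    { toFun := fun x => J₁ x.fst + J₂ x.snd
      map_add' := fun x y => by
        simp only [WithLp.add_fst, WithLp.add_snd, map_add]; abel
      map_smul' := fun c x => by
        simp only [WithLp.smul_fst, WithLp.smul_snd, map_smul, smul_add, RingHom.id_apply] }
  let W : WithLp 2 (H × H) →ₗᵢ[ℂ] K := ⟨W₀, fun x => by
    change ‖J₁ x.fst + J₂ x.snd‖ = ‖x‖
    rw [← sq_eq_sq₀ (norm_nonneg _) (norm_nonneg _), WithLp.prod_norm_sq_eq_of_L2, sq, sq, sq,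
      norm_add_sq_eq_norm_sq_add_norm_sq_of_inner_eq_zero _ _ (horth _ _), J₁.norm_map,
      J₂.norm_map]⟩
  have hW : ∀ x, W x = J₁ x.fst + J₂ x.snd := fun x => rfl
  have hsurj : Function.Surjective W := by
    have hc : IsClosed ((LinearMap.range W.toLinearMap : Submodule ℂ K) : Set K) := by
      rw [LinearMap.coe_range]
      exact W.isometry.isClosedEmbedding.isClosed_range
    have := hc.completeSpace_coe
    have htop : LinearMap.range W.toLinearMap = ⊤ := by
      rw [← Submodule.orthogonal_eq_bot_iff, Submodule.eq_bot_iff]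
      intro x hx
      refine hf.total x (fun n => ?_) fun n => ?_
      · refine hx _ ⟨WithLp.toLp 2 (e n, 0), ?_⟩
        change J₁ (e n) + J₂ 0 = _
        rw [map_zero, add_zero, hJ₁]
      · refine hx _ ⟨WithLp.toLp 2 (0, e n), ?_⟩
        change J₁ 0 + J₂ (e n) = _
        rw [map_zero, zero_add, hJ₂]
    exact LinearMap.range_eq_top.1 htop
  let U := LinearIsometryEquiv.ofSurjective W hsurj
  refine ⟨T₁, S, T₂, e₁, e₂, e₃, U.symm, fun x => ?_⟩
  obtain ⟨y, rfl⟩ := U.surjective x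
  rw [U.symm_apply_apply, LinearIsometryEquiv.symm_apply_eq]
  change T (J₁ y.fst + J₂ y.snd) = J₁ (T₁ y.fst + S y.snd) + J₂ (T₂ y.snd)
  rw [map_add, map_add, c₁, c₂]
  abel

end TwoShift

namespace TwoShift

open scoped InnerProductSpace ComplexConjugate
open Filter Topology

variable {K : Type*} [NormedAddCommGroup K] [InnerProductSpace ℂ K] [CompleteSpace K]

variable {T : K →L[ℂ] K}

/-- A quadratic which is positive on the integers has, up to an integer translation, two roots in
`(-1, 0)` or two conjugate non-real roots. -/
lemma quadratic_cases {k γ : ℝ} (h : ∀ n : ℤ, 0 < (n : ℝ) ^ 2 + k * n + γ) : ∃ m : ℤ,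
    (∃ a b : ℝ, 0 < a ∧ a ≤ b ∧ b < 1 ∧ k + 2 * m = a + b ∧ (m : ℝ) ^ 2 + k * m + γ = a * b) ∨
    ∃ x a : ℝ, 0 < x ∧ x ≤ 1 ∧ 0 < a ∧ k + 2 * m = 2 * x ∧
      (m : ℝ) ^ 2 + k * m + γ = x ^ 2 + a ^ 2 := by
  rcases le_or_gt 0 (k ^ 2 - 4 * γ) with hD | hD
  · set r := Real.sqrt (k ^ 2 - 4 * γ) with hr
    have hr0 : 0 ≤ r := Real.sqrt_nonneg _
    have hr2 : r ^ 2 = k ^ 2 - 4 * γ := Real.sq_sqrt hD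
    set p := (k - r) / 2 with hp
    set q := (k + r) / 2 with hq
    have hpq : p + q = k := by rw [hp, hq]; ring
    have hpq' : p * q = γ := by rw [hp, hq]; linarith
    have hle : p ≤ q := by rw [hp, hq]; linarith
    have hpos : ∀ n : ℤ, 0 < (n + p) * (n + q) := fun n => by
      have := h n
      rw [← hpq, ← hpq'] at this
      linarith
    have hfl := floor_eq_of_pos hpos
    have h1 := hpos (-⌊p⌋)
    push_cast at h1
    have h2 := Int.floor_le p
    have h3 := Int.lt_floor_add_one q
    rw [← hfl] at h3
    refine ⟨-⌊p⌋, Or.inl ⟨p - ⌊p⌋, q - ⌊p⌋, ?_, by linarith, by linarith, ?_, ?_⟩⟩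
    · have : p - ⌊p⌋ ≠ 0 := fun h0 => by
        rw [show -(⌊p⌋ : ℝ) + p = p - ⌊p⌋ by ring, h0, zero_mul] at h1
        exact lt_irrefl _ h1
      exact lt_of_le_of_ne (by linarith) this.symm
    · push_cast; linarith
    · push_cast; rw [← hpq, ← hpq']; ring
  · have h1 := Int.ceil_lt_add_one (k / 2)
    have h2 := Int.le_ceil (k / 2)
    refine ⟨1 - ⌈k / 2⌉, Or.inr ⟨k / 2 + 1 - ⌈k / 2⌉, Real.sqrt (-(k ^ 2 - 4 * γ)) / 2, by linarith,
      by linarith, by have := Real.sqrt_pos.2 (neg_pos.2 hD); positivity, ?_, ?_⟩⟩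
    · push_cast; ring
    · push_cast
      rw [div_pow, Real.sq_sqrt (by linarith)]
      ring

lemma weight_sq {a b : ℝ} {n : ℤ} (hab : 0 < ((n : ℝ) + a) * (n + b)) :
    ∃ ω : ℂ, ‖ω‖ ^ 2 = (n + a) * (n + b) ∧ ω / (n + b) = wT a b n ∧ ω / (n + a) = wT b a n := by
  have hb : (n : ℝ) + b ≠ 0 := right_ne_zero_of_mul hab.ne'
  have ha : (n : ℝ) + a ≠ 0 := left_ne_zero_of_mul hab.ne'
  have hdiv : 0 < ((n : ℝ) + a) / (n + b) := by
    rw [show ((n : ℝ) + a) / (n + b) = (n + a) * (n + b) / (n + b) ^ 2 by field_simp]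
    positivity
  set r := Real.sqrt ((n + a) / (n + b)) with hr
  have hr2 : r ^ 2 = (n + a) / (n + b) := Real.sq_sqrt hdiv.le
  have hr0 : r ≠ 0 := (Real.sqrt_pos.2 hdiv).ne'
  have hinv : Real.sqrt ((n + b) / (n + a)) = r⁻¹ := by rw [hr, ← Real.sqrt_inv, inv_div]
  refine ⟨((r * (n + b) : ℝ) : ℂ), ?_, ?_, ?_⟩
  · rw [Complex.norm_real, Real.norm_eq_abs, sq_abs, mul_pow, hr2]
    field_simp
  · rw [wT, ← hr]
    have : (n : ℂ) + b ≠ 0 := by exact_mod_cast hb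
    push_cast
    field_simp
  · rw [wT, hinv]
    have h1 : r * (n + b) / (n + a) = r⁻¹ := by
      rw [eq_comm, inv_eq_iff_eq_inv, inv_div, eq_div_iff (by positivity)]
      have : r * (r * (n + b)) = r ^ 2 * (n + b) := by ring
      rw [this, hr2]
      field_simp
    rw [← h1]
    push_cast
    rfl

lemma HasNormalForm.real_case {a b : ℝ} (h : HasNormalForm T (a + b) (a * b)) (hab : a < b) :
    ∃ α : ℝ, 0 < α ∧ ∃ T₁ T₂ : H →L[ℂ] H, (∀ n : ℤ, T₁ (e n) = wT a b n • e (n + 1)) ∧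
      (∀ n : ℤ, T₂ (e n) = wT b a n • e (n + 1)) ∧
      UnitarilyEquiv T (blockOp T₁ ((α : ℂ) • (T₁ - T₂)) T₂) := by
  have hpos : ∀ n : ℤ, 0 < ((n : ℝ) + a) * (n + b) := fun n => by
    have := h.1 n
    linarith
  choose ω hω hω₁ hω₂ using fun n => weight_sq (hpos n)
  obtain ⟨f₁, f₂, t, ht, hf, h₁, h₂⟩ := h.2 b a 1 ω (by push_cast; ring) (by push_cast; ring)
    norm_one (fun n => by rw [hω]; ring)
  obtain ⟨T₁, S, T₂, e₁, e₂, e₃, hU⟩ := hf.unitarilyEquiv h₁ h₂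
  have hba : (b : ℂ) - a ≠ 0 := by rw [sub_ne_zero]; exact_mod_cast hab.ne'
  have hS : S = ((t / (b - a) : ℝ) : ℂ) • (T₁ - T₂) := ext_e fun n => by
    change S (e n) = ((t / (b - a) : ℝ) : ℂ) • (T₁ (e n) - T₂ (e n))
    rw [e₁, e₂, e₃, ← sub_smul, smul_smul]
    congr 1
    have hb : (n : ℂ) + b ≠ 0 := by exact_mod_cast right_ne_zero_of_mul (hpos n).ne'
    have ha : (n : ℂ) + a ≠ 0 := by exact_mod_cast left_ne_zero_of_mul (hpos n).ne'
    push_cast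
    field_simp
    ring
  rw [hS] at hU
  exact ⟨t / (b - a), div_pos ht (sub_pos.2 hab), T₁, T₂, fun n => by rw [e₁, hω₁],
    fun n => by rw [e₃, hω₂], hU⟩

lemma HasNormalForm.complex_case {x a : ℝ} (h : HasNormalForm T (2 * x) (x ^ 2 + a ^ 2))
    (ha : 0 < a) : ∃ α : ℝ, 0 < α ∧
      ∃ B₁ B₀ : H →L[ℂ] H, (∀ n : ℤ, B₁ (e n) = wB (2 * x - 1) a n • e (n + 1)) ∧
        (∀ n : ℤ, B₀ (e n) = e (n + 1)) ∧
        UnitarilyEquiv T (blockOp B₁ ((α : ℂ) • (B₁ - B₀)) B₀) := by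
  have hne : ∀ n : ℤ, ((n : ℂ) + (x - Complex.I * a) ≠ 0) ∧ ((n : ℂ) + (x + Complex.I * a) ≠ 0) :=
    fun n => ⟨fun h0 => by simpa [ha.ne'] using congrArg Complex.im h0,
      fun h0 => by simpa [ha.ne'] using congrArg Complex.im h0⟩
  obtain ⟨f₁, f₂, t, ht, hf, h₁, h₂⟩ := h.2 (x - Complex.I * a) (x + Complex.I * a) (-Complex.I)
    (fun n => n + (x + Complex.I * a)) (by push_cast; ring)
    (by push_cast; linear_combination (-(a : ℂ) ^ 2) * Complex.I_sq) (by simp) (fun n => by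
      rw [← Complex.normSq_eq_norm_sq, Complex.normSq_apply]
      simp
      ring)
  obtain ⟨T₁, S, T₂, e₁, e₂, e₃, hU⟩ := hf.unitarilyEquiv h₁ h₂
  have hS : S = ((t / (2 * a) : ℝ) : ℂ) • (T₁ - T₂) := ext_e fun n => by
    change S (e n) = ((t / (2 * a) : ℝ) : ℂ) • (T₁ (e n) - T₂ (e n))
    rw [e₁, e₂, e₃, ← sub_smul, smul_smul]
    congr 1
    obtain ⟨hp, hq⟩ := hne n
    have ha0 : (a : ℂ) ≠ 0 := by exact_mod_cast ha.ne'
    push_cast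
    field_simp
    ring
  rw [hS] at hU
  refine ⟨t / (2 * a), by positivity, T₁, T₂, fun n => ?_, fun n => ?_, hU⟩
  · rw [e₁, wB]
    congr 1
    push_cast
    ring
  · rw [e₃, div_self (hne n).2, one_smul]

lemma HasNormalForm.double_case {x : ℝ} (h : HasNormalForm T (x + x) (x * x)) : ∃ α : ℝ, 0 < α ∧
      ∃ B₀ Sl : H →L[ℂ] H, (∀ n : ℤ, B₀ (e n) = e (n + 1)) ∧
        (∀ n : ℤ, Sl (e n) = wS (2 * x - 1) n • e (n + 1)) ∧
        UnitarilyEquiv T (blockOp B₀ ((α : ℂ) • Sl) B₀) := by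
  have hne : ∀ n : ℤ, (n : ℂ) + x ≠ 0 := fun n h0 => by
    have h1 : (n : ℝ) + x = 0 := by exact_mod_cast h0
    have h2 := h.1 n
    nlinarith
  obtain ⟨f₁, f₂, t, ht, hf, h₁, h₂⟩ := h.2 x x (-1) (fun n => n + x) (by push_cast; ring)
    (by push_cast; ring) (by simp) (fun n => by
      rw [← Complex.normSq_eq_norm_sq, Complex.normSq_apply]
      simp
      ring)
  obtain ⟨T₁, S, T₂, e₁, e₂, e₃, hU⟩ := hf.unitarilyEquiv h₁ h₂
  have e₁' : ∀ n, T₁ (e n) = e (n + 1) := fun n => by rw [e₁, div_self (hne n), one_smul]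
  have hT : T₂ = T₁ := ext_e fun n => by rw [e₁, e₃]
  have ht0 : ((2 * t : ℝ) : ℂ) ≠ 0 := by exact_mod_cast (by positivity : 2 * t ≠ 0)
  refine ⟨2 * t, by positivity, T₁, ((2 * t : ℝ) : ℂ)⁻¹ • S, e₁', fun n => ?_, ?_⟩
  · change ((2 * t : ℝ) : ℂ)⁻¹ • S (e n) = _
    rw [e₂, smul_smul, wS]
    congr 1
    have h1 := hne n
    have h2 : ((2 * x - 1 : ℝ) : ℂ) + 2 * n + 1 ≠ 0 := by
      rw [show ((2 * x - 1 : ℝ) : ℂ) + 2 * n + 1 = 2 * (n + x) by push_cast; ring]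
      exact mul_ne_zero two_ne_zero h1
    have h3 : (t : ℂ) ≠ 0 := by exact_mod_cast ht.ne'
    rw [show ((2 * x - 1 : ℝ) : ℂ) + 2 * n + 1 = 2 * (n + x) by push_cast; ring]
    push_cast
    field_simp
  · rw [smul_inv_smul₀ ht0]
    rwa [hT] at hU

lemma exists_model [TopologicalSpace.SeparableSpace K] (hirr : IrreducibleOp T)
    (hhom : Homogeneous T) {G : ℤ → Submodule ℂ K} (hG : IsGrading G)
    (hshift : ∀ n, ∀ x ∈ G n, T x ∈ G (n + 1))
    (hdim : {n : ℤ | Module.finrank ℂ (G n) ≠ 2}.Finite) : ∃ E F κ, Model T G E F κ := by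
  choose! V hV using fun (z : ℂ) (hz : ‖z‖ < 1) => exists_impl hhom hz
  have hB : ∃ B : ℤ, ∀ n, B < |n| → Module.finrank ℂ (G n) = 2 := by
    obtain ⟨B, hB⟩ := (hdim.image fun n => |n|).bddAbove
    refine ⟨B, fun n hn => ?_⟩
    by_contra hne
    exact absurd (hB ⟨n, hne, rfl⟩) (not_le.2 hn)
  have : Nontrivial K := by
    obtain ⟨B, hB⟩ := hB
    have h2 := hB (|B| + 1) (by
      rw [abs_of_nonneg (by positivity)]
      linarith [le_abs_self B])
    have : Nontrivial (G (|B| + 1)) := Module.nontrivial_of_finrank_pos (R := ℂ) (by omega)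
    exact (G (|B| + 1)).injective_subtype.nontrivial
  exact Setup.exists_model (V := V) ⟨hirr, fun c hc => (hhom.2 0 c hc).1, hV, hG, hshift⟩ hB

end TwoShift

/-- every irreducible homogeneous bilateral 2-shift is, up to unitary
equivalence, one of `T(a, b, α)`, `B(λ, ia, α)` or `B(λ, α)`. -/
theorem stmt0 {K : Type*} [NormedAddCommGroup K] [InnerProductSpace ℂ K] [CompleteSpace K]
    [TopologicalSpace.SeparableSpace K] (T : K →L[ℂ] K)
    (hirr : IrreducibleOp T) (hhom : Homogeneous T)
    (Ksub : ℤ → Submodule ℂ K)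
    (hclosed : ∀ n, IsClosed (Ksub n : Set K))
    (horth : ∀ m n, m ≠ n → ∀ x ∈ Ksub m, ∀ y ∈ Ksub n, @inner ℂ K _ x y = 0)
    (hspan : (⨆ n, Ksub n).topologicalClosure = ⊤)
    (hshift : ∀ n, ∀ x ∈ Ksub n, T x ∈ Ksub (n + 1))
    (hdim : {n : ℤ | Module.finrank ℂ (Ksub n) ≠ 2}.Finite) :
    (∃ a b α : ℝ, 0 < a ∧ a < b ∧ b < 1 ∧ 0 < α ∧
      ∃ T₁ T₂ : H →L[ℂ] H, (∀ n : ℤ, T₁ (e n) = wT a b n • e (n + 1)) ∧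
        (∀ n : ℤ, T₂ (e n) = wT b a n • e (n + 1)) ∧
        UnitarilyEquiv T (blockOp T₁ ((α : ℂ) • (T₁ - T₂)) T₂)) ∨
    (∃ l a α : ℝ, -1 < l ∧ l ≤ 1 ∧ 0 < a ∧ 0 < α ∧
      ∃ B₁ B₀ : H →L[ℂ] H, (∀ n : ℤ, B₁ (e n) = wB l a n • e (n + 1)) ∧
        (∀ n : ℤ, B₀ (e n) = e (n + 1)) ∧
        UnitarilyEquiv T (blockOp B₁ ((α : ℂ) • (B₁ - B₀)) B₀)) ∨
    (∃ l α : ℝ, -1 < l ∧ l < 1 ∧ 0 < α ∧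
      ∃ B₀ Sl : H →L[ℂ] H, (∀ n : ℤ, B₀ (e n) = e (n + 1)) ∧
        (∀ n : ℤ, Sl (e n) = wS l n • e (n + 1)) ∧
        UnitarilyEquiv T (blockOp B₀ ((α : ℂ) • Sl) B₀)) := by
  obtain ⟨E, F, κ, hM⟩ := TwoShift.exists_model hirr hhom ⟨hclosed, horth, hspan⟩ hshift hdim
  obtain ⟨k, γ, hNF⟩ := hM.exists_normalForm
  obtain ⟨m, ⟨a, b, ha, hab, hb, hk, hγ⟩ | ⟨x, a, hx0, hx1, ha, hk, hγ⟩⟩ :=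
    TwoShift.quadratic_cases hNF.1
  · have h := hNF.shift m
    rw [hk, hγ] at h
    rcases hab.eq_or_lt with rfl | hlt
    · obtain ⟨α, hα, h⟩ := h.double_case
      exact Or.inr (Or.inr ⟨2 * a - 1, α, by linarith, by linarith, hα, h⟩)
    · obtain ⟨α, hα, h⟩ := h.real_case hlt
      exact Or.inl ⟨a, b, α, ha, hlt, hb, hα, h⟩
  · have h := hNF.shift m
    rw [hk, hγ] at h
    obtain ⟨α, hα, h⟩ := h.complex_case ha
    exact Or.inr (Or.inl ⟨2 * x - 1, a, α, by linarith, by linarith, ha, hα, h⟩)
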